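/- Let R be a Cohen–Macaulay Noetherian local ring with dualizing module ω, M a maximal Cohen–Macaulay R-module, and x = (x₁,…,xₙ) an R-regular sequence. Then M has finite Gorenstein injective dimension over R if and only if M/xM has finite Gorenstein injective dimension over R/xR. -/

import Mathlib

universe u

namespace GG

open RingTheory.Sequence

variable (R : Type u) [CommRing R]

/-- A module `N` is Gorenstein injective if it is a kernel in a `Hom(Inj,−)`-exact exact
doubly infinite complex of injective modules. -/
def IsGorensteinInjective (N : Type u) [AddCommGroup N] [Module R N] : Prop :=
  ∃ (X : ℤ → ModuleCat.{u} R) (d : ∀ n : ℤ, X n →ₗ[R] X (n + 1)),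
    (∀ n, Module.Injective R (X n)) ∧
    (∀ n, LinearMap.range (d n) = LinearMap.ker (d (n + 1))) ∧
    (∀ (I : ModuleCat.{u} R), Module.Injective R I →
      ∀ (n : ℤ) (φ : I →ₗ[R] X (n + 1)), (d (n + 1)).comp φ = 0 →
        ∃ ψ : I →ₗ[R] X n, (d n).comp ψ = φ) ∧
    Nonempty (N ≃ₗ[R] LinearMap.ker (d 0))

/-- A module `N` is Gorenstein projective if it is a kernel in a `Hom(−,Proj)`-exact exact
doubly infinite complex of projective modules. -/
def IsGorensteinProjective (N : Type u) [AddCommGroup N] [Module R N] : Prop :=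
  ∃ (X : ℤ → ModuleCat.{u} R) (d : ∀ n : ℤ, X n →ₗ[R] X (n + 1)),
    (∀ n, Module.Projective R (X n)) ∧
    (∀ n, LinearMap.range (d n) = LinearMap.ker (d (n + 1))) ∧
    (∀ (P : ModuleCat.{u} R), Module.Projective R P →
      ∀ (n : ℤ) (φ : X (n + 1) →ₗ[R] P), φ.comp (d n) = 0 →
        ∃ ψ : X (n + 1 + 1) →ₗ[R] P, ψ.comp (d (n + 1)) = φ) ∧
    Nonempty (N ≃ₗ[R] LinearMap.ker (d 0))

/-- A module `N` is Gorenstein flat if it is a kernel in an `(Inj ⊗ −)`-exact exact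
doubly infinite complex of flat modules. -/
def IsGorensteinFlat (N : Type u) [AddCommGroup N] [Module R N] : Prop :=
  ∃ (X : ℤ → ModuleCat.{u} R) (d : ∀ n : ℤ, X n →ₗ[R] X (n + 1)),
    (∀ n, Module.Flat R (X n)) ∧
    (∀ n, LinearMap.range (d n) = LinearMap.ker (d (n + 1))) ∧
    (∀ (I : ModuleCat.{u} R), Module.Injective R I →
      ∀ n : ℤ, LinearMap.range (LinearMap.lTensor (R := R) I (d n)) =
        LinearMap.ker (LinearMap.lTensor (R := R) I (d (n + 1)))) ∧
    Nonempty (N ≃ₗ[R] LinearMap.ker (d 0))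

/-- Existence of a right resolution of length `≤ n` by modules satisfying `P`. -/
def CoresolutionLE (P : ModuleCat.{u} R → Prop) (M : Type u) [AddCommGroup M] [Module R M]
    (n : ℕ) : Prop :=
  ∃ (G : ℕ → ModuleCat.{u} R) (d : ∀ i : ℕ, G i →ₗ[R] G (i + 1)) (ε : M →ₗ[R] G 0),
    (∀ i, P (G i)) ∧ Function.Injective ε ∧
    LinearMap.range ε = LinearMap.ker (d 0) ∧
    (∀ i, LinearMap.range (d i) = LinearMap.ker (d (i + 1))) ∧
    (∀ i, n < i → ∀ x : G i, x = 0)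

/-- Existence of a left resolution of length `≤ n` by modules satisfying `P`. -/
def ResolutionLE (P : ModuleCat.{u} R → Prop) (M : Type u) [AddCommGroup M] [Module R M]
    (n : ℕ) : Prop :=
  ∃ (G : ℕ → ModuleCat.{u} R) (d : ∀ i : ℕ, G (i + 1) →ₗ[R] G i) (ε : G 0 →ₗ[R] M),
    (∀ i, P (G i)) ∧ Function.Surjective ε ∧
    LinearMap.ker ε = LinearMap.range (d 0) ∧
    (∀ i, LinearMap.ker (d i) = LinearMap.range (d (i + 1))) ∧
    (∀ i, n < i → ∀ x : G i, x = 0)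

/-- `Gid_R M ≤ n`. -/
def gidLE (M : Type u) [AddCommGroup M] [Module R M] (n : ℕ) : Prop :=
  CoresolutionLE R (fun N => IsGorensteinInjective R N) M n

/-- `id_R M ≤ n`. -/
def idLE (M : Type u) [AddCommGroup M] [Module R M] (n : ℕ) : Prop :=
  CoresolutionLE R (fun N => Module.Injective R N) M n

/-- `pd_R M ≤ n`. -/
def pdLE (M : Type u) [AddCommGroup M] [Module R M] (n : ℕ) : Prop :=
  ResolutionLE R (fun N => Module.Projective R N) M n

/-- `fd_R M ≤ n`. -/
def fdLE (M : Type u) [AddCommGroup M] [Module R M] (n : ℕ) : Prop :=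
  ResolutionLE R (fun N => Module.Flat R N) M n

/-- `Gfd_R M ≤ n`. -/
def gfdLE (M : Type u) [AddCommGroup M] [Module R M] (n : ℕ) : Prop :=
  ResolutionLE R (fun N => IsGorensteinFlat R N) M n

/-- Gorenstein injective dimension, as an extended natural number. -/
noncomputable def gid (M : Type u) [AddCommGroup M] [Module R M] : ℕ∞ :=
  sInf {c : ℕ∞ | ∃ n : ℕ, c = n ∧ gidLE R M n}

/-- The depth of a module over a local ring: the supremum of the lengths of regular
sequences contained in the maximal ideal. -/
noncomputable def mdepth [IsLocalRing R] (M : Type u) [AddCommGroup M] [Module R M] : ℕ∞ :=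
  sSup {c : ℕ∞ | ∃ rs : List R, c = rs.length ∧
    (∀ r ∈ rs, r ∈ IsLocalRing.maximalIdeal R) ∧ RingTheory.Sequence.IsRegular M rs}

/-- The Krull dimension of a module: the Krull dimension of its support. -/
noncomputable def mdim (M : Type u) [AddCommGroup M] [Module R M] : WithBot ℕ∞ :=
  Order.krullDim ↥(Module.support R M)

/-- The height of a prime in the support of `M`. -/
noncomputable def htM (M : Type u) [AddCommGroup M] [Module R M] (p : PrimeSpectrum R) : ℕ∞ :=
  ⨆ h : p ∈ Module.support R M, Order.height (⟨p, h⟩ : ↥(Module.support R M))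

/-- A Cohen–Macaulay module over a local ring: depth equals Krull dimension. -/
def IsCMModule [IsLocalRing R] (M : Type u) [AddCommGroup M] [Module R M] : Prop :=
  (mdepth R M : WithBot ℕ∞) = mdim R M

/-- A maximal Cohen–Macaulay module over a local ring. -/
def IsMaximalCM [IsLocalRing R] (M : Type u) [AddCommGroup M] [Module R M] : Prop :=
  IsCMModule R M ∧ mdim R M = ringKrullDim R

/-- A Cohen–Macaulay local ring. -/
def IsCMLocalRing [IsLocalRing R] : Prop :=
  (mdepth R R : WithBot ℕ∞) = ringKrullDim R

/-- A Gorenstein local ring: a Noetherian local ring of finite self-injective dimension. -/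
def IsGorensteinLocalRing [IsLocalRing R] : Prop :=
  IsNoetherianRing R ∧ ∃ n : ℕ, idLE R R n

/-- A regular local ring: Noetherian, and the maximal ideal is generated by `dim R` elements. -/
def IsRegularLocal [IsLocalRing R] : Prop :=
  IsNoetherianRing R ∧ ∃ s : Finset R, Ideal.span (s : Set R) = IsLocalRing.maximalIdeal R ∧
    (s.card : WithBot ℕ∞) = ringKrullDim R

/-- A (not necessarily local) Gorenstein ring: all localizations at primes are Gorenstein. -/
def IsGorensteinRing : Prop :=
  ∀ p : PrimeSpectrum R, ∃ n : ℕ,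
    idLE (Localization.AtPrime p.asIdeal) (Localization.AtPrime p.asIdeal) n

/-- `R` admits a dualizing complex; by Kawasaki's theorem this is equivalent to being a
homomorphic image of a finite-dimensional Gorenstein ring. -/
def HasDualizingComplex : Prop :=
  ∃ Q : CommRingCat.{u}, IsNoetherianRing Q ∧ ringKrullDim Q < ⊤ ∧ IsGorensteinRing Q ∧
    ∃ f : Q →+* R, Function.Surjective f

section Cousin

/-- The product of the localizations of `N` at the primes in `S`. -/
noncomputable abbrev locProd (S : Set (PrimeSpectrum R)) (N : Type u) [AddCommGroup N]
    [Module R N] : Type u :=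
  Π p : S, LocalizedModule p.1.asIdeal.primeCompl N

/-- The submodule of the product of localizations consisting of finitely supported families;
this is the direct sum `⊕_{p ∈ S} N_p`. -/
noncomputable def finSupp (S : Set (PrimeSpectrum R)) (N : Type u) [AddCommGroup N]
    [Module R N] : Submodule R (locProd R S N) where
  carrier := {f | {p : S | f p ≠ 0}.Finite}
  add_mem' := by
    intro f g hf hg
    refine (hf.union hg).subset ?_
    intro p hp
    by_contra h
    simp only [Set.mem_union, Set.mem_setOf_eq, not_or, not_not] at h
    exact hp (by simp [Pi.add_apply, h.1, h.2])
  zero_mem' := by simp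
  smul_mem' := by
    intro c f hf
    refine hf.subset ?_
    intro p hp
    by_contra h
    simp only [Set.mem_setOf_eq, not_not] at h
    exact hp (by simp [Pi.smul_apply, h])

/-- The canonical map `N → ∏_{p ∈ S} N_p`. -/
noncomputable def thetaFull (S : Set (PrimeSpectrum R)) (N : Type u) [AddCommGroup N]
    [Module R N] : N →ₗ[R] locProd R S N :=
  LinearMap.pi fun p => LocalizedModule.mkLinearMap p.1.asIdeal.primeCompl N

/-- The cokernel of `N → ⊕_{p ∈ S} N_p` (computed inside the direct sum). -/
noncomputable abbrev nextKType (S : Set (PrimeSpectrum R)) (N : Type u) [AddCommGroup N]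
    [Module R N] : Type u :=
  ↥(finSupp R S N) ⧸
    (Submodule.comap (finSupp R S N).subtype (LinearMap.range (thetaFull R S N)))

/-- The sequence of "kernel/cokernel" modules in the inductive construction
of the Cousin complex of `M` with respect to the filtration `F`. -/
noncomputable def cousinK (F : ℕ → Set (PrimeSpectrum R)) (M : ModuleCat.{u} R) :
    ℕ → ModuleCat.{u} R
  | 0 => M
  | n + 1 => ModuleCat.of R (nextKType R (F n \ F (n + 1)) (cousinK F M n))

/-- The `n`-th term `M^n = ⊕_{p ∈ ∂F_n} (coker d^{n-2})_p` of the Cousin complex. -/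
noncomputable abbrev cousinC (F : ℕ → Set (PrimeSpectrum R)) (M : ModuleCat.{u} R) (n : ℕ) :
    Type u :=
  ↥(finSupp R (F n \ F (n + 1)) (cousinK R F M n))

/-- The canonical map from the `n`-th cokernel into the product of its localizations. -/
noncomputable def cousinTheta (F : ℕ → Set (PrimeSpectrum R)) (M : ModuleCat.{u} R) (n : ℕ) :
    (cousinK R F M n) →ₗ[R] locProd R (F n \ F (n + 1)) (cousinK R F M n) :=
  thetaFull R _ _

/-- The (full) `n`-th differential of the Cousin complex, from `M^n` to the product at
level `n+1` (it lands inside the direct sum `M^{n+1}`). -/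
noncomputable def cousinD (F : ℕ → Set (PrimeSpectrum R)) (M : ModuleCat.{u} R) (n : ℕ) :
    (cousinC R F M n) →ₗ[R] locProd R (F (n + 1) \ F (n + 2)) (cousinK R F M (n + 1)) :=
  (cousinTheta R F M (n + 1)).comp
    (Submodule.mkQ (Submodule.comap (finSupp R (F n \ F (n + 1)) (cousinK R F M n)).subtype
      (LinearMap.range (thetaFull R (F n \ F (n + 1)) (cousinK R F M n)))))

/-- `F` is a filtration of `Spec R`: descending, and every element of `∂F_n = F_n \ F_{n+1}`
is a minimal member of `F_n`. -/
def IsFiltration (F : ℕ → Set (PrimeSpectrum R)) : Prop :=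
  (∀ n, F (n + 1) ⊆ F n) ∧
    ∀ n, ∀ p ∈ F n \ F (n + 1), ∀ q ∈ F n, q ≤ p → q = p

/-- The filtration `F` admits `M`. -/
def Admits (F : ℕ → Set (PrimeSpectrum R)) (M : Type u) [AddCommGroup M] [Module R M] : Prop :=
  Module.support R M ⊆ F 0

/-- The `M`-height filtration `K_i = {p ∈ Supp M | ht_M p ≥ i}`. -/
noncomputable def heightFiltration (M : Type u) [AddCommGroup M] [Module R M] :
    ℕ → Set (PrimeSpectrum R) :=
  fun i => {p | p ∈ Module.support R M ∧ (i : ℕ∞) ≤ htM R M p}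

/-- The Cousin complex `C(F, M)` is exact at `M, M⁰, …, M^t`
(together with the well-definedness of the differentials into the direct sums). -/
def CousinPartiallyExact (F : ℕ → Set (PrimeSpectrum R)) (M : ModuleCat.{u} R) (t : ℕ) : Prop :=
  (∀ n, LinearMap.range (cousinTheta R F M n) ≤ finSupp R (F n \ F (n + 1)) (cousinK R F M n)) ∧
  Function.Injective (cousinTheta R F M 0) ∧
  (∀ n ≤ t, LinearMap.ker (cousinD R F M n) =
    Submodule.comap (finSupp R (F n \ F (n + 1)) (cousinK R F M n)).subtype
      (LinearMap.range (cousinTheta R F M n)))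

/-- The Cousin complex `C(F, M)` is exact and all of its terms satisfy `P`, i.e. it provides
a `P`-resolution of `M`. -/
def CousinResolves (F : ℕ → Set (PrimeSpectrum R)) (M : ModuleCat.{u} R)
    (P : ModuleCat.{u} R → Prop) : Prop :=
  (∀ n, LinearMap.range (cousinTheta R F M n) ≤ finSupp R (F n \ F (n + 1)) (cousinK R F M n)) ∧
  Function.Injective (cousinTheta R F M 0) ∧
  (∀ n, LinearMap.ker (cousinD R F M n) =
    Submodule.comap (finSupp R (F n \ F (n + 1)) (cousinK R F M n)).subtype
      (LinearMap.range (cousinTheta R F M n))) ∧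
  (∀ n, P (ModuleCat.of R (cousinC R F M n)))

/-- A G–Gorenstein module: a nonzero finitely generated module whose Cousin complex with
respect to the `M`-height filtration is a Gorenstein injective resolution. -/
def IsGGorenstein (M : ModuleCat.{u} R) : Prop :=
  (∃ x : M, x ≠ 0) ∧ Module.Finite R M ∧
    CousinResolves R (heightFiltration R M) M (fun N => IsGorensteinInjective R N)

/-- A Gorenstein module: a nonzero finitely generated module whose Cousin complex with
respect to the `M`-height filtration is an injective resolution. -/
def IsGorensteinModule (M : ModuleCat.{u} R) : Prop :=
  (∃ x : M, x ≠ 0) ∧ Module.Finite R M ∧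
    CousinResolves R (heightFiltration R M) M (fun N => Module.Injective R N)

end Cousin

/-- A system of parameters of a local ring. -/
def IsSOP [IsLocalRing R] (rs : List R) : Prop :=
  (rs.length : WithBot ℕ∞) = ringKrullDim R ∧
    (∀ r ∈ rs, r ∈ IsLocalRing.maximalIdeal R) ∧
    IsLocalRing.maximalIdeal R ≤ (Ideal.span {r | r ∈ rs}).radical

/-- A balanced big Cohen–Macaulay module: every system of parameters of `R` is a regular
sequence on `M`. -/
def IsBalancedBigCM [IsLocalRing R] (M : Type u) [AddCommGroup M] [Module R M] : Prop :=
  ∀ rs : List R, IsSOP R rs → RingTheory.Sequence.IsRegular M rs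

end GG

namespace HH
open Function

section Act
variable {R : Type u} [CommRing R]

/-- The matrix `A` acting on vectors with entries in a module. -/
def act {m n : ℕ} (A : Matrix (Fin m) (Fin n) R) (L : Type u) [AddCommGroup L] [Module R L] :
    (Fin n → L) →ₗ[R] (Fin m → L) where
  toFun v i := ∑ j, A i j • v j
  map_add' v w := by
    funext i; simp [Finset.sum_add_distrib]
  map_smul' r v := by
    funext i; simp [Finset.smul_sum, smul_comm r]

variable {L L' : Type u} [AddCommGroup L] [Module R L] [AddCommGroup L'] [Module R L']

lemma act_apply {m n : ℕ} (A : Matrix (Fin m) (Fin n) R) (v : Fin n → L) (i : Fin m) :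
    act A L v i = ∑ j, A i j • v j := rfl

lemma act_nat {m n : ℕ} (A : Matrix (Fin m) (Fin n) R) (f : L →ₗ[R] L') (v : Fin n → L) :
    act A L' (fun j => f (v j)) = fun i => f (act A L v i) := by
  funext i; simp [act_apply]

lemma act_mul {l m n : ℕ} (A : Matrix (Fin l) (Fin m) R) (B : Matrix (Fin m) (Fin n) R)
    (v : Fin n → L) : act A L (act B L v) = act (A * B) L v := by
  funext i
  simp only [act_apply, Matrix.mul_apply, Finset.smul_sum, Finset.sum_smul, mul_smul]
  exact Finset.sum_comm

lemma act_eq_mulVec {m n : ℕ} (A : Matrix (Fin m) (Fin n) R) (v : Fin n → R) :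
    act A R v = A.mulVec v := by
  funext i; simp [act_apply, Matrix.mulVec, dotProduct]

/-- composition zero on `R` means the matrix product is zero. -/
lemma mul_eq_zero_of_R {l m n : ℕ} (A : Matrix (Fin l) (Fin m) R) (B : Matrix (Fin m) (Fin n) R)
    (h : ∀ v : Fin n → R, act A R (act B R v) = 0) : A * B = 0 := by
  ext i j
  have := congrFun (h (Pi.single j 1)) i
  rw [act_mul, act_apply] at this
  simpa [Pi.single_apply] using this

/-- the map `R^n → L` given by a family. -/
def comb {n : ℕ} (e : Fin n → L) : (Fin n → R) →ₗ[R] L where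
  toFun v := ∑ j, v j • e j
  map_add' v w := by simp [add_smul, Finset.sum_add_distrib]
  map_smul' r v := by simp [Finset.smul_sum, mul_smul]

lemma comb_apply {n : ℕ} (e : Fin n → L) (v : Fin n → R) : comb e v = ∑ j, v j • e j := rfl

/-- linear maps out of `U^n` as vectors of linear maps. -/
lemma exists_hom_vec {n : ℕ} (φ : (Fin n → L) →ₗ[R] L') :
    ∃ f : Fin n → (L →ₗ[R] L'), ∀ v, φ v = ∑ j, f j (v j) := by
  refine ⟨fun j => φ.comp (LinearMap.single R (fun _ => L) j), fun v => ?_⟩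
  conv_lhs => rw [← Finset.univ_sum_single v]
  simp

/-- the linear map out of `L^n` given by a vector of linear maps. -/
def sumHom {n : ℕ} (f : Fin n → (L →ₗ[R] L')) : (Fin n → L) →ₗ[R] L' where
  toFun v := ∑ j, f j (v j)
  map_add' v w := by simp [Finset.sum_add_distrib]
  map_smul' r v := by simp [Finset.smul_sum]

lemma sumHom_apply {n : ℕ} (f : Fin n → (L →ₗ[R] L')) (v : Fin n → L) :
    sumHom f v = ∑ j, f j (v j) := rfl

lemma sumHom_act {m n : ℕ} (A : Matrix (Fin m) (Fin n) R) (f : Fin m → (L →ₗ[R] L'))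
    (v : Fin n → L) : sumHom f (act A L v) = sumHom (act A.transpose (L →ₗ[R] L') f) v := by
  simp only [sumHom_apply, act_apply, map_sum, map_smul, LinearMap.sum_apply, LinearMap.smul_apply,
    Matrix.transpose_apply]
  exact Finset.sum_comm

lemma sumHom_injective {n : ℕ} {f g : Fin n → (L →ₗ[R] L')} (h : ∀ v, sumHom f v = sumHom g v) :
    f = g := by
  funext j
  ext x
  have := h (Pi.single j x)
  simpa [sumHom_apply, Pi.single_apply, apply_ite] using this

/-- extension of maps along exact sequences into injectives -/
lemma inj_ext {U V W X : Type u} [AddCommGroup U] [Module R U] [AddCommGroup V] [Module R V]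
    [AddCommGroup W] [Module R W] [AddCommGroup X] [Module R X] [Module.Injective R X]
    (f : U →ₗ[R] V) (g : V →ₗ[R] W) (h : Exact f g) (φ : V →ₗ[R] X)
    (hφ : ∀ u, φ (f u) = 0) : ∃ ψ : W →ₗ[R] X, ∀ v, ψ (g v) = φ v := by
  have hk : LinearMap.ker g ≤ LinearMap.ker φ := by
    intro v hv
    obtain ⟨u, rfl⟩ := (h v).1 hv
    exact hφ u
  obtain ⟨ψ, hψ⟩ := Module.Injective.out ((LinearMap.ker g).liftQ g le_rfl)
    (LinearMap.ker_eq_bot.1 (Submodule.ker_liftQ_eq_bot _ _ _ le_rfl))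
    ((LinearMap.ker g).liftQ φ hk)
  refine ⟨ψ, fun v => ?_⟩
  have := hψ (Submodule.Quotient.mk v)
  simpa using this

/-- `Hom(-, X)` of an exact matrix sequence is exact for `X` injective. -/
lemma exact_hom {l m n : ℕ} (A : Matrix (Fin m) (Fin n) R) (B : Matrix (Fin l) (Fin m) R)
    (L X : Type u) [AddCommGroup L] [Module R L] [AddCommGroup X] [Module R X] [Module.Injective R X]
    (h : Exact (act A L) (act B L)) :
    Exact (act B.transpose (L →ₗ[R] X)) (act A.transpose (L →ₗ[R] X)) := by
  intro f
  constructor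
  · intro hf
    obtain ⟨ψ, hψ⟩ := inj_ext (act A L) (act B L) h (sumHom f) (fun u => by
      rw [sumHom_act, hf]; simp [sumHom_apply])
    obtain ⟨g, hg⟩ := exists_hom_vec ψ
    refine ⟨g, sumHom_injective (fun v => ?_)⟩
    rw [← sumHom_act, ← hψ, hg, sumHom_apply]
  · rintro ⟨g, rfl⟩
    refine sumHom_injective (fun v => ?_)
    rw [← sumHom_act, ← sumHom_act, (h _).2 ⟨v, rfl⟩]
    simp [sumHom_apply]

/-- exactness is transported along linear equivalences of coefficients -/
lemma exact_equiv {l m n : ℕ} (A : Matrix (Fin m) (Fin n) R) (B : Matrix (Fin l) (Fin m) R)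
    (e : L ≃ₗ[R] L') (h : Exact (act A L) (act B L)) : Exact (act A L') (act B L') := by
  intro v
  have key : ∀ {p q : ℕ} (C : Matrix (Fin p) (Fin q) R) (w : Fin q → L'),
      act C L' w = fun i => e (act C L (fun j => e.symm (w j)) i) := by
    intro p q C w
    rw [← LinearEquiv.coe_coe, ← act_nat]
    simp
  constructor
  · intro hv
    have h1 : act B L (fun j => e.symm (v j)) = 0 := by
      have := act_nat B e.symm.toLinearMap v
      simp only [LinearEquiv.coe_coe] at this
      rw [this, hv]; funext i; simp
    obtain ⟨u, hu⟩ := (h _).1 h1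
    refine ⟨fun j => e (u j), ?_⟩
    rw [key]; simp [hu]
  · rintro ⟨u, rfl⟩
    rw [key B, key A]
    simp only [LinearEquiv.symm_apply_apply]
    rw [(h _).2 ⟨_, rfl⟩]; funext i; simp

lemma exact_hom_R {l m n : ℕ} (A : Matrix (Fin m) (Fin n) R) (B : Matrix (Fin l) (Fin m) R)
    (X : Type u) [AddCommGroup X] [Module R X] [Module.Injective R X]
    (h : Exact (act A R) (act B R)) :
    Exact (act B.transpose X) (act A.transpose X) :=
  exact_equiv _ _ (LinearMap.ringLmapEquivSelf R R X) (exact_hom A B R X h)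

lemma exact_pi {l m n k : ℕ} (A : Matrix (Fin m) (Fin n) R) (B : Matrix (Fin l) (Fin m) R)
    (h : Exact (act A L) (act B L)) : Exact (act A (Fin k → L)) (act B (Fin k → L)) := by
  have key : ∀ {p q : ℕ} (C : Matrix (Fin p) (Fin q) R) (w : Fin q → Fin k → L) (t : Fin k),
      (fun i => act C (Fin k → L) w i t) = act C L (fun j => w j t) := by
    intro p q C w t
    funext i; simp [act_apply]
  intro v
  constructor
  · intro hv
    have : ∀ t, ∃ u, act A L u = fun j => v j t := fun t => by
      refine (h _).1 ?_
      rw [← key, hv]; rfl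
    choose u hu using this
    refine ⟨fun j t => u t j, ?_⟩
    funext i t
    exact (congrFun (key A (fun j t => u t j) t) i).trans (congrFun (hu t) i)
  · rintro ⟨u, rfl⟩
    funext i t
    refine (congrFun (key B _ t) i).trans ?_
    rw [key A u t, (h _).2 ⟨_, rfl⟩]; rfl

/-- exactness of complex composite implies zero on every module. -/
lemma act_act_zero {l m n : ℕ} {A : Matrix (Fin m) (Fin n) R} {B : Matrix (Fin l) (Fin m) R}
    (h : Exact (act A R) (act B R)) (L : Type u) [AddCommGroup L] [Module R L] (v : Fin n → L) :
    act B L (act A L v) = 0 := by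
  rw [act_mul, mul_eq_zero_of_R B A (fun v => (h _).2 ⟨v, rfl⟩)]
  funext i; simp [act_apply]

lemma act_act_zero' {l m n : ℕ} {A : Matrix (Fin m) (Fin n) R} {B : Matrix (Fin l) (Fin m) R}
    (h : Exact (act A R) (act B R)) (L : Type u) [AddCommGroup L] [Module R L] (v : Fin l → L) :
    act A.transpose L (act B.transpose L v) = 0 := by
  rw [act_mul, ← Matrix.transpose_mul, mul_eq_zero_of_R B A (fun v => (h _).2 ⟨v, rfl⟩)]
  funext i; simp [act_apply]

end Act

section Chase
variable {R : Type u} [CommRing R]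
variable {U0 U1 U2 V0 V1 V2 V3 W0 W1 W2 W3 : Type u}
  [AddCommGroup U0] [Module R U0] [AddCommGroup U1] [Module R U1] [AddCommGroup U2] [Module R U2]
  [AddCommGroup V0] [Module R V0] [AddCommGroup V1] [Module R V1] [AddCommGroup V2] [Module R V2]
  [AddCommGroup V3] [Module R V3]
  [AddCommGroup W0] [Module R W0] [AddCommGroup W1] [Module R W1] [AddCommGroup W2] [Module R W2]
  [AddCommGroup W3] [Module R W3]

/-- exactness of the sub complex -/
lemma sub_exact (dU2 : U2 →ₗ[R] U1) (dU1 : U1 →ₗ[R] U0)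
    (dV3 : V3 →ₗ[R] V2) (dV2 : V2 →ₗ[R] V1) (dV1 : V1 →ₗ[R] V0)
    (dW3 : W3 →ₗ[R] W2) (dW2 : W2 →ₗ[R] W1)
    (f2 : U2 →ₗ[R] V2) (f1 : U1 →ₗ[R] V1) (f0 : U0 →ₗ[R] V0)
    (g3 : V3 →ₗ[R] W3) (g2 : V2 →ₗ[R] W2) (g1 : V1 →ₗ[R] W1)
    (cU2 : ∀ x, f1 (dU2 x) = dV2 (f2 x)) (cU1 : ∀ x, f0 (dU1 x) = dV1 (f1 x))
    (cV3 : ∀ x, g2 (dV3 x) = dW3 (g3 x)) (cV2 : ∀ x, g1 (dV2 x) = dW2 (g2 x))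
    (hf1 : Injective f1) (e2 : Exact f2 g2) (e1 : ∀ x, g1 (f1 x) = 0) (hg3 : Surjective g3)
    (hU : ∀ x, dU1 (dU2 x) = 0) (hVV : ∀ x, dV2 (dV3 x) = 0)
    (hV : ∀ x, dV1 x = 0 → ∃ y, dV2 y = x) (hW : ∀ x, dW2 x = 0 → ∃ y, dW3 y = x) :
    Exact dU2 dU1 := by
  intro u
  constructor
  · intro hu
    obtain ⟨v2, hv2⟩ := hV (f1 u) (by rw [← cU1, hu, map_zero])
    obtain ⟨w3, hw3⟩ := hW (g2 v2) (by rw [← cV2, hv2, e1])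
    obtain ⟨v3, rfl⟩ := hg3 w3
    obtain ⟨u2, hu2⟩ := (e2 (v2 - dV3 v3)).1 (by rw [map_sub, cV3, hw3, sub_self])
    refine ⟨u2, hf1 ?_⟩
    rw [cU2, hu2, map_sub, hVV, sub_zero, hv2]
  · rintro ⟨x, rfl⟩; exact hU x

/-- exactness of the quotient complex -/
lemma quot_exact (dU1 : U1 →ₗ[R] U0)
    (dV2 : V2 →ₗ[R] V1) (dV1 : V1 →ₗ[R] V0)
    (dW2 : W2 →ₗ[R] W1) (dW1 : W1 →ₗ[R] W0)
    (f1 : U1 →ₗ[R] V1) (f0 : U0 →ₗ[R] V0)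
    (g2 : V2 →ₗ[R] W2) (g1 : V1 →ₗ[R] W1) (g0 : V0 →ₗ[R] W0)
    (cU1 : ∀ x, f0 (dU1 x) = dV1 (f1 x))
    (cV2 : ∀ x, g1 (dV2 x) = dW2 (g2 x)) (cV1 : ∀ x, g0 (dV1 x) = dW1 (g1 x))
    (e1 : ∀ x, g1 (f1 x) = 0) (e0 : Exact f0 g0) (hg1 : Surjective g1)
    (hW : ∀ x, dW1 (dW2 x) = 0)
    (hV : ∀ x, dV1 x = 0 → ∃ y, dV2 y = x)
    (hU : ∀ u0, (∃ v1, dV1 v1 = f0 u0) → ∃ u1, dU1 u1 = u0) :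
    Exact dW2 dW1 := by
  intro w
  constructor
  · intro hw
    obtain ⟨v1, rfl⟩ := hg1 w
    obtain ⟨u0, hu0⟩ := (e0 (dV1 v1)).1 (by rw [cV1, hw])
    obtain ⟨u1, hu1⟩ := hU u0 ⟨v1, hu0.symm⟩
    obtain ⟨v2, hv2⟩ := hV (v1 - f1 u1) (by rw [map_sub, ← cU1, hu1, hu0, sub_self])
    refine ⟨g2 v2, ?_⟩
    rw [← cV2, hv2, map_sub, e1, sub_zero]
  · rintro ⟨x, rfl⟩; exact hW x

end Chase

section SES
variable {R : Type u} [CommRing R]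

/-- a short exact sequence -/
structure Ses {L G C : Type u} [AddCommGroup L] [Module R L] [AddCommGroup G] [Module R G]
    [AddCommGroup C] [Module R C] (f : L →ₗ[R] G) (g : G →ₗ[R] C) : Prop where
  inj : Injective f
  exact : Exact f g
  surj : Surjective g

variable {L G C : Type u} [AddCommGroup L] [Module R L] [AddCommGroup G] [Module R G]
    [AddCommGroup C] [Module R C] {f : L →ₗ[R] G} {g : G →ₗ[R] C}

lemma Ses.comp_zero (h : Ses f g) (x : L) : g (f x) = 0 := (h.exact _).2 ⟨x, rfl⟩

/-- coordinatewise map -/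
def pw (f : L →ₗ[R] G) (n : ℕ) : (Fin n → L) →ₗ[R] (Fin n → G) where
  toFun v j := f (v j)
  map_add' v w := by funext j; simp
  map_smul' r v := by funext j; simp

@[simp] lemma pw_apply (f : L →ₗ[R] G) (n : ℕ) (v : Fin n → L) : pw f n v = fun j => f (v j) := rfl

lemma act_pw {m n : ℕ} (A : Matrix (Fin m) (Fin n) R) (f : L →ₗ[R] G) (v : Fin n → L) :
    pw f m (act A L v) = act A G (pw f n v) := by
  rw [pw_apply, pw_apply, act_nat]

lemma Ses.pow (h : Ses f g) (n : ℕ) : Ses (pw f n) (pw g n) where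
  inj v w hvw := by
    funext j; exact h.inj (congrFun hvw j)
  exact v := by
    constructor
    · intro hv
      have : ∀ j, ∃ x, f x = v j := fun j => (h.exact _).1 (congrFun hv j)
      choose u hu using this
      exact ⟨u, funext hu⟩
    · rintro ⟨u, rfl⟩
      funext j; exact h.comp_zero _
  surj v := by
    have : ∀ j, ∃ x, g x = v j := fun j => h.surj _
    choose u hu using this
    exact ⟨u, funext hu⟩

lemma ses_mkQ (K : Submodule R G) : Ses K.subtype K.mkQ where
  inj := Subtype.val_injective
  exact v := by simp
  surj := Submodule.mkQ_surjective K

lemma ses_ker (hg : Surjective g) : Ses (LinearMap.ker g).subtype g where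
  inj := Subtype.val_injective
  exact v := by simp
  surj := hg

lemma ses_quot_range (hf : Injective f) : Ses f (LinearMap.range f).mkQ where
  inj := hf
  exact v := by simp
  surj := Submodule.mkQ_surjective _

/-- matrix complexes: exactness on the sub -/
lemma Ses.act_sub (h : Ses f g) {k l m n : ℕ} (A : Matrix (Fin l) (Fin k) R)
    (B : Matrix (Fin m) (Fin l) R) (D : Matrix (Fin n) (Fin m) R)
    (hAB : ∀ v : Fin k → G, act B G (act A G v) = 0)
    (hBD : ∀ v : Fin l → L, act D L (act B L v) = 0)
    (hG : Exact (act B G) (act D G)) (hC : Exact (act A C) (act B C)) :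
    Exact (act B L) (act D L) :=
  sub_exact (act B L) (act D L) (act A G) (act B G) (act D G) (act A C) (act B C)
    (pw f _) (pw f _) (pw f _) (pw g _) (pw g _) (pw g _)
    (act_pw _ _) (act_pw _ _) (act_pw _ _) (act_pw _ _)
    (h.pow _).inj (h.pow _).exact (h.pow _).comp_zero (h.pow _).surj hBD hAB
    (fun x hx => (hG x).1 hx) (fun x hx => (hC x).1 hx)

end SES

section FCdef
variable (R : Type u) [CommRing R]

/-- finite coresolutions -/
inductive FC (P : ∀ (N : Type u) [AddCommGroup N] [Module R N], Prop) :
    ∀ (L : Type u) [AddCommGroup L] [Module R L], Prop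
  | of (L : Type u) [AddCommGroup L] [Module R L] (h : P L) : FC P L
  | step (L G C : Type u) [AddCommGroup L] [Module R L] [AddCommGroup G] [Module R G]
    [AddCommGroup C] [Module R C] (f : L →ₗ[R] G) (g : G →ₗ[R] C) (h : Ses f g)
    (hG : P G) (hC : FC P C) : FC P L

/-- injectivity as a predicate -/
abbrev Inj (N : Type u) [AddCommGroup N] [Module R N] : Prop := Module.Injective R N

variable {R}

lemma FC.congr {P : ∀ (N : Type u) [AddCommGroup N] [Module R N], Prop}
    (hP : ∀ (N N' : Type u) [AddCommGroup N] [Module R N] [AddCommGroup N'] [Module R N'],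
      (N ≃ₗ[R] N') → P N → P N')
    {L L' : Type u} [AddCommGroup L] [Module R L] [AddCommGroup L'] [Module R L']
    (e : L ≃ₗ[R] L') (h : FC R P L) : FC R P L' := by
  cases h with
  | of _ h => exact FC.of _ (hP _ _ e h)
  | step _ G C f g hs hG hC =>
    refine FC.step _ G C (f.comp e.symm.toLinearMap) g ⟨?_, ?_, hs.surj⟩ hG hC
    · exact hs.inj.comp e.symm.injective
    · intro v
      rw [hs.exact v]
      constructor
      · rintro ⟨x, rfl⟩; exact ⟨e x, by simp⟩
      · rintro ⟨x, rfl⟩; exact ⟨_, rfl⟩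

/-- from the frozen definition to `FC` -/
lemma FC.of_coresolution (P : ∀ (N : Type u) [AddCommGroup N] [Module R N], Prop)
    (hP : ∀ (N N' : Type u) [AddCommGroup N] [Module R N] [AddCommGroup N'] [Module R N'],
      (N ≃ₗ[R] N') → P N → P N') (n : ℕ) :
    ∀ (L : Type u) [AddCommGroup L] [Module R L],
    GG.CoresolutionLE R (fun N => P N) L n → FC R P L := by
  induction n with
  | zero =>
    rintro L _ _ ⟨G, d, ε, hG, hi, h0, h1, hz⟩
    refine FC.of _ (hP _ _ (LinearEquiv.ofBijective ε ⟨hi, fun x => ?_⟩).symm (hG 0))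
    have : x ∈ LinearMap.range ε := by
      rw [h0]; exact hz 1 (by norm_num) _
    exact this
  | succ n ih =>
    rintro L _ _ ⟨G, d, ε, hG, hi, h0, h1, hz⟩
    refine FC.step L (G 0) (LinearMap.range (d 0)) ε (d 0).rangeRestrict ⟨hi, ?_, ?_⟩ (hG 0) ?_
    · intro v
      rw [← LinearMap.mem_ker, LinearMap.ker_rangeRestrict, ← h0]; rfl
    · exact LinearMap.surjective_rangeRestrict _
    · refine ih _ ⟨fun i => G (i + 1), fun i => d (i + 1), (LinearMap.range (d 0)).subtype,
        fun i => hG _, Subtype.val_injective, ?_, fun i => h1 _, fun i hi => hz _ (by omega)⟩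
      rw [Submodule.range_subtype, h1]

/-- from `FC` to the frozen definition -/
lemma FC.to_coresolution {P : ∀ (N : Type u) [AddCommGroup N] [Module R N], Prop}
    (hP0 : P PUnit) {L : Type u} [AddCommGroup L] [Module R L] (h : FC R P L) :
    ∃ n, GG.CoresolutionLE R (fun N => P N) L n := by
  induction h with
  | of L h =>
    refine ⟨0, fun i => Nat.casesOn i (ModuleCat.of R L) (fun _ => ModuleCat.of R PUnit),
      fun i => 0, LinearMap.id, ?_, fun x y h => h, ?_, ?_, ?_⟩
    · rintro (_ | i)
      · exact h
      · exact hP0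
    · ext x; simp
    · intro i
      ext (x : PUnit); simp
    · rintro (_ | i) hi x
      · exact absurd hi (lt_irrefl _)
      · exact Subsingleton.elim (α := PUnit) _ _
  | step L G C f g hs hG hC ih =>
    obtain ⟨n, G', d, ε, hG', hi, h0, h1, hz⟩ := ih
    refine ⟨n + 1, fun i => Nat.casesOn i (ModuleCat.of R G) (fun i => G' i),
      fun i => match i with
        | 0 => ε.comp g
        | i + 1 => d i, f, ?_, hs.inj, ?_, ?_, ?_⟩
    · rintro (_ | i)
      · exact hG
      · exact hG' i
    · ext x
      constructor
      · rintro ⟨y, rfl⟩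
        show ε (g (f y)) = 0
        rw [hs.comp_zero, map_zero]
      · intro hx
        have hx : ε (g x) = 0 := hx
        exact (hs.exact x).1 (hi (by rw [hx, map_zero]))
    · rintro (_ | i)
      · show LinearMap.range (ε.comp g) = LinearMap.ker (d 0)
        rw [LinearMap.range_comp_of_range_eq_top _ (LinearMap.range_eq_top.2 hs.surj), h0]
      · exact h1 i
    · rintro (_ | i) hi x
      · omega
      · exact hz i (by omega) x

lemma inj_congr (N N' : Type u) [AddCommGroup N] [Module R N] [AddCommGroup N'] [Module R N']
    (e : N ≃ₗ[R] N') (h : Inj R N) : Inj R N' := by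
  constructor
  intro X Y _ _ _ _ f hf g
  obtain ⟨k, hk⟩ := Module.Injective.out f hf (e.symm.toLinearMap.comp g)
  exact ⟨e.toLinearMap.comp k, fun x => by simp [hk]⟩

lemma gi_congr (N N' : Type u) [AddCommGroup N] [Module R N] [AddCommGroup N'] [Module R N']
    (e : N ≃ₗ[R] N') (h : GG.IsGorensteinInjective R N) : GG.IsGorensteinInjective R N' := by
  obtain ⟨X, d, h1, h2, h3, ⟨h4⟩⟩ := h
  exact ⟨X, d, h1, h2, h3, ⟨e.symm.trans h4⟩⟩

lemma inj_punit : Inj R PUnit.{u+1} := by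
  constructor
  intro X Y _ _ _ _ f hf g
  exact ⟨0, fun x => Subsingleton.elim _ _⟩

lemma gi_punit : GG.IsGorensteinInjective R PUnit.{u+1} := by
  refine ⟨fun _ => ModuleCat.of R PUnit, fun _ => 0, fun _ => inj_punit, ?_, ?_, ⟨?_⟩⟩
  · intro n; ext (x : PUnit); simp
  · intro I _ n φ _
    exact ⟨0, by ext x⟩
  · exact (LinearEquiv.ofTop _ (by ext (x : PUnit); simp)).symm

end FCdef
end HH

namespace HH
open Function

section Res
variable {R : Type u} [CommRing R] {X : Type u} [AddCommGroup X] [Module R X]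

/-- a free resolution given by matrices -/
structure IsRes (b : ℕ → ℕ) (A : ∀ i, Matrix (Fin (b (i + 1))) (Fin (b i)) R)
    (e : Fin (b 0) → X) : Prop where
  surj : Surjective (comb (R := R) e)
  ex0 : Exact (act (A 0).transpose R) (comb (R := R) e)
  ex : ∀ i, Exact (act (A (i + 1)).transpose R) (act (A i).transpose R)

lemma comb_rows {m n : ℕ} (B : Matrix (Fin m) (Fin n) R) (v : Fin m → R) :
    comb (R := R) (fun k => B k) v = act B.transpose R v := by
  funext j
  simp [comb_apply, act_apply, mul_comm]

lemma exists_gens [IsNoetherianRing R] (n : ℕ) (K : Submodule R (Fin n → R)) :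
    ∃ (m : ℕ) (B : Matrix (Fin m) (Fin n) R), LinearMap.range (act B.transpose R) = K := by
  obtain ⟨m, s, hs⟩ := Submodule.fg_iff_exists_fin_generating_family.1 (IsNoetherian.noetherian K)
  refine ⟨m, s, ?_⟩
  rw [← hs]
  ext w
  rw [Submodule.mem_span_range_iff_exists_fun]
  constructor
  · rintro ⟨v, rfl⟩
    exact ⟨v, comb_rows (R := R) s v⟩
  · rintro ⟨v, rfl⟩
    exact ⟨v, (comb_rows (R := R) s v).symm⟩

lemma exists_res' [IsNoetherianRing R] (n : ℕ) (e0 : Fin n → X)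
    (he : Surjective (comb (R := R) e0)) :
    ∃ (b : ℕ → ℕ) (A : ∀ i, Matrix (Fin (b (i + 1))) (Fin (b i)) R) (e : Fin (b 0) → X),
      IsRes b A e ∧ ∃ h : b 0 = n, ∀ j, e j = e0 (Fin.cast h j) := by
  choose m B hB using @exists_gens R _ _
  let s : ℕ → Σ n, Submodule R (Fin n → R) := fun k => Nat.rec ⟨n, LinearMap.ker (comb (R := R) e0)⟩
    (fun _ t => ⟨m t.1 t.2, LinearMap.ker (act (B t.1 t.2).transpose R)⟩) k
  refine ⟨fun k => (s k).1, fun k => B (s k).1 (s k).2, e0, ⟨he, ?_, ?_⟩, rfl, fun j => rfl⟩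
  · exact LinearMap.exact_iff.2 (hB (s 0).1 (s 0).2).symm
  · intro i
    exact LinearMap.exact_iff.2 (hB (s (i+1)).1 (s (i+1)).2).symm

variable (R X) in
lemma exists_res [IsNoetherianRing R] [Module.Finite R X] :
    ∃ (b : ℕ → ℕ) (A : ∀ i, Matrix (Fin (b (i + 1))) (Fin (b i)) R) (e : Fin (b 0) → X),
      IsRes b A e := by
  obtain ⟨n, s, hs⟩ := Module.Finite.exists_fin (R := R) (M := X)
  obtain ⟨b, A, e, h, -⟩ := exists_res' (R := R) n s (by
    intro x
    have : x ∈ Submodule.span R (Set.range s) := hs ▸ Submodule.mem_top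
    obtain ⟨v, hv⟩ := (Submodule.mem_span_range_iff_exists_fun R).1 this
    exact ⟨v, hv⟩)
  exact ⟨b, A, e, h⟩

variable {b : ℕ → ℕ} {A : ∀ i, Matrix (Fin (b (i + 1))) (Fin (b i)) R} {e : Fin (b 0) → X}

lemma IsRes.row_mem (h : IsRes b A e) (k : Fin (b 1)) : A 0 k ∈ LinearMap.ker (comb (R := R) e) := by
  have : A 0 k = act (A 0).transpose R (Pi.single k 1) := by
    funext j; simp [act_apply, Pi.single_apply]
  rw [this]
  exact (h.ex0 _).2 ⟨_, rfl⟩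

/-- generators of the first syzygy -/
def IsRes.gen (h : IsRes b A e) (k : Fin (b 1)) : LinearMap.ker (comb (R := R) e) :=
  ⟨A 0 k, h.row_mem k⟩

lemma IsRes.comb_gen (h : IsRes b A e) (v : Fin (b 1) → R) :
    (comb (R := R) h.gen v : Fin (b 0) → R) = act (A 0).transpose R v := by
  rw [← comb_rows, comb_apply, comb_apply]
  simp [IsRes.gen]

lemma IsRes.shift (h : IsRes b A e) :
    IsRes (fun i => b (i + 1)) (fun i => A (i + 1)) h.gen where
  surj x := by
    obtain ⟨v, hv⟩ := (h.ex0 x.1).1 x.2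
    exact ⟨v, Subtype.ext (by rw [h.comb_gen, hv])⟩
  ex0 v := by
    rw [← h.ex 0 v, ← Subtype.coe_inj, h.comb_gen]; rfl
  ex i := h.ex (i + 1)

lemma IsRes.act_e (h : IsRes b A e) : act (A 0) X e = 0 := by
  funext k
  have := h.row_mem k
  rw [LinearMap.mem_ker, comb_apply] at this
  simpa [act_apply] using this

/-- maps out of `X` are the kernel of the first matrix -/
lemma IsRes.exists_hom (h : IsRes b A e) {Y : Type u} [AddCommGroup Y] [Module R Y]
    (y : Fin (b 0) → Y) (hy : act (A 0) Y y = 0) : ∃ f : X →ₗ[R] Y, ∀ j, f (e j) = y j := by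
  have hk : LinearMap.ker (comb (R := R) e) ≤ LinearMap.ker (comb (R := R) y) := by
    intro v hv
    obtain ⟨w, rfl⟩ := (h.ex0 v).1 hv
    rw [LinearMap.mem_ker, comb_apply]
    have : ∑ j, (act (A 0).transpose R w) j • y j = ∑ k, w k • act (A 0) Y y k := by
      simp only [act_apply, Finset.sum_smul, Finset.smul_sum, Matrix.transpose_apply, smul_eq_mul,
        mul_smul]
      rw [Finset.sum_comm]
      simp [smul_smul, mul_comm]
    rw [this, hy]; simp
  let E := (comb (R := R) e).quotKerEquivOfSurjective h.surj
  refine ⟨((LinearMap.ker (comb (R := R) e)).liftQ (comb (R := R) y) hk).comp E.symm.toLinearMap,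
    fun j => ?_⟩
  have : E.symm (e j) = Submodule.Quotient.mk (Pi.single j 1) := by
    rw [LinearEquiv.symm_apply_eq]
    simp [E, comb_apply, Pi.single_apply]
  simp [this, comb_apply, Pi.single_apply]

lemma IsRes.hom_ext (h : IsRes b A e) {Y : Type u} [AddCommGroup Y] [Module R Y]
    {f g : X →ₗ[R] Y} (hfg : ∀ j, f (e j) = g (e j)) : f = g := by
  ext x
  obtain ⟨v, rfl⟩ := h.surj x
  simp [comb_apply, hfg]

lemma IsRes.hom_mem (h : IsRes b A e) {Y : Type u} [AddCommGroup Y] [Module R Y]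
    (f : X →ₗ[R] Y) : act (A 0) Y (fun j => f (e j)) = 0 := by
  rw [act_nat, h.act_e]; funext; simp

end Res
end HH

namespace HH
open Function CategoryTheory CategoryTheory.Abelian

section EZ
variable (R : Type u) [CommRing R]

/-- vanishing of `Ext` -/
def EZ (X Y : Type u) [AddCommGroup X] [Module R X] [AddCommGroup Y] [Module R Y] (i : ℕ) : Prop :=
  ∀ x : Ext.{u} (ModuleCat.of R X) (ModuleCat.of R Y) i, x = 0

variable {R}
variable {X Y L G C : Type u} [AddCommGroup X] [Module R X] [AddCommGroup Y] [Module R Y]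
    [AddCommGroup L] [Module R L] [AddCommGroup G] [Module R G]
    [AddCommGroup C] [Module R C] {f : L →ₗ[R] G} {g : G →ₗ[R] C}

lemma ez_iff {i : ℕ} : EZ R X Y i ↔ Subsingleton (Ext.{u} (ModuleCat.of R X) (ModuleCat.of R Y) i) :=
  ⟨fun h => subsingleton_of_forall_eq 0 h, fun _ x => Subsingleton.elim _ _⟩

/-- the associated short complex -/
abbrev Ses.sc (h : Ses f g) : ShortComplex (ModuleCat.{u} R) :=
  ShortComplex.mk (ModuleCat.ofHom f) (ModuleCat.ofHom g) (by
    ext x; exact h.comp_zero x)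

lemma Ses.se (h : Ses f g) : h.sc.ShortExact where
  exact := (ShortComplex.ShortExact.moduleCat_exact_iff_function_exact _).mpr h.exact
  mono_f := (ModuleCat.mono_iff_injective _).mpr h.inj
  epi_g := (ModuleCat.epi_iff_surjective _).mpr h.surj

lemma Ses.ezY_mid (h : Ses f g) {i : ℕ} (h1 : EZ R X L i) (h3 : EZ R X C i) : EZ R X G i := by
  intro x
  obtain ⟨y, rfl⟩ := Ext.covariant_sequence_exact₂ (ModuleCat.of R X) h.se x (h3 _)
  rw [h1 y, Ext.zero_comp]

lemma Ses.ezY_sub (h : Ses f g) {i : ℕ} (h3 : EZ R X C i) (h2 : EZ R X G (i + 1)) :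
    EZ R X L (i + 1) := by
  intro x
  obtain ⟨y, rfl⟩ := Ext.covariant_sequence_exact₁ (ModuleCat.of R X) h.se x (h2 _) rfl
  rw [h3 y, Ext.zero_comp]

lemma Ses.ezY_quot (h : Ses f g) {i : ℕ} (h2 : EZ R X G i) (h1 : EZ R X L (i + 1)) :
    EZ R X C i := by
  intro x
  obtain ⟨y, rfl⟩ := Ext.covariant_sequence_exact₃ (ModuleCat.of R X) h.se x rfl (h1 _)
  rw [h2 y, Ext.zero_comp]

lemma Ses.ezX_mid (h : Ses f g) {i : ℕ} (h1 : EZ R L Y i) (h3 : EZ R C Y i) : EZ R G Y i := by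
  intro x
  obtain ⟨y, rfl⟩ := Ext.contravariant_sequence_exact₂ h.se (ModuleCat.of R Y) x (h1 _)
  rw [h3 y, Ext.comp_zero]

lemma Ses.ezX_sub (h : Ses f g) {i : ℕ} (h2 : EZ R G Y i) (h3 : EZ R C Y (i + 1)) :
    EZ R L Y i := by
  intro x
  obtain ⟨y, rfl⟩ := Ext.contravariant_sequence_exact₁ h.se (ModuleCat.of R Y) x (add_comm 1 i) (h3 _)
  rw [h2 y, Ext.comp_zero]

lemma Ses.ezX_quot (h : Ses f g) {i : ℕ} (h1 : EZ R L Y i) (h2 : EZ R G Y (i + 1)) :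
    EZ R C Y (i + 1) := by
  intro x
  obtain ⟨y, rfl⟩ := Ext.contravariant_sequence_exact₃ h.se (ModuleCat.of R Y) x (h2 _) (add_comm 1 i)
  rw [h1 y, Ext.comp_zero]

lemma exists_lin {X Y : Type u} [AddCommGroup X] [Module R X] [AddCommGroup Y] [Module R Y]
    (x : Ext.{u} (ModuleCat.of R X) (ModuleCat.of R Y) 0) :
    ∃ φ : X →ₗ[R] Y, Ext.mk₀ (ModuleCat.ofHom φ) = x :=
  ⟨(Ext.homEquiv₀ x).hom, by simp⟩

lemma mk_inj {X Y : Type u} [AddCommGroup X] [Module R X] [AddCommGroup Y] [Module R Y]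
    {φ ψ : X →ₗ[R] Y} (h : Ext.mk₀ (ModuleCat.ofHom φ) = Ext.mk₀.{u} (ModuleCat.ofHom ψ)) :
    φ = ψ := by
  have := (Ext.mk₀_bijective _ _).1 h
  exact ModuleCat.hom_ext_iff.1 this

lemma ez_zero : EZ R X Y 0 ↔ ∀ φ : X →ₗ[R] Y, φ = 0 := by
  constructor
  · intro h φ
    refine mk_inj ?_
    rw [h (Ext.mk₀ (ModuleCat.ofHom φ))]
    exact (h _).symm
  · intro h x
    obtain ⟨φ, rfl⟩ := exists_lin x
    rw [h φ]
    exact Ext.mk₀_zero (ModuleCat.of R X) (ModuleCat.of R Y)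

lemma ez_inj [Module.Injective R Y] (i : ℕ) : EZ R X Y (i + 1) := by
  have := Module.injective_object_of_injective_module R Y
  exact fun x => Ext.eq_zero_of_injective x

lemma ez_proj [Module.Projective R X] (i : ℕ) : EZ R X Y (i + 1) := by
  have := (IsProjective.iff_projective (R := R) X).1 inferInstance
  exact fun x => Ext.eq_zero_of_projective x

lemma Ses.lift1 (h : Ses f g) (hX : EZ R X L 1) (φ : X →ₗ[R] C) : ∃ ψ : X →ₗ[R] G, g.comp ψ = φ := by
  obtain ⟨y, hy⟩ := Ext.covariant_sequence_exact₃ (ModuleCat.of R X) h.se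
    (Ext.mk₀ (ModuleCat.ofHom φ)) rfl (hX _)
  obtain ⟨ψ, rfl⟩ := exists_lin y
  refine ⟨ψ, mk_inj ?_⟩
  rw [← hy, Ext.mk₀_comp_mk₀]; rfl

lemma Ses.ez_of_lift (h : Ses f g) (hG : EZ R X G 1)
    (hl : ∀ φ : X →ₗ[R] C, ∃ ψ : X →ₗ[R] G, g.comp ψ = φ) : EZ R X L 1 := by
  intro x
  obtain ⟨y, rfl⟩ := Ext.covariant_sequence_exact₁ (ModuleCat.of R X) h.se x (hG _) rfl
  obtain ⟨φ, rfl⟩ := exists_lin y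
  obtain ⟨ψ, rfl⟩ := hl φ
  have : Ext.mk₀.{u} (ModuleCat.ofHom (g.comp ψ)) =
    (Ext.mk₀ (ModuleCat.ofHom ψ)).comp (Ext.mk₀ h.sc.g) (add_zero 0) := by
    rw [Ext.mk₀_comp_mk₀]; rfl
  rw [this]
  exact Ext.comp_assoc_of_second_deg_zero _ _ _ _ |>.trans (by simp [h.se.comp_extClass])

lemma Ses.ext1 (h : Ses f g) (hC : EZ R C Y 1) (φ : L →ₗ[R] Y) : ∃ ψ : G →ₗ[R] Y, ψ.comp f = φ := by
  obtain ⟨y, hy⟩ := Ext.contravariant_sequence_exact₁ h.se (ModuleCat.of R Y)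
    (Ext.mk₀ (ModuleCat.ofHom φ)) rfl (hC _)
  obtain ⟨ψ, rfl⟩ := exists_lin y
  refine ⟨ψ, mk_inj ?_⟩
  rw [← hy, Ext.mk₀_comp_mk₀]; rfl

lemma Ses.ez_of_ext (h : Ses f g) (hG : EZ R G Y 1)
    (hl : ∀ φ : L →ₗ[R] Y, ∃ ψ : G →ₗ[R] Y, ψ.comp f = φ) : EZ R C Y 1 := by
  intro x
  obtain ⟨y, rfl⟩ := Ext.contravariant_sequence_exact₃ h.se (ModuleCat.of R Y) x (hG _) (n₀ := 0) rfl
  obtain ⟨φ, rfl⟩ := exists_lin y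
  obtain ⟨ψ, rfl⟩ := hl φ
  have : Ext.mk₀.{u} (ModuleCat.ofHom (ψ.comp f)) =
    (Ext.mk₀ h.sc.f).comp (Ext.mk₀ (ModuleCat.ofHom ψ)) (add_zero 0) := by
    rw [Ext.mk₀_comp_mk₀]; rfl
  rw [this]
  exact h.se.extClass_comp_assoc _

lemma ez_punitX (i : ℕ) : EZ R PUnit.{u+1} Y i := by
  cases i with
  | zero => exact ez_zero.2 (fun φ => LinearMap.ext fun x => by rw [Subsingleton.elim x 0, map_zero, map_zero])
  | succ i => exact ez_proj i

lemma ez_punitY (i : ℕ) : EZ R X PUnit.{u+1} i := by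
  cases i with
  | zero => exact ez_zero.2 (fun φ => by ext x)
  | succ i =>
    have : Module.Injective R PUnit.{u+1} := inj_punit
    exact ez_inj i

lemma ses_equiv (e : L ≃ₗ[R] G) : Ses e.toLinearMap (0 : G →ₗ[R] PUnit.{u+1}) where
  inj := e.injective
  exact v := by simp
  surj v := ⟨0, Subsingleton.elim _ _⟩

lemma EZ.congrX (e : L ≃ₗ[R] G) {i : ℕ} (h : EZ R L Y i) : EZ R G Y i :=
  (ses_equiv e).ezX_mid h (ez_punitX i)

lemma EZ.congrY (e : L ≃ₗ[R] G) {i : ℕ} (h : EZ R X L i) : EZ R X G i :=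
  (ses_equiv e).ezY_mid h (ez_punitY i)

/-- splitting off the first coordinate -/
lemma ses_cons (n : ℕ) : Ses (LinearMap.single R (fun _ : Fin (n + 1) => L) 0)
    (LinearMap.funLeft R L (Fin.succ : Fin n → Fin (n + 1))) where
  inj := Pi.single_injective (M := fun _ : Fin (n + 1) => L) 0
  exact v := by
    constructor
    · intro hv
      refine ⟨v 0, ?_⟩
      funext j
      refine Fin.cases ?_ (fun j => ?_) j
      · simp
      · have := congrFun hv j
        simp only [LinearMap.funLeft_apply, Pi.zero_apply] at this
        simp [this]
    · rintro ⟨x, rfl⟩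
      funext j
      simp [LinearMap.funLeft_apply]
  surj v := ⟨Fin.cons 0 v, by funext j; simp [LinearMap.funLeft_apply]⟩

lemma EZ.powY {i : ℕ} (h : EZ R X L i) (n : ℕ) : EZ R X (Fin n → L) i := by
  induction n with
  | zero =>
    refine EZ.congrY (L := PUnit.{u+1}) ⟨0, 0, fun x => Subsingleton.elim _ _, fun x => Subsingleton.elim _ _⟩ (ez_punitY i)
  | succ n ih => exact (ses_cons n).ezY_mid h ih

lemma EZ.powX {i : ℕ} (h : EZ R L Y i) (n : ℕ) : EZ R (Fin n → L) Y i := by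
  induction n with
  | zero =>
    refine EZ.congrX (L := PUnit.{u+1}) ⟨0, 0, fun x => Subsingleton.elim _ _, fun x => Subsingleton.elim _ _⟩ (ez_punitX i)
  | succ n ih => exact (ses_cons n).ezX_mid h ih

lemma FC.ez {W : Type u} [AddCommGroup W] [Module R W] (h : FC R (Inj R) W) :
    ∃ n : ℕ, ∀ (X : Type u) [AddCommGroup X] [Module R X] (i : ℕ), n < i → EZ R X W i := by
  induction h with
  | of L h =>
    refine ⟨0, fun X _ _ i hi => ?_⟩
    obtain ⟨i, rfl⟩ := Nat.exists_eq_succ_of_ne_zero hi.ne'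
    exact ez_inj i
  | step L G C f g hs hG _ ih =>
    obtain ⟨n, hn⟩ := ih
    refine ⟨n + 1, fun X _ _ i hi => ?_⟩
    obtain ⟨i, rfl⟩ := Nat.exists_eq_succ_of_ne_zero (n := i) (by omega)
    exact hs.ezY_sub (hn X i (by omega)) (ez_inj i)

/-- `Ext` and matrix resolutions -/
lemma IsRes.ez_iff (Y : Type u) [AddCommGroup Y] [Module R Y] (i : ℕ) :
    ∀ (X : Type u) [AddCommGroup X] [Module R X] {b : ℕ → ℕ}
      {A : ∀ i, Matrix (Fin (b (i + 1))) (Fin (b i)) R} {e : Fin (b 0) → X} (_ : IsRes b A e),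
    EZ R X Y (i + 1) ↔ Exact (act (A i) Y) (act (A (i + 1)) Y) := by
  induction i with
  | zero =>
    intro X _ _ b A e h
    have hs := ses_ker h.surj
    constructor
    · intro hE v
      constructor
      · intro hv
        obtain ⟨φ, hφ⟩ := h.shift.exists_hom v hv
        obtain ⟨ψ, hψ⟩ := hs.ext1 hE φ
        refine ⟨fun j => ψ (Pi.single j 1), ?_⟩
        funext k
        rw [← hφ, ← hψ]
        have : (LinearMap.ker (comb (R := R) e)).subtype (h.gen k) = ∑ j, A 0 k j • Pi.single j 1 := by
          funext j
          simp [IsRes.gen, Pi.single_apply]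
        simp only [LinearMap.comp_apply, this, act_apply, map_sum, map_smul]
      · rintro ⟨w, rfl⟩
        have := act_act_zero' (h.ex 0) Y w
        simpa using this
    · intro hE
      refine hs.ez_of_ext (ez_proj 0) (fun φ => ?_)
      obtain ⟨y, hy⟩ := (hE (fun k => φ (h.gen k))).1 (h.shift.hom_mem φ)
      refine ⟨comb (R := R) y, h.shift.hom_ext (fun k => ?_)⟩
      rw [← congrFun hy k]
      simp [comb_apply, act_apply, IsRes.gen]
  | succ i ih =>
    intro X _ _ b A e h
    rw [← ih _ h.shift]
    exact ⟨fun hE => (ses_ker h.surj).ezX_sub (ez_proj _) hE,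
      fun hE => (ses_ker h.surj).ezX_quot hE (ez_proj _)⟩

end EZ
end HH

namespace HH
open Function

section Glue
variable {R : Type u} [CommRing R]

lemma inj_pi {I : Type u} [AddCommGroup I] [Module R I] [Module.Injective R I] (n : ℕ) :
    Module.Injective R (Fin n → I) := by
  constructor
  intro X Y _ _ _ _ f hf g
  have : ∀ j, ∃ k : Y →ₗ[R] I, ∀ x, k (f x) = (LinearMap.proj j).comp g x := fun j =>
    Module.Injective.out f hf _
  choose k hk using this
  exact ⟨LinearMap.pi k, fun x => by funext j; simp [hk]⟩

/-- two-sided sequences: exactness downwards on `R` gives exactness upwards on modules of finite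
injective dimension -/
lemma upZ_of_FC (b : ℤ → ℕ) (B : ∀ n, Matrix (Fin (b n)) (Fin (b (n + 1))) R)
    (hB : ∀ n, Exact (act (B (n + 1)) R) (act (B n) R))
    {W : Type u} [AddCommGroup W] [Module R W] (hW : FC R (Inj R) W) :
    ∀ n, Exact (act (B n).transpose W) (act (B (n + 1)).transpose W) := by
  induction hW with
  | of W h => exact fun n => exact_hom_R _ _ W (hB n)
  | step L G C f g hs hG _ ih =>
    intro n
    obtain ⟨m, rfl⟩ : ∃ m, n = m + 1 := ⟨n - 1, by ring⟩
    refine hs.act_sub (B m).transpose _ _ (fun v => ?_) (fun v => ?_) ?_ (ih m)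
    · exact act_act_zero' (hB m) G v
    · exact act_act_zero' (hB (m + 1)) L v
    · exact exact_hom_R _ _ G (hB (m + 1))

variable {c : ℕ → ℕ} {h : ∀ i, Matrix (Fin (c (i + 1))) (Fin (c i)) R}
  {g : ℕ → ℕ} {Gm : ∀ i, Matrix (Fin (g (i + 1))) (Fin (g i)) R}
  {E : Matrix (Fin (c 0)) (Fin (g 0)) R}

/-- ranks in the glued sequence -/
def zb (c g : ℕ → ℕ) : ℤ → ℕ
  | Int.ofNat k => g k
  | Int.negSucc k => c k

/-- matrices in the glued sequence -/
def zB {c g : ℕ → ℕ} (h : ∀ i, Matrix (Fin (c (i + 1))) (Fin (c i)) R)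
    (Gm : ∀ i, Matrix (Fin (g (i + 1))) (Fin (g i)) R)
    (E : Matrix (Fin (c 0)) (Fin (g 0)) R) :
    ∀ n : ℤ, Matrix (Fin (zb c g n)) (Fin (zb c g (n + 1))) R
  | Int.ofNat k => (Gm k).transpose
  | Int.negSucc 0 => E
  | Int.negSucc (k + 1) => h k

/-- exactness of the glued sequence (downwards) -/
structure Glued (h : ∀ i, Matrix (Fin (c (i + 1))) (Fin (c i)) R)
    (Gm : ∀ i, Matrix (Fin (g (i + 1))) (Fin (g i)) R)
    (E : Matrix (Fin (c 0)) (Fin (g 0)) R) : Prop where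
  eh : ∀ i, Exact (act (h i) R) (act (h (i + 1)) R)
  eE : Exact (act E R) (act (h 0) R)
  e0 : Exact (act (Gm 0).transpose R) (act E R)
  eG : ∀ i, Exact (act (Gm (i + 1)).transpose R) (act (Gm i).transpose R)

/-- exactness of the transposed glued sequence -/
structure UpEx (h : ∀ i, Matrix (Fin (c (i + 1))) (Fin (c i)) R)
    (Gm : ∀ i, Matrix (Fin (g (i + 1))) (Fin (g i)) R)
    (E : Matrix (Fin (c 0)) (Fin (g 0)) R) (L : Type u) [AddCommGroup L] [Module R L] : Prop where
  eh : ∀ i, Exact (act (h (i + 1)).transpose L) (act (h i).transpose L)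
  eE : Exact (act (h 0).transpose L) (act E.transpose L)
  e0 : Exact (act E.transpose L) (act (Gm 0) L)
  eG : ∀ i, Exact (act (Gm i) L) (act (Gm (i + 1)) L)

lemma Glued.down (H : Glued h Gm E) (n : ℤ) :
    Exact (act (zB h Gm E (n + 1)) R) (act (zB h Gm E n) R) := by
  match n with
  | Int.ofNat k => exact H.eG k
  | Int.negSucc 0 => exact H.e0
  | Int.negSucc 1 => exact H.eE
  | Int.negSucc (k + 2) => exact H.eh k

lemma UpEx.up {L : Type u} [AddCommGroup L] [Module R L] (H : UpEx h Gm E L) (n : ℤ) :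
    Exact (act (zB h Gm E n).transpose L) (act (zB h Gm E (n + 1)).transpose L) := by
  match n with
  | Int.ofNat k => exact H.eG k
  | Int.negSucc 0 => exact H.e0
  | Int.negSucc 1 => exact H.eE
  | Int.negSucc (k + 2) => exact H.eh k

lemma Glued.up (H : Glued h Gm E) {W : Type u} [AddCommGroup W] [Module R W]
    (hW : FC R (Inj R) W) : UpEx h Gm E W where
  eh i := upZ_of_FC _ _ H.down hW (Int.negSucc (i + 2))
  eE := upZ_of_FC _ _ H.down hW (Int.negSucc 1)
  e0 := upZ_of_FC _ _ H.down hW (Int.negSucc 0)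
  eG i := upZ_of_FC _ _ H.down hW (Int.ofNat i)

lemma exists_glue [IsNoetherianRing R] (h : ∀ i, Matrix (Fin (c (i + 1))) (Fin (c i)) R)
    (hh : ∀ i, Exact (act (h i) R) (act (h (i + 1)) R)) :
    ∃ (g : ℕ → ℕ) (Gm : ∀ i, Matrix (Fin (g (i + 1))) (Fin (g i)) R)
      (e : Fin (g 0) → LinearMap.ker (act (h 0) R)),
      IsRes g Gm e ∧ Glued h Gm (Matrix.of (fun j i => (e i).1 j)) := by
  obtain ⟨g, Gm, e, H⟩ := exists_res R (LinearMap.ker (act (h 0) R))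
  have key : ∀ v, act (Matrix.of (fun j i => (e i).1 j)) R v = (comb (R := R) e v).1 := by
    intro v
    funext j
    simp [act_apply, comb_apply, mul_comm]
  refine ⟨g, Gm, e, H, hh, ?_, ?_, H.ex⟩
  · intro v
    constructor
    · intro hv
      obtain ⟨w, hw⟩ := H.surj ⟨v, hv⟩
      exact ⟨w, by rw [key, hw]⟩
    · rintro ⟨w, rfl⟩
      rw [key]
      exact (comb (R := R) e w).2
  · intro v
    rw [← H.ex0 v, key, ← Subtype.coe_inj]; rfl

lemma Glued.gi (H : Glued h Gm E) (HR : UpEx h Gm E R) (I : Type u) [AddCommGroup I] [Module R I]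
    [Module.Injective R I] : GG.IsGorensteinInjective R (LinearMap.ker (act (Gm 0) I)) := by
  refine ⟨fun n => ModuleCat.of R (Fin (zb c g n) → I), fun n => act (zB h Gm E n).transpose I,
    fun n => inj_pi _, fun n => ?_, ?_, ⟨LinearEquiv.refl _ _⟩⟩
  · have := exact_hom_R _ _ I (H.down n)
    exact (LinearMap.exact_iff.1 this).symm
  · intro J hJ n φ hφ
    have hJ : Module.Injective R J := hJ
    have h1 : Exact (act (zB h Gm E (n+1)) J) (act (zB h Gm E n) J) := exact_hom_R _ _ J (HR.up n)
    have h2 := exact_hom _ _ J I h1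
    let φ' : J →ₗ[R] (Fin (zb c g (n + 1)) → I) := φ
    obtain ⟨k, hk⟩ := (h2 (fun i => (LinearMap.proj i).comp φ')).1 (by
      funext i
      ext x
      have : act (zB h Gm E (n + 1)).transpose I (φ' x) = 0 := LinearMap.congr_fun hφ x
      have := congrFun this i
      simpa [act_apply] using this)
    refine ⟨LinearMap.pi k, ?_⟩
    refine LinearMap.ext fun x => funext fun i => ?_
    have := LinearMap.congr_fun (congrFun hk i) x
    simpa [act_apply, φ'] using this

/-- kernels along a finite injective coresolution -/
lemma Glued.fc_ker (H : Glued h Gm E) (HR : UpEx h Gm E R) {W : Type u} [AddCommGroup W]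
    [Module R W] (hW : FC R (Inj R) W) :
    FC R (fun N _ _ => GG.IsGorensteinInjective R N) (LinearMap.ker (act (Gm 0) W)) := by
  induction hW with
  | of W h => exact FC.of _ (H.gi HR W)
  | step L G C f k hs hG hC ih =>
    have kf : ∀ v ∈ LinearMap.ker (act (Gm 0) L), pw f _ v ∈ LinearMap.ker (act (Gm 0) G) := by
      intro v hv
      rw [LinearMap.mem_ker, ← act_pw, hv, map_zero]
    have kg : ∀ v ∈ LinearMap.ker (act (Gm 0) G), pw k _ v ∈ LinearMap.ker (act (Gm 0) C) := by
      intro v hv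
      rw [LinearMap.mem_ker, ← act_pw, hv, map_zero]
    refine FC.step _ _ _ ((pw f _).restrict kf) ((pw k _).restrict kg) ⟨?_, ?_, ?_⟩ (H.gi HR G) ih
    · intro v w hvw
      exact Subtype.ext ((hs.pow _).inj (congrArg Subtype.val hvw))
    · intro v
      constructor
      · intro hv
        obtain ⟨u, hu⟩ := ((hs.pow _).exact v.1).1 (congrArg Subtype.val hv)
        refine ⟨⟨u, ?_⟩, Subtype.ext hu⟩
        apply (hs.pow _).inj
        rw [act_pw, hu, map_zero]; exact v.2
      · rintro ⟨u, rfl⟩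
        exact Subtype.ext ((hs.pow _).comp_zero u.1)
    · rintro ⟨w, hw⟩
      obtain ⟨w', rfl⟩ := ((H.up hC).e0 w).1 hw
      obtain ⟨v, rfl⟩ := (hs.pow _).surj w'
      refine ⟨⟨act E.transpose G v, ?_⟩, Subtype.ext (act_pw _ _ _)⟩
      exact ((H.up (FC.of G hG)).e0 _).2 ⟨v, rfl⟩

end Glue
end HH

namespace HH
open Function

section Bdir
variable {R : Type u} [CommRing R] {ω : Type u} [AddCommGroup ω] [Module R ω]
variable {b : ℕ → ℕ} {A : ∀ i, Matrix (Fin (b (i + 1))) (Fin (b i)) R} {e : Fin (b 0) → ω}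

/-- dualizing data -/
structure Dz (A : ∀ i, Matrix (Fin (b (i + 1))) (Fin (b i)) R) (e : Fin (b 0) → ω) : Prop where
  res : IsRes b A e
  fc : FC R (Inj R) ω
  ex : ∀ i, Exact (act (A i) ω) (act (A (i + 1)) ω)
  endo : ∀ v : Fin (b 0) → ω, act (A 0) ω v = 0 → ∃ r : R, ∀ j, v j = r • e j
  faith : ∀ r : R, (∀ j, r • e j = 0) → r = 0

/-- evaluation -/
def ev {n : ℕ} (e : Fin n → ω) (Y : Type u) [AddCommGroup Y] [Module R Y] :
    (Fin n → (ω →ₗ[R] Y)) →ₗ[R] Y where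
  toFun k := ∑ j, k j (e j)
  map_add' v w := by simp [Finset.sum_add_distrib]
  map_smul' r v := by simp [Finset.smul_sum]

lemma ev_apply {n : ℕ} (e : Fin n → ω) {Y : Type u} [AddCommGroup Y] [Module R Y]
    (k : Fin n → (ω →ₗ[R] Y)) : ev e Y k = ∑ j, k j (e j) := rfl

/-- the Bass class conditions on evaluation -/
structure KEx (A : ∀ i, Matrix (Fin (b (i + 1))) (Fin (b i)) R) (e : Fin (b 0) → ω)
    (Y : Type u) [AddCommGroup Y] [Module R Y] : Prop where
  k0 : Surjective (ev (R := R) e Y)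
  k1 : Exact (act (A 0).transpose (ω →ₗ[R] Y)) (ev (R := R) e Y)
  k2 : ∀ i, Exact (act (A (i + 1)).transpose (ω →ₗ[R] Y)) (act (A i).transpose (ω →ₗ[R] Y))

lemma Dz.end_eq (D : Dz A e) (φ : ω →ₗ[R] ω) : ∃ r : R, ∀ w, φ w = r • w := by
  obtain ⟨r, hr⟩ := D.endo (fun j => φ (e j)) (D.res.hom_mem φ)
  refine ⟨r, fun w => ?_⟩
  have : φ = r • LinearMap.id := D.res.hom_ext (fun j => by simp [hr])
  simp [this]

lemma Dz.faith' (D : Dz A e) {r s : R} (h : ∀ w : ω, r • w = s • w) : r = s :=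
  sub_eq_zero.1 (D.faith _ (fun j => by rw [sub_smul, h, sub_self]))

lemma Dz.ez (D : Dz A e) (i : ℕ) : EZ R ω ω (i + 1) := (D.res.ez_iff ω i ω).2 (D.ex i)

lemma Dz.hom_pow (D : Dz A e) {n : ℕ} (ψ : (Fin n → ω) →ₗ[R] ω) :
    ∃ r : Fin n → R, ∀ v, ψ v = ∑ k, r k • v k := by
  obtain ⟨f, hf⟩ := exists_hom_vec ψ
  choose r hr using fun k => D.end_eq (f k)
  exact ⟨r, fun v => by simp [hf, hr]⟩

/-- `w ↦ (v_k w)_k` -/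
def vec {n : ℕ} (v : Fin n → R) (ω : Type u) [AddCommGroup ω] [Module R ω] :
    ω →ₗ[R] (Fin n → ω) where
  toFun w k := v k • w
  map_add' x y := by funext k; simp
  map_smul' r x := by funext k; simp [smul_comm r]

lemma vec_apply {n : ℕ} (v : Fin n → R) (w : ω) (k : Fin n) : vec v ω w k = v k • w := rfl

lemma act_vec {m n : ℕ} (B : Matrix (Fin m) (Fin n) R) (v : Fin n → R) (w : ω) :
    act B ω (vec v ω w) = vec (act B R v) ω w := by
  funext i
  simp [act_apply, vec_apply, Finset.sum_smul, mul_smul]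

lemma Dz.vec_inj (D : Dz A e) {n : ℕ} {v v' : Fin n → R} (h : ∀ w, vec v ω w = vec v' ω w) :
    v = v' := by
  funext k
  exact D.faith' (fun w => congrFun (h w) k)

/-- a model of `ω ⊗ N` with vanishing higher Tor -/
structure Model (A : ∀ i, Matrix (Fin (b (i + 1))) (Fin (b i)) R) {N T : Type u} [AddCommGroup N]
    [Module R N] [AddCommGroup T] [Module R T] (t : (Fin (b 0) → N) →ₗ[R] T) : Prop where
  surj : Surjective t
  ex : Exact (act (A 0).transpose N) t
  hi : ∀ i, Exact (act (A (i + 1)).transpose N) (act (A i).transpose N)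

/-- the map `(R^c)^b → ω^c` -/
def tR {n : ℕ} (e : Fin n → ω) (c : ℕ) : (Fin n → Fin c → R) →ₗ[R] (Fin c → ω) where
  toFun u k := ∑ j, u j k • e j
  map_add' v w := by funext k; simp [add_smul, Finset.sum_add_distrib]
  map_smul' r v := by funext k; simp [Finset.smul_sum, mul_smul]

lemma tR_apply {n : ℕ} (e : Fin n → ω) (c : ℕ) (u : Fin n → Fin c → R) (k : Fin c) :
    tR e c u k = comb (R := R) e (fun j => u j k) := rfl

lemma IsRes.modelR (H : IsRes b A e) (c : ℕ) : Model A (tR (R := R) e c) where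
  surj w := by
    choose v hv using fun k => H.surj (w k)
    exact ⟨fun j k => v k j, by funext k; rw [tR_apply, hv]⟩
  ex u := by
    have key : ∀ (w : Fin (b 1) → Fin c → R) (k : Fin c),
      (fun i => act (A 0).transpose (Fin c → R) w i k) = act (A 0).transpose R (fun j => w j k) := by
      intro w t
      funext i; simp [act_apply]
    constructor
    · intro hu
      have : ∀ k, ∃ w, act (A 0).transpose R w = fun j => u j k := fun k => by
        refine (H.ex0 _).1 ?_
        rw [← tR_apply, hu]; rfl
      choose w hw using this
      refine ⟨fun j k => w k j, ?_⟩
      funext i k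
      exact (congrFun (key (fun j k => w k j) k) i).trans (congrFun (hw k) i)
    · rintro ⟨w, rfl⟩
      funext k
      rw [tR_apply, key w k]
      exact (H.ex0 _).2 ⟨_, rfl⟩
  hi i := exact_pi _ _ (H.ex i)

lemma comb_nat {L L' : Type u} [AddCommGroup L] [Module R L] [AddCommGroup L'] [Module R L']
    {n : ℕ} (e : Fin n → L) (f : L →ₗ[R] L') (v : Fin n → R) :
    f (comb (R := R) e v) = comb (R := R) (fun j => f (e j)) v := by
  simp [comb_apply]

lemma tau_step (H : IsRes b A e) {N T : Type u} [AddCommGroup N]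
    [Module R N] [AddCommGroup T] [Module R T] (t : (Fin (b 0) → N) →ₗ[R] T) (hm : Model A t)
    {c : ℕ} (f : Fin c → N) (hf : Surjective (comb (R := R) f)) (s : (Fin c → ω) →ₗ[R] T)
    (hs : ∀ u : Fin (b 0) → Fin c → R, s (tR e c u) = t (fun j => comb (R := R) f (u j))) :
    Surjective s ∧ ∃ t1 : (Fin (b 0) → LinearMap.ker (comb (R := R) f)) →ₗ[R] LinearMap.ker s,
      Model A t1 ∧ ∀ u, (t1 u).1 = tR e c (fun j => (u j).1) := by
  have hR := H.modelR c
  have ss := ses_ker hf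
  have hss : Surjective s := by
    intro x
    obtain ⟨n, rfl⟩ := hm.surj x
    obtain ⟨u, rfl⟩ := (ss.pow _).surj n
    exact ⟨tR e c u, hs u⟩
  have hmem : ∀ u : Fin (b 0) → LinearMap.ker (comb (R := R) f),
      tR e c (fun j => (u j).1) ∈ LinearMap.ker s := by
    intro u
    rw [LinearMap.mem_ker, hs]
    have : (fun j => comb (R := R) f (u j).1) = 0 := by funext j; exact (u j).2
    rw [this, map_zero]
  let t1 : (Fin (b 0) → LinearMap.ker (comb (R := R) f)) →ₗ[R] LinearMap.ker s :=
    LinearMap.codRestrict _ ((tR e c).comp (pw (LinearMap.ker (comb (R := R) f)).subtype _)) hmem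
  refine ⟨hss, t1, ⟨?_, ?_, fun i => ?_⟩, fun u => rfl⟩
  · rintro ⟨w, hw⟩
    obtain ⟨u, rfl⟩ := hR.surj w
    obtain ⟨n, hn⟩ := (hm.ex (pw (comb (R := R) f) _ u)).1 (by
      have := hs u
      rw [hw] at this; exact this.symm)
    obtain ⟨m, rfl⟩ := (ss.pow _).surj n
    obtain ⟨y, hy⟩ := ((ss.pow _).exact (u - act (A 0).transpose _ m)).1 (by
      rw [map_sub, act_pw, hn, sub_self])
    refine ⟨y, Subtype.ext ?_⟩
    show tR e c (pw _ _ y) = tR e c u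
    rw [hy, map_sub, (hR.ex _).2 ⟨m, rfl⟩, sub_zero]
  · refine sub_exact (act (A 0).transpose _) t1 (act (A 1).transpose (Fin c → R))
      (act (A 0).transpose _) (tR e c) (act (A 1).transpose N) (act (A 0).transpose N)
      (pw (LinearMap.ker (comb (R := R) f)).subtype _) (pw (LinearMap.ker (comb (R := R) f)).subtype _)
      (LinearMap.ker s).subtype (pw (comb f) _) (pw (comb f) _) (pw (comb f) _)
      (act_pw _ _) (fun _ => rfl) (act_pw _ _) (act_pw _ _) (ss.pow _).inj (ss.pow _).exact
      (ss.pow _).comp_zero (ss.pow _).surj ?_ ?_ (fun x hx => (hR.ex x).1 hx)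
      (fun x hx => (hm.hi 0 x).1 hx)
    · intro x
      refine Subtype.ext ?_
      show tR e c (pw _ _ _) = 0
      rw [act_pw]
      exact (hR.ex _).2 ⟨_, rfl⟩
    · exact fun x => (hR.hi 0 _).2 ⟨x, rfl⟩
  · refine ss.act_sub (A (i + 2)).transpose (A (i + 1)).transpose _ ?_ ?_ (hR.hi i) (hm.hi (i + 1))
    · exact fun x => (hR.hi (i+1) _).2 ⟨x, rfl⟩
    · intro v
      exact act_act_zero (H.ex i) _ v

lemma tau_ex0 (H : IsRes b A e) {N T : Type u} [AddCommGroup N]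
    [Module R N] [AddCommGroup T] [Module R T] (t : (Fin (b 0) → N) →ₗ[R] T) (hm : Model A t)
    {c : ℕ → ℕ} {h : ∀ i, Matrix (Fin (c (i + 1))) (Fin (c i)) R} {f : Fin (c 0) → N}
    (HN : IsRes c h f) (s : (Fin (c 0) → ω) →ₗ[R] T)
    (hs : ∀ u : Fin (b 0) → Fin (c 0) → R, s (tR e _ u) = t (fun j => comb (R := R) f (u j))) :
    ∃ (t1 : (Fin (b 0) → LinearMap.ker (comb (R := R) f)) →ₗ[R] LinearMap.ker s)
      (s1 : (Fin (c 1) → ω) →ₗ[R] LinearMap.ker s), Model A t1 ∧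
      (∀ u : Fin (b 0) → Fin (c 1) → R, s1 (tR e _ u) = t1 (fun j => comb (R := R) HN.gen (u j))) ∧
      ∀ v, (s1 v).1 = act (h 0).transpose ω v := by
  obtain ⟨hss, t1, hm1, ht1⟩ := tau_step H t hm f HN.surj s hs
  have key : ∀ u : Fin (b 0) → Fin (c 1) → R,
      act (h 0).transpose ω (tR e _ u) = tR e _ (fun j => act (h 0).transpose R (u j)) := by
    intro u
    funext k
    simp only [act_apply, tR_apply, comb_apply, Finset.smul_sum, Finset.sum_smul, smul_smul,
      smul_eq_mul]
    exact Finset.sum_comm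
  have hmem : ∀ v, act (h 0).transpose ω v ∈ LinearMap.ker s := by
    intro v
    obtain ⟨u, rfl⟩ := (H.modelR (c 1)).surj v
    rw [LinearMap.mem_ker, key, hs]
    have : (fun j => comb (R := R) f (act (h 0).transpose R (u j))) = 0 := by
      funext j; exact (HN.ex0 _).2 ⟨_, rfl⟩
    rw [this, map_zero]
  refine ⟨t1, LinearMap.codRestrict _ (act (h 0).transpose ω) hmem, hm1, fun u => ?_, fun v => rfl⟩
  refine Subtype.ext ?_
  rw [ht1]
  show act (h 0).transpose ω (tR e _ u) = _
  rw [key]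
  simp only [HN.comb_gen]

lemma tau_exact (H : IsRes b A e) (j : ℕ) : ∀ {N T : Type u} [AddCommGroup N]
    [Module R N] [AddCommGroup T] [Module R T] (t : (Fin (b 0) → N) →ₗ[R] T) (_ : Model A t)
    {c : ℕ → ℕ} {h : ∀ i, Matrix (Fin (c (i + 1))) (Fin (c i)) R} {f : Fin (c 0) → N}
    (_ : IsRes c h f) (s : (Fin (c 0) → ω) →ₗ[R] T)
    (_ : ∀ u : Fin (b 0) → Fin (c 0) → R, s (tR e _ u) = t (fun j => comb (R := R) f (u j))),
    Exact (act (h 0).transpose ω) s ∧ Exact (act (h (j + 1)).transpose ω) (act (h j).transpose ω) := by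
  induction j with
  | zero =>
    intro N T _ _ _ _ t hm c h f HN s hs
    obtain ⟨t1, s1, hm1, hc1, hs1⟩ := tau_ex0 H t hm HN s hs
    obtain ⟨t2, s2, hm2, hc2, hs2⟩ := tau_ex0 H t1 hm1 HN.shift s1 hc1
    have q1 := (tau_step H t1 hm1 HN.gen HN.shift.surj s1 hc1).1
    have q2 := (tau_step H t2 hm2 HN.shift.gen HN.shift.shift.surj s2 hc2).1
    constructor
    · intro v
      constructor
      · intro hv
        obtain ⟨w, hw⟩ := q1 ⟨v, hv⟩
        exact ⟨w, by rw [← hs1, hw]⟩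
      · rintro ⟨w, rfl⟩
        rw [← hs1]; exact (s1 w).2
    · intro v
      constructor
      · intro hv
        obtain ⟨w, hw⟩ := q2 ⟨v, Subtype.ext (by rw [hs1, hv]; rfl)⟩
        exact ⟨w, by rw [← hs2 w, hw]⟩
      · rintro ⟨w, rfl⟩
        rw [← hs2 w, ← hs1]
        have := (s2 w).2
        rw [LinearMap.mem_ker] at this
        rw [this]; rfl
  | succ j ih =>
    intro N T _ _ _ _ t hm c h f HN s hs
    obtain ⟨t1, s1, hm1, hc1, hs1⟩ := tau_ex0 H t hm HN s hs
    have q1 := (tau_step H t1 hm1 HN.gen HN.shift.surj s1 hc1).1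
    refine ⟨?_, (ih t1 hm1 HN.shift s1 hc1).2⟩
    intro v
    constructor
    · intro hv
      obtain ⟨w, hw⟩ := q1 ⟨v, hv⟩
      exact ⟨w, by rw [← hs1, hw]⟩
    · rintro ⟨w, rfl⟩
      rw [← hs1]; exact (s1 w).2

lemma dual_exact (D : Dz A e) (j : ℕ) : ∀ {T : Type u} [AddCommGroup T] [Module R T]
    {c : ℕ → ℕ} {h : ∀ i, Matrix (Fin (c (i + 1))) (Fin (c i)) R}
    (s : (Fin (c 0) → ω) →ₗ[R] T) (_ : Surjective s)
    (_ : ∀ i (v : Fin (c i) → R), act (h (i + 1)) R (act (h i) R v) = 0)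
    (_ : Exact (act (h 0).transpose ω) s)
    (_ : ∀ i, Exact (act (h (i + 1)).transpose ω) (act (h i).transpose ω))
    (_ : ∀ i, EZ R T ω (i + 1)), Exact (act (h j) R) (act (h (j + 1)) R) := by
  induction j with
  | zero =>
    intro T _ _ c h s hs hz h0 hi hE v
    refine ⟨fun hv => ?_, by rintro ⟨w, rfl⟩; exact hz 0 w⟩
    let φ : (Fin (c 1) → ω) →ₗ[R] ω := sumHom (fun k => v k • LinearMap.id)
    have hφ : ∀ w, φ w = ∑ k, v k • w k := fun w => by simp [φ, sumHom_apply]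
    have hle : LinearMap.ker (act (h 0).transpose ω) ≤ LinearMap.ker φ := by
      intro w hw
      obtain ⟨x, rfl⟩ := (hi 0 w).1 hw
      rw [LinearMap.mem_ker, hφ]
      have : ∑ k, v k • act (h 1).transpose ω x k = ∑ l, act (h 1) R v l • x l := by
        simp only [act_apply, Finset.smul_sum, Finset.sum_smul, smul_smul, smul_eq_mul,
          Matrix.transpose_apply, mul_comm]
        exact Finset.sum_comm
      rw [this, hv]; simp
    have hmem : ∀ w, act (h 0).transpose ω w ∈ LinearMap.ker s := fun w => (h0 _).2 ⟨w, rfl⟩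
    let q : (Fin (c 1) → ω) →ₗ[R] LinearMap.ker s := LinearMap.codRestrict _ (act (h 0).transpose ω) hmem
    have hq : Surjective q := by
      rintro ⟨x, hx⟩
      obtain ⟨w, hw⟩ := (h0 x).1 hx
      exact ⟨w, Subtype.ext hw⟩
    have hle' : LinearMap.ker q ≤ LinearMap.ker φ := by
      intro w hw
      exact hle (congrArg Subtype.val hw)
    let φ' : LinearMap.ker s →ₗ[R] ω :=
      ((LinearMap.ker q).liftQ φ hle').comp (q.quotKerEquivOfSurjective hq).symm.toLinearMap
    have hφ' : ∀ w, φ' (q w) = φ w := by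
      intro w
      have : (q.quotKerEquivOfSurjective hq).symm (q w) = Submodule.Quotient.mk w := by
        rw [LinearEquiv.symm_apply_eq]; rfl
      simp [φ', this]
    obtain ⟨ψ, hψ⟩ := (ses_ker hs).ext1 (hE 0) φ'
    obtain ⟨r, hr⟩ := D.hom_pow ψ
    refine ⟨r, ?_⟩
    funext k
    refine D.faith' (fun w => ?_)
    have h1 : φ' (q (Pi.single k w)) = v k • w := by
      rw [hφ', hφ]; simp [Pi.single_apply, smul_ite]
    rw [← h1, ← hψ]
    show _ = ψ (act (h 0).transpose ω (Pi.single k w))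
    rw [hr]
    simp only [act_apply, Finset.sum_smul, Matrix.transpose_apply, smul_eq_mul]
    refine Finset.sum_congr rfl (fun j _ => ?_)
    simp [Pi.single_apply, smul_ite, smul_smul, mul_comm]
  | succ j ih =>
    intro T _ _ c h s hs hz h0 hi hE
    have hmem : ∀ w, act (h 0).transpose ω w ∈ LinearMap.ker s := fun w => (h0 _).2 ⟨w, rfl⟩
    let q : (Fin (c 1) → ω) →ₗ[R] LinearMap.ker s := LinearMap.codRestrict _ (act (h 0).transpose ω) hmem
    have hq : Surjective q := by
      rintro ⟨x, hx⟩
      obtain ⟨w, hw⟩ := (h0 x).1 hx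
      exact ⟨w, Subtype.ext hw⟩
    refine ih (c := fun i => c (i + 1)) (h := fun i => h (i + 1)) q hq (fun i => hz (i + 1)) ?_
      (fun i => hi (i + 1)) (fun i => ?_)
    · intro w
      rw [← hi 0 w, ← Subtype.coe_inj]; rfl
    · exact (ses_ker hs).ezX_sub ((D.ez i).powX _) (hE (i + 1))

lemma lift_exact (D : Dz A e) (j : ℕ) : ∀ {T : Type u} [AddCommGroup T] [Module R T]
    {g : ℕ → ℕ} {Gm : ∀ i, Matrix (Fin (g (i + 1))) (Fin (g i)) R}
    (θ : T →ₗ[R] (Fin (g 0) → ω)) (_ : Injective θ)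
    (_ : ∀ i (v : Fin (g i) → R), act (Gm (i + 1)) R (act (Gm i) R v) = 0)
    (_ : Exact θ (act (Gm 0) ω))
    (_ : ∀ i, Exact (act (Gm i) ω) (act (Gm (i + 1)) ω))
    (_ : ∀ i, EZ R ω T (i + 1)), Exact (act (Gm j) R) (act (Gm (j + 1)) R) := by
  induction j with
  | zero =>
    intro T _ _ g Gm θ hθ hz h0 hi hE v
    refine ⟨fun hv => ?_, by rintro ⟨w, rfl⟩; exact hz 0 w⟩
    have ss : Ses θ (act (Gm 0) ω).rangeRestrict := ⟨hθ, fun x => by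
      rw [← h0 x, ← Subtype.coe_inj]; rfl, LinearMap.surjective_rangeRestrict _⟩
    have hmem : ∀ w, vec v ω w ∈ LinearMap.range (act (Gm 0) ω) := by
      intro w
      refine (hi 0 _).1 ?_
      rw [act_vec, hv]; funext k; simp [vec_apply]
    obtain ⟨ψ, hψ⟩ := ss.lift1 (hE 0) (LinearMap.codRestrict _ (vec v ω) hmem)
    choose r hr using fun k => D.end_eq ((LinearMap.proj k).comp ψ)
    refine ⟨r, D.vec_inj (fun w => ?_)⟩
    have h1 : vec r ω w = ψ w := by funext k; exact (hr k w).symm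
    rw [← act_vec, h1]
    exact congrArg Subtype.val (LinearMap.congr_fun hψ w)
  | succ j ih =>
    intro T _ _ g Gm θ hθ hz h0 hi hE
    have ss : Ses θ (act (Gm 0) ω).rangeRestrict := ⟨hθ, fun x => by
      rw [← h0 x, ← Subtype.coe_inj]; rfl, LinearMap.surjective_rangeRestrict _⟩
    refine ih (g := fun i => g (i + 1)) (Gm := fun i => Gm (i + 1))
      (LinearMap.range (act (Gm 0) ω)).subtype Subtype.val_injective (fun i => hz (i + 1)) ?_
      (fun i => hi (i + 1)) (fun i => ?_)
    · intro w
      rw [hi 0 w]; simp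
    · exact ss.ezY_quot ((D.ez i).powY _) (hE (i + 1))

theorem Bdir [IsNoetherianRing R] (D : Dz A e) (M : Type u) [AddCommGroup M] [Module R M]
    [Module.Finite R M] (hMω : ∀ i, EZ R M ω (i + 1)) (hE : ∀ i, EZ R ω M (i + 1))
    (hK : KEx A e M) : ∃ n, GG.gidLE R M n := by
  have hfin : Module.Finite R (ω →ₗ[R] M) := by
    let p : (ω →ₗ[R] M) →ₗ[R] (Fin (b 0) → M) := 
      { toFun := fun f j => f (e j), map_add' := fun f g => rfl, map_smul' := fun r f => rfl }
    exact Module.Finite.of_injective p (fun f g h => D.res.hom_ext (fun j => congrFun h j))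
  obtain ⟨c, h, f, HN⟩ := exists_res R (ω →ₗ[R] M)
  let s : (Fin (c 0) → ω) →ₗ[R] M := sumHom f
  have hm : Model A (ev (R := R) e M) := ⟨hK.k0, hK.k1, hK.k2⟩
  have hs : ∀ u : Fin (b 0) → Fin (c 0) → R, s (tR e _ u) =
      ev e M (fun j => comb (R := R) f (u j)) := by
    intro u
    simp only [s, sumHom_apply, tR_apply, comb_apply, ev_apply, map_sum, map_smul,
      LinearMap.sum_apply, LinearMap.smul_apply]
    exact Finset.sum_comm
  have hss := (tau_step D.res _ hm f HN.surj s hs).1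
  have h0 := (tau_exact D.res 0 _ hm HN s hs).1
  have hi := fun i => (tau_exact D.res i _ hm HN s hs).2
  have hdual := fun j => dual_exact D j s hss
    (fun i v => by simpa using act_act_zero' (HN.ex i) R v) h0 hi hMω
  obtain ⟨g, Gm, eT, HT, HG⟩ := exists_glue h hdual
  set E : Matrix (Fin (c 0)) (Fin (g 0)) R := Matrix.of (fun j i => (eT i).1 j) with hEdef
  have U := HG.up D.fc
  have hsvec : ∀ (v : Fin (c 0) → R) (w : ω), s (vec v ω w) = comb (R := R) f v w := by
    intro v w
    simp [s, sumHom_apply, vec_apply, comb_apply]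
  -- the embedding of `M`
  have hle : LinearMap.ker s ≤ LinearMap.ker (act E.transpose ω) := by
    intro v hv
    obtain ⟨w, rfl⟩ := (h0 v).1 hv
    exact (U.eE _).2 ⟨w, rfl⟩
  let θ : M →ₗ[R] (Fin (g 0) → ω) := ((LinearMap.ker s).liftQ (act E.transpose ω) hle).comp
    (s.quotKerEquivOfSurjective hss).symm.toLinearMap
  have hθs : ∀ v, θ (s v) = act E.transpose ω v := by
    intro w
    have : (s.quotKerEquivOfSurjective hss).symm (s w) = Submodule.Quotient.mk w := by
      rw [LinearEquiv.symm_apply_eq]; rfl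
    simp [θ, this]
  have hθ : Injective θ := by
    rw [injective_iff_map_eq_zero]
    intro m hmz
    obtain ⟨v, rfl⟩ := hss m
    rw [hθs] at hmz
    exact (h0 v).2 ((U.eE v).1 hmz)
  have hθe : Exact θ (act (Gm 0) ω) := by
    intro v
    rw [U.e0 v]
    constructor
    · rintro ⟨w, rfl⟩; exact ⟨s w, hθs w⟩
    · rintro ⟨m, rfl⟩
      obtain ⟨w, rfl⟩ := hss m
      exact ⟨w, (hθs w).symm⟩
  have UR : UpEx h Gm E R := by
    refine ⟨HN.ex, ?_, ?_, fun j => lift_exact D j θ hθ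
      (fun i v => by simpa using act_act_zero' (HG.eG i) R v) hθe U.eG hE⟩
    · intro v
      refine ⟨fun hv => ?_, ?_⟩
      · refine (HN.ex0 v).1 ?_
        ext w
        rw [← hsvec]
        refine (h0 _).2 ((U.eE _).1 ?_)
        rw [act_vec, hv]; funext k; simp [vec_apply]
      · rintro ⟨w, rfl⟩
        exact act_act_zero' HG.eE R w
    · intro v
      refine ⟨fun hv => ?_, ?_⟩
      · have hmem : ∀ w, vec v ω w ∈ LinearMap.range θ := by
          intro w
          refine (hθe _).1 ?_
          rw [act_vec, hv]; funext k; simp [vec_apply]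
        let φ : ω →ₗ[R] M := (LinearEquiv.ofInjective θ hθ).symm.toLinearMap.comp
          (LinearMap.codRestrict _ (vec v ω) hmem)
        have hφ : ∀ w, θ (φ w) = vec v ω w := by
          intro w
          have := (LinearEquiv.ofInjective θ hθ).apply_symm_apply (LinearMap.codRestrict _ (vec v ω) hmem w)
          exact congrArg Subtype.val this
        obtain ⟨r, hr⟩ := HN.surj φ
        refine ⟨r, D.vec_inj (fun w => ?_)⟩
        rw [← act_vec, ← hθs, hsvec, hr, hφ]
      · rintro ⟨w, rfl⟩
        simpa using act_act_zero' HG.e0 R w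
  have := HG.fc_ker UR D.fc
  let eM : LinearMap.ker (act (Gm 0) ω) ≃ₗ[R] M :=
    ((LinearEquiv.ofInjective θ hθ).trans (LinearEquiv.ofEq _ _ (LinearMap.exact_iff.1 hθe).symm)).symm
  exact FC.to_coresolution (P := fun N _ _ => GG.IsGorensteinInjective R N) gi_punit
    (FC.congr (fun N N' _ _ _ _ e h => gi_congr N N' e h) eM this)

end Bdir
end HH

namespace HH
open Function CategoryTheory CategoryTheory.Abelian

section TAsec
variable {R : Type u} [CommRing R]

/-- totally acyclic complexes of injectives -/
structure TA (X : ℤ → ModuleCat.{u} R) (d : ∀ n : ℤ, X n →ₗ[R] X (n + 1)) : Prop where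
  inj : ∀ n, Module.Injective R (X n)
  ex : ∀ n, LinearMap.range (d n) = LinearMap.ker (d (n + 1))
  lift : ∀ (I : ModuleCat.{u} R), Module.Injective R I →
      ∀ (n : ℤ) (φ : I →ₗ[R] X (n + 1)), (d (n + 1)).comp φ = 0 →
        ∃ ψ : I →ₗ[R] X n, (d n).comp ψ = φ

variable {X : ℤ → ModuleCat.{u} R} {d : ∀ n : ℤ, X n →ₗ[R] X (n + 1)}

lemma TA.mem (T : TA X d) (n : ℤ) (x : X n) : d n x ∈ LinearMap.ker (d (n + 1)) := by
  rw [← T.ex]; exact ⟨x, rfl⟩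

lemma TA.ses (T : TA X d) (n : ℤ) : Ses (LinearMap.ker (d n)).subtype
    ((d n).codRestrict (LinearMap.ker (d (n + 1))) (T.mem n)) where
  inj := Subtype.val_injective
  exact v := by
    rw [Subtype.ext_iff]
    constructor
    · intro h; exact ⟨⟨v, h⟩, rfl⟩
    · rintro ⟨⟨w, hw⟩, rfl⟩; exact hw
  surj := by
    rintro ⟨w, hw⟩
    rw [← T.ex] at hw
    obtain ⟨x, rfl⟩ := hw
    exact ⟨x, rfl⟩

lemma TA.liftFC (T : TA X d) {D : Type u} [AddCommGroup D] [Module R D] (h : FC R (Inj R) D) :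
    ∀ (n : ℤ) (φ : D →ₗ[R] X (n + 1)), (d (n + 1)).comp φ = 0 →
        ∃ ψ : D →ₗ[R] X n, (d n).comp ψ = φ := by
  induction h with
  | of L h => exact fun n φ hφ => T.lift (ModuleCat.of R L) h n φ hφ
  | step L G C f g h hG hC ih =>
    intro n φ hφ
    have := T.inj (n + 1)
    have := T.inj (n + 1 + 1)
    obtain ⟨φ', hφ'⟩ := Module.Injective.out f h.inj φ
    obtain ⟨χ', hχ'⟩ := inj_ext f g h.exact ((d (n + 1)).comp φ') (fun x => by
      rw [LinearMap.comp_apply, hφ']; exact LinearMap.congr_fun hφ x)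
    obtain ⟨χ, hχ⟩ := ih (n + 1) χ' (by
      ext c
      obtain ⟨y, rfl⟩ := h.surj c
      rw [LinearMap.comp_apply, hχ']
      exact T.mem (n + 1) _)
    obtain ⟨ψ, hψ⟩ := T.lift (ModuleCat.of R G) hG n (φ' - χ.comp g) (by
      ext y
      have := LinearMap.congr_fun hχ (g y)
      rw [hχ'] at this
      simp only [LinearMap.comp_apply] at this
      simp only [LinearMap.comp_apply, LinearMap.sub_apply, map_sub, LinearMap.zero_apply]
      rw [this, sub_self])
    refine ⟨ψ.comp f, ?_⟩
    ext x
    have := LinearMap.congr_fun hψ (f x)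
    simp only [LinearMap.comp_apply, LinearMap.sub_apply] at this ⊢
    rw [this, h.comp_zero, map_zero, sub_zero, hφ']

lemma TA.ez (T : TA X d) {D : Type u} [AddCommGroup D] [Module R D] (h : FC R (Inj R) D) (i : ℕ) :
    ∀ n, EZ R D (LinearMap.ker (d n)) (i + 1) := by
  induction i with
  | zero =>
    intro n
    have := T.inj n
    refine (T.ses n).ez_of_lift (ez_inj 0) (fun φ => ?_)
    obtain ⟨ψ, hψ⟩ := T.liftFC h n ((LinearMap.ker (d (n + 1))).subtype.comp φ) (by
      ext x; exact (φ x).2)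
    refine ⟨ψ, ?_⟩
    ext x
    exact LinearMap.congr_fun hψ x
  | succ i ih =>
    intro n
    have := T.inj n
    exact (T.ses n).ezY_sub (ih (n + 1)) (ez_inj _)

lemma gi_ez {D N : Type u} [AddCommGroup D] [Module R D] [AddCommGroup N] [Module R N]
    (h : FC R (Inj R) D) (hN : GG.IsGorensteinInjective R N) (i : ℕ) : EZ R D N (i + 1) := by
  obtain ⟨X, d, h1, h2, h3, ⟨e⟩⟩ := hN
  exact ((TA.mk h1 h2 h3).ez h i 0).congrY e.symm

lemma FC.gi_ez {D W : Type u} [AddCommGroup D] [Module R D] [AddCommGroup W] [Module R W]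
    (hD : FC R (Inj R) D) (h : FC R (GG.IsGorensteinInjective R) W) :
    ∃ n : ℕ, ∀ (i : ℕ), n < i → EZ R D W i := by
  induction h with
  | of L h =>
    refine ⟨0, fun i hi => ?_⟩
    obtain ⟨i, rfl⟩ := Nat.exists_eq_succ_of_ne_zero hi.ne'
    exact HH.gi_ez hD h i
  | step L G C f g h hG hC ih =>
    obtain ⟨n, hn⟩ := ih
    refine ⟨n + 1, fun i hi => ?_⟩
    obtain ⟨i, rfl⟩ := Nat.exists_eq_succ_of_ne_zero (show i ≠ 0 by omega)
    exact h.ezY_sub (hn i (by omega)) (HH.gi_ez hD hG i)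
end TAsec

section KEsec
variable {R : Type u} [CommRing R] {ω : Type u} [AddCommGroup ω] [Module R ω]
variable {b : ℕ → ℕ} {A : ∀ i, Matrix (Fin (b (i + 1))) (Fin (b i)) R} {e : Fin (b 0) → ω}
variable {L G C : Type u} [AddCommGroup L] [Module R L] [AddCommGroup G] [Module R G]
    [AddCommGroup C] [Module R C] {f : L →ₗ[R] G} {g : G →ₗ[R] C}

/-- Bass class spots -/
def KE (A : ∀ i, Matrix (Fin (b (i + 1))) (Fin (b i)) R) (e : Fin (b 0) → ω)
    (Y : Type u) [AddCommGroup Y] [Module R Y] : ℕ → Prop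
  | 0 => Surjective (ev (R := R) e Y)
  | 1 => Exact (act (A 0).transpose (ω →ₗ[R] Y)) (ev (R := R) e Y)
  | (i + 2) => Exact (act (A (i + 1)).transpose (ω →ₗ[R] Y)) (act (A i).transpose (ω →ₗ[R] Y))

lemma kex_of_ke {Y : Type u} [AddCommGroup Y] [Module R Y] (h : ∀ i, KE A e Y i) : KEx A e Y :=
  ⟨h 0, h 1, fun i => h (i + 2)⟩

/-- postcomposition -/
def hm (ω : Type u) [AddCommGroup ω] [Module R ω] (f : L →ₗ[R] G) :
    (ω →ₗ[R] L) →ₗ[R] (ω →ₗ[R] G) where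
  toFun k := f.comp k
  map_add' v w := by ext; simp
  map_smul' r v := by ext; simp

lemma Ses.hm (h : Ses f g) (hL : EZ R ω L 1) : Ses (HH.hm ω f) (HH.hm ω g) where
  inj v w hvw := by
    ext x; exact h.inj (LinearMap.congr_fun hvw x)
  exact v := by
    constructor
    · intro hv
      have hv' : ∀ x, v x ∈ LinearMap.range f := fun x => (h.exact _).1 (LinearMap.congr_fun hv x)
      refine ⟨(LinearEquiv.ofInjective f h.inj).symm.toLinearMap.comp (v.codRestrict _ hv'), ?_⟩
      ext x
      show f ((LinearEquiv.ofInjective f h.inj).symm (v.codRestrict _ hv' x)) = v x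
      rw [← LinearEquiv.ofInjective_apply (h := h.inj), LinearEquiv.apply_symm_apply]
      rfl
    · rintro ⟨u, rfl⟩
      ext x; exact h.comp_zero _
  surj v := h.lift1 hL v

lemma ev_nat {n : ℕ} (e : Fin n → ω) (f : L →ₗ[R] G) (k : Fin n → (ω →ₗ[R] L)) :
    f (ev e L k) = ev e G (pw (hm ω f) n k) := by
  simp [ev_apply, hm]

lemma IsRes.ev_act (H : IsRes b A e) (k : Fin (b 1) → (ω →ₗ[R] L)) :
    ev e L (act (A 0).transpose _ k) = 0 := by
  have : ∀ j, ∑ l, A 0 j l • e l = 0 := fun j => by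
    have := congrFun H.act_e j
    rwa [act_apply] at this
  simp only [ev_apply, act_apply, LinearMap.sum_apply, LinearMap.smul_apply, Matrix.transpose_apply]
  rw [Finset.sum_comm]
  refine Finset.sum_eq_zero fun j _ => ?_
  rw [← map_zero (k j), ← this j, map_sum]
  simp

lemma IsRes.act_act' (H : IsRes b A e) (i : ℕ) (k : Fin (b (i + 1 + 1)) → L) :
    act (A i).transpose L (act (A (i + 1)).transpose L k) = 0 :=
  act_act_zero (H.ex i) L k

lemma Ses.ke_sub (h : Ses f g) (H : IsRes b A e) (hL : EZ R ω L 1) {i : ℕ} (hG : KE A e G i)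
    (hC : KE A e C (i + 1)) : KE A e L i := by
  have hs := h.hm hL
  match i with
  | 0 =>
    have := sub_exact (ev (R := R) e L) (0 : L →ₗ[R] PUnit.{u+1}) (act (A 0).transpose (ω →ₗ[R] G)) (ev (R := R) e G)
      (0 : G →ₗ[R] PUnit.{u+1}) (act (A 0).transpose (ω →ₗ[R] C)) (ev (R := R) e C)
      (pw (HH.hm ω f) _) f 0 (pw (HH.hm ω g) _) (pw (HH.hm ω g) _) g (ev_nat e f) (fun _ => rfl) (act_pw _ _)
      (ev_nat e g) h.inj (hs.pow _).exact h.comp_zero (hs.pow _).surj (fun _ => rfl) (H.ev_act)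
      (fun x _ => hG x) (fun x hx => (hC x).1 hx)
    intro x
    exact (this x).1 rfl
  | 1 =>
    exact sub_exact _ _ (act (A 1).transpose (ω →ₗ[R] G)) (act (A 0).transpose (ω →ₗ[R] G)) (ev (R := R) e G)
      (act (A 1).transpose (ω →ₗ[R] C)) (act (A 0).transpose (ω →ₗ[R] C))
      (pw (HH.hm ω f) _) (pw (HH.hm ω f) _) f (pw (HH.hm ω g) _) (pw (HH.hm ω g) _) (pw (HH.hm ω g) _)
      (act_pw _ _) (ev_nat e f) (act_pw _ _) (act_pw _ _)
      (hs.pow _).inj (hs.pow _).exact (hs.pow _).comp_zero (hs.pow _).surj H.ev_act (H.act_act' 0)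
      (fun x hx => (hG x).1 hx) (fun x hx => (hC x).1 hx)
  | i + 2 =>
    exact hs.act_sub (A (i + 1 + 1)).transpose (A (i + 1)).transpose (A i).transpose (H.act_act' (i + 1)) (H.act_act' i) hG hC

lemma Ses.ke_quot0 (h : Ses f g) (hG : KE A e G 0) : KE A e C 0 := by
  intro c
  obtain ⟨y, rfl⟩ := h.surj c
  obtain ⟨k, rfl⟩ := hG y
  exact ⟨_, (ev_nat e g k).symm⟩

lemma Ses.ke_quot (h : Ses f g) (H : IsRes b A e) (hL : EZ R ω L 1) {i : ℕ} (hG : KE A e G (i + 1))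
    (hLi : KE A e L i) : KE A e C (i + 1) := by
  have hs := h.hm hL
  match i with
  | 0 =>
    exact quot_exact (ev (R := R) e L) (act (A 0).transpose (ω →ₗ[R] G)) (ev (R := R) e G) _ _
      (pw (HH.hm ω f) _) f (pw (HH.hm ω g) _) (pw (HH.hm ω g) _) g
      (ev_nat e f) (act_pw _ _) (ev_nat e g) (hs.pow _).comp_zero h.exact (hs.pow _).surj H.ev_act
      (fun x hx => (hG x).1 hx) (fun u _ => hLi u)
  | 1 =>
    exact quot_exact (act (A 0).transpose (ω →ₗ[R] L)) (act (A 1).transpose (ω →ₗ[R] G))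
      (act (A 0).transpose (ω →ₗ[R] G)) _ _
      (pw (HH.hm ω f) _) (pw (HH.hm ω f) _) (pw (HH.hm ω g) _) (pw (HH.hm ω g) _) (pw (HH.hm ω g) _)
      (act_pw _ _) (act_pw _ _) (act_pw _ _) (hs.pow _).comp_zero (hs.pow _).exact (hs.pow _).surj
      (H.act_act' 0) (fun x hx => (hG x).1 hx) (fun u ⟨v, hv⟩ => (hLi u).1 (h.inj (by
        rw [ev_nat, ← hv, H.ev_act, map_zero])))
  | i + 2 =>
    exact quot_exact (act (A (i + 1)).transpose (ω →ₗ[R] L)) (act (A (i + 1 + 1)).transpose (ω →ₗ[R] G))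
      (act (A (i + 1)).transpose (ω →ₗ[R] G)) _ _
      (pw (HH.hm ω f) _) (pw (HH.hm ω f) _) (pw (HH.hm ω g) _) (pw (HH.hm ω g) _) (pw (HH.hm ω g) _)
      (act_pw _ _) (act_pw _ _) (act_pw _ _) (hs.pow _).comp_zero (hs.pow _).exact (hs.pow _).surj
      (H.act_act' (i + 1)) (fun x hx => (hG x).1 hx) (fun u ⟨v, hv⟩ => (hLi u).1 ((hs.pow _).inj (by
        rw [act_pw, ← hv, H.act_act', map_zero])))

lemma Dz.ke_inj (D : Dz A e) (X : Type u) [AddCommGroup X] [Module R X] [Module.Injective R X] (i : ℕ) :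
    KE A e X i := by
  match i with
  | 0 =>
    intro x
    obtain ⟨ψ, hψ⟩ := Module.Injective.out (LinearMap.toSpanSingleton R (Fin (b 0) → ω) e) (fun r s hrs => by
      refine sub_eq_zero.1 (D.faith _ fun j => ?_)
      have := congrFun hrs j
      simp only [LinearMap.toSpanSingleton_apply, Pi.smul_apply] at this
      rw [sub_smul, this, sub_self]) (LinearMap.toSpanSingleton R X x)
    obtain ⟨k, hk⟩ := exists_hom_vec ψ
    refine ⟨k, ?_⟩
    have := hψ 1
    simp only [LinearMap.toSpanSingleton_apply, one_smul] at this
    rw [ev_apply, ← this, hk]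
  | 1 =>
    intro k
    refine ⟨fun hk => ?_, ?_⟩
    · obtain ⟨ψ, hψ⟩ := inj_ext (LinearMap.toSpanSingleton R (Fin (b 0) → ω) e) (act (A 0) ω) (by
        intro v
        constructor
        · intro hv
          obtain ⟨r, hr⟩ := D.endo v hv
          exact ⟨r, by funext j; simp [hr]⟩
        · rintro ⟨r, rfl⟩
          simp [D.res.act_e]) (sumHom k) (by
        intro r
        rw [LinearMap.toSpanSingleton_apply, map_smul, sumHom_apply, ← ev_apply, hk, smul_zero])
      obtain ⟨m, hm⟩ := exists_hom_vec ψ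
      refine ⟨m, ?_⟩
      refine sumHom_injective fun v => ?_
      rw [← hψ, hm, ← sumHom_apply]
      exact (sumHom_act (A 0) m v).symm
    · rintro ⟨m, rfl⟩
      exact D.res.ev_act m
  | i + 2 => exact exact_hom _ _ ω X (D.ex i)

lemma TA.ke {X : ℤ → ModuleCat.{u} R} {d : ∀ n : ℤ, X n →ₗ[R] X (n + 1)} (T : TA X d)
    (D : Dz A e) (i : ℕ) : ∀ n, KE A e (LinearMap.ker (d n)) i := by
  induction i with
  | zero =>
    intro n
    obtain ⟨m, rfl⟩ : ∃ m, n = m + 1 := ⟨n - 1, by ring⟩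
    have := T.inj m
    exact (T.ses m).ke_quot0 (D.ke_inj _ 0)
  | succ i ih =>
    intro n
    obtain ⟨m, rfl⟩ : ∃ m, n = m + 1 := ⟨n - 1, by ring⟩
    have := T.inj m
    exact (T.ses m).ke_quot D.res (T.ez D.fc 0 m) (D.ke_inj _ _) (ih m)

lemma ke_congr (H : IsRes b A e) (E : L ≃ₗ[R] G) {i : ℕ} (hL : KE A e L i) : KE A e G i := by
  have h : Ses E.symm.toLinearMap (0 : L →ₗ[R] PUnit.{u+1}) := ses_equiv E.symm
  match i with
  | 0 =>
    intro x
    obtain ⟨k, hk⟩ := hL (E.symm x)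
    refine ⟨pw (hm ω E.toLinearMap) _ k, ?_⟩
    rw [← ev_nat, hk]; simp
  | 1 =>
    intro x
    refine ⟨fun hx => ?_, ?_⟩
    · obtain ⟨k, hk⟩ := (hL (pw (hm ω E.symm.toLinearMap) _ x)).1 (by rw [← ev_nat, hx, map_zero])
      refine ⟨pw (hm ω E.toLinearMap) _ k, ?_⟩
      rw [← act_pw, hk]
      funext j; ext w; simp [hm]
    · rintro ⟨k, rfl⟩; exact H.ev_act k
  | i + 2 =>
    intro x
    refine ⟨fun hx => ?_, ?_⟩
    · obtain ⟨k, hk⟩ := (hL (pw (hm ω E.symm.toLinearMap) _ x)).1 (by rw [← act_pw, hx, map_zero])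
      refine ⟨pw (hm ω E.toLinearMap) _ k, ?_⟩
      rw [← act_pw, hk]
      funext j; ext w; simp [hm]
    · rintro ⟨k, rfl⟩; exact H.act_act' i k

lemma Dz.ke_gi (D : Dz A e) (hG : GG.IsGorensteinInjective R G) (i : ℕ) : KE A e G i := by
  obtain ⟨X, d, h1, h2, h3, ⟨E⟩⟩ := hG
  exact ke_congr D.res E.symm ((TA.mk h1 h2 h3).ke D i 0)

lemma Dz.ke_fc (D : Dz A e) (hL : FC R (GG.IsGorensteinInjective R) L) :
    (∀ i, EZ R ω L (i + 1)) → ∀ i, KE A e L i := by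
  induction hL with
  | of L h => exact fun _ => D.ke_gi h
  | step L G C f g h hG hC ih =>
    intro hE i
    exact h.ke_sub D.res (hE 0) (D.ke_gi hG i)
      (ih (fun j => h.ezY_quot (gi_ez D.fc hG j) (hE (j + 1))) (i + 1))

end KEsec

section Adir
variable {R : Type u} [CommRing R] [IsLocalRing R] {ω : Type u} [AddCommGroup ω] [Module R ω]
variable {b : ℕ → ℕ} {A : ∀ i, Matrix (Fin (b (i + 1))) (Fin (b i)) R} {e : Fin (b 0) → ω}

/-- a coordinate functional modulo the maximal ideal -/
lemma IsRes.exists_unit (H : IsRes b A e) [Nontrivial ω] : ∃ (a : Fin (b 0) → R) (j : Fin (b 0)), IsUnit (a j) ∧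
    ∀ k, ∑ l, a l * A 0 k l ∈ IsLocalRing.maximalIdeal R := by
  have : Module.Finite R ω := Module.Finite.of_surjective _ H.surj
  obtain ⟨N, hN⟩ := IsCoatomic.exists_coatom (Submodule R ω)
  have hs : IsSimpleModule R (ω ⧸ N) := isSimpleModule_iff_isCoatom.2 hN
  obtain ⟨I, hI, ⟨E⟩⟩ := isSimpleModule_iff_quot_maximal.1 hs
  obtain rfl := IsLocalRing.eq_maximalIdeal hI
  let lam : ω →ₗ[R] R ⧸ IsLocalRing.maximalIdeal R := E.toLinearMap.comp N.mkQ
  have hlam : Surjective lam := E.surjective.comp N.mkQ_surjective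
  choose a ha using fun l => Ideal.Quotient.mk_surjective (lam (e l))
  have h2 : ∃ j, IsUnit (a j) := by
    by_contra hcon
    push Not at hcon
    have h0 : lam = 0 := H.hom_ext fun j => by
      rw [← ha]
      exact Ideal.Quotient.eq_zero_iff_mem.2 (hcon j)
    obtain ⟨w, hw⟩ := hlam 1
    rw [h0] at hw
    exact one_ne_zero hw.symm
  obtain ⟨j, hj⟩ := h2
  refine ⟨a, j, hj, fun k => ?_⟩
  rw [← Ideal.Quotient.eq_zero_iff_mem]
  have := congrArg lam (congrFun H.act_e k)
  rw [act_apply, map_sum, Pi.zero_apply, map_zero] at this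
  rw [← this, map_sum]
  refine Finset.sum_congr rfl fun l _ => ?_
  rw [map_smul, ← ha, mul_comm]
  rfl

lemma Dz.nontrivial (D : Dz A e) : Nontrivial ω := by
  by_contra h
  rw [not_nontrivial_iff_subsingleton] at h
  exact one_ne_zero (D.faith 1 fun j => Subsingleton.elim _ _)

lemma smul_top_of_surj {E F : Type*} [AddCommGroup E] [Module R E] [AddCommGroup F] [Module R F]
    (δ : E →ₗ[R] F) (hδ : Surjective δ) (I : Ideal R) (h : (I • ⊤ : Submodule R E) = ⊤) :
    (I • ⊤ : Submodule R F) = ⊤ := by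
  have := Submodule.map_smul'' I ⊤ δ
  rw [h, Submodule.map_top, LinearMap.range_eq_top.2 hδ] at this
  exact this.symm

lemma Dz.smul_ext (D : Dz A e) {L : Type u} [AddCommGroup L] [Module R L] (hL : FC R (GG.IsGorensteinInjective R) L) :
    ∀ s, (∀ i, s < i → EZ R ω L (i + 1)) →
      (IsLocalRing.maximalIdeal R • ⊤ : Submodule R (Ext.{u} (ModuleCat.of R ω) (ModuleCat.of R L) (s + 1))) = ⊤ := by
  induction hL with
  | of L h =>
    intro s _
    have := ez_iff.1 (gi_ez D.fc h s)
    exact Subsingleton.elim _ _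
  | step L G C f g h hG hC ih =>
    intro s hs
    let δ := h.se.extClass.postcompOfLinear R (ModuleCat.of R ω) (a := s) (b := s + 1) rfl
    have hδ : Surjective δ := fun x => by
      obtain ⟨y, hy⟩ := Ext.covariant_sequence_exact₁ (ModuleCat.of R ω) h.se x (gi_ez D.fc hG s _) rfl
      exact ⟨y, hy⟩
    have hCz : ∀ i, s ≤ i → EZ R ω C (i + 1) := fun i hi =>
      h.ezY_quot (gi_ez D.fc hG i) (hs (i + 1) (by omega))
    cases s with
    | succ s => exact smul_top_of_surj δ hδ _ (ih s (fun i hi => hCz i hi))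
    | zero =>
      have hK := D.ke_fc hC (fun i => hCz i (Nat.zero_le _))
      have := D.nontrivial
      obtain ⟨a, j, hj, ham⟩ := D.res.exists_unit
      rw [eq_top_iff]
      intro x _
      obtain ⟨y, rfl⟩ := hδ x
      obtain ⟨φ, rfl⟩ := exists_lin y
      obtain ⟨y, hy⟩ := h.surj (φ (e j))
      obtain ⟨n, hn⟩ := D.ke_gi hG 0 y
      obtain ⟨m, hm'⟩ := (hK 1 (Pi.single j φ - pw (hm ω g) _ n)).1 (by
        rw [map_sub, ← ev_nat, hn, hy, ev_apply, sub_eq_zero, Finset.sum_eq_single j]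
        · simp
        · intro l _ hl; simp [hl]
        · simp)
      have key : a j • φ = g.comp (∑ l, a l • n l) + ∑ k, (∑ l, a l * A 0 k l) • m k := by
        have h1 : ∀ l, a l • (Pi.single j φ : Fin (b 0) → (ω →ₗ[R] C)) l = a l • g.comp (n l)
            + ∑ k, (a l * A 0 k l) • m k := by
          intro l
          have := congrFun hm' l
          rw [act_apply, Pi.sub_apply, eq_sub_iff_add_eq] at this
          rw [← this, smul_add, add_comm, Finset.smul_sum]
          simp only [smul_smul, Matrix.transpose_apply]
          rfl
        have h2 := Finset.sum_congr (rfl : (Finset.univ : Finset (Fin (b 0))) = _) (fun l _ => h1 l)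
        rw [Finset.sum_eq_single j, Finset.sum_add_distrib] at h2
        · rw [Pi.single_eq_same] at h2
          rw [h2, Finset.sum_comm]
          congr 1
          · ext w; simp
          · simp only [Finset.sum_smul]
        · intro l _ hl; simp [hl]
        · simp
      let M0 : (ω →ₗ[R] C) →ₗ[R] Ext.{u} (ModuleCat.of R ω) (ModuleCat.of R C) 0 :=
        (Ext.linearEquiv₀.trans ModuleCat.homLinearEquiv).symm.toLinearMap
      have hM0 : ∀ ψ, M0 ψ = Ext.mk₀ (ModuleCat.ofHom ψ) := fun ψ => rfl
      have hg0 : ∀ ψ : ω →ₗ[R] G, δ (M0 (g.comp ψ)) = 0 := by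
        intro ψ
        rw [hM0]
        have : Ext.mk₀.{u} (ModuleCat.ofHom (g.comp ψ)) = (Ext.mk₀ (ModuleCat.ofHom ψ)).comp
          (Ext.mk₀ (ModuleCat.ofHom g)) (add_zero 0) := by rw [Ext.mk₀_comp_mk₀]; rfl
        rw [this]
        show Ext.comp _ h.se.extClass rfl = 0
        rw [Ext.comp_assoc_of_second_deg_zero]
        have := h.se.comp_extClass
        erw [this]
        simp
      have key2 := congrArg (fun t => δ (M0 t)) key
      simp only [map_add, hg0, zero_add, map_sum, map_smul] at key2
      rw [← hM0]
      obtain ⟨c, hc⟩ := hj.exists_left_inv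
      have : δ (M0 φ) = c • (a j • δ (M0 φ)) := by rw [smul_smul, hc, one_smul]
      rw [this, key2]
      exact Submodule.smul_mem _ _ (Submodule.sum_mem _ fun k _ =>
        Submodule.smul_mem_smul (ham k) trivial)

lemma Adir [IsNoetherianRing R] (D : Dz A e) {M : Type u} [AddCommGroup M] [Module R M] [Module.Finite R M]
    (hM : FC R (GG.IsGorensteinInjective R) M) : (∀ i, EZ R ω M (i + 1)) ∧ KEx A e M := by
  have : Module.Finite R ω := Module.Finite.of_surjective _ D.res.surj
  obtain ⟨n, hn⟩ := FC.gi_ez D.fc hM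
  have key : ∀ t s, n ≤ s + t → EZ R ω M (s + 1) := by
    intro t
    induction t with
    | zero => exact fun s hs => hn _ (by omega)
    | succ t ih =>
      intro s hs
      have := D.smul_ext hM s (fun i hi => ih i (by omega))
      have h2 := Submodule.eq_bot_of_le_smul_of_le_jacobson_bot (IsLocalRing.maximalIdeal R)
        (⊤ : Submodule R (Ext.{u} (ModuleCat.of R ω) (ModuleCat.of R M) (s + 1)))
        Module.Finite.fg_top this.ge (IsLocalRing.maximalIdeal_le_jacobson _)
      intro x
      have hx : x ∈ (⊤ : Submodule R (Ext.{u} (ModuleCat.of R ω) (ModuleCat.of R M) (s + 1))) := trivial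
      rw [h2] at hx
      exact hx
  have hE : ∀ i, EZ R ω M (i + 1) := fun i => key n i (by omega)
  exact ⟨hE, kex_of_ke (D.ke_fc hM hE)⟩

end Adir
end HH

namespace HH
open Function

section T3
variable {R : Type u} [CommRing R] {x : R}
variable {C0 C1 C2 C3 D0 D1 D2 D3 : Type u}
  [AddCommGroup C0] [Module R C0] [AddCommGroup C1] [Module R C1] [AddCommGroup C2] [Module R C2]
  [AddCommGroup C3] [Module R C3]
  [AddCommGroup D0] [Module R D0] [AddCommGroup D1] [Module R D1] [AddCommGroup D2] [Module R D2]
  [AddCommGroup D3] [Module R D3]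

/-- regular or zero -/
def Rg (x : R) (C : Type u) [AddCommGroup C] [Module R C] : Prop :=
  (∀ c : C, x • c = 0 → c = 0) ∨ x = 0

/-- reduction modulo a regular element, or an isomorphism if `x = 0` -/
structure Md (x : R) (p : C1 →ₗ[R] D1) : Prop where
  surj : Surjective p
  px : ∀ c, p (x • c) = 0
  ker : ∀ c, p c = 0 → ∃ c', c = x • c'
  rg : Rg x C1

lemma Rg.pi (h : Rg x C1) (n : ℕ) : Rg x (Fin n → C1) := by
  rcases h with h | h
  · exact Or.inl fun c hc => funext fun j => h _ (congrFun hc j)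
  · exact Or.inr h

lemma Rg.sub (h : Rg x C1) (K : Submodule R C1) : Rg x K := by
  rcases h with h | h
  · exact Or.inl fun c hc => Subtype.ext (h _ (congrArg Subtype.val hc))
  · exact Or.inr h

lemma rg_punit : Rg x PUnit.{u+1} := Or.inl fun _ _ => rfl

lemma Md.pi {p : C1 →ₗ[R] D1} (m : Md x p) (n : ℕ) : Md x (pw p n) where
  surj v := by
    choose w hw using fun j => m.surj (v j)
    exact ⟨w, funext hw⟩
  px c := funext fun j => m.px _
  ker c hc := by
    choose w hw using fun j => m.ker _ (congrFun hc j)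
    exact ⟨w, funext hw⟩
  rg := m.rg.pi n

lemma md_punit : Md x (0 : PUnit.{u+1} →ₗ[R] PUnit.{u+1}) where
  surj _ := ⟨0, rfl⟩
  px _ := rfl
  ker _ _ := ⟨0, rfl⟩
  rg := rg_punit

/-- exactness modulo `x` -/
lemma T3d {f : C3 →ₗ[R] C2} {g : C2 →ₗ[R] C1} {h : C1 →ₗ[R] C0}
    {f' : D3 →ₗ[R] D2} {g' : D2 →ₗ[R] D1} {p3 : C3 →ₗ[R] D3} {p2 : C2 →ₗ[R] D2} {p1 : C1 →ₗ[R] D1}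
    (m3 : Surjective p3) (m2 : Md x p2) (m1 : Md x p1) (r0 : Rg x C0)
    (cf : ∀ v, p2 (f v) = f' (p3 v)) (cg : ∀ v, p1 (g v) = g' (p2 v))
    (hfg : Exact f g) (hgh : Exact g h) : Exact f' g' := by
  intro v
  constructor
  · intro hv
    obtain ⟨c, rfl⟩ := m2.surj v
    rw [← cg] at hv
    have key : ∃ c'', g c = x • g c'' := by
      obtain ⟨c', hc'⟩ := m1.ker _ hv
      rcases r0 with r0 | r0
      · obtain ⟨c'', hc''⟩ := (hgh c').1 (r0 _ (by
          rw [← map_smul, ← hc', (hgh _).2 ⟨c, rfl⟩]))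
        exact ⟨c'', by rw [hc'', hc']⟩
      · exact ⟨0, by rw [hc', r0, zero_smul, zero_smul]⟩
    obtain ⟨c'', hc''⟩ := key
    obtain ⟨w, hw⟩ := (hfg (c - x • c'')).1 (by rw [map_sub, map_smul, hc'', sub_self])
    exact ⟨p3 w, by rw [← cf, hw, map_sub, m2.px, sub_zero]⟩
  · rintro ⟨w, rfl⟩
    obtain ⟨w, rfl⟩ := m3 w
    rw [← cf, ← cg, (hfg _).2 ⟨w, rfl⟩, map_zero]

/-- exactness lifted along reduction modulo `x` -/
lemma T3u [IsLocalRing R] [IsNoetherianRing R] [Module.Finite R C2] (hx : x ∈ IsLocalRing.maximalIdeal R)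
    {f : C3 →ₗ[R] C2} {g : C2 →ₗ[R] C1}
    {f' : D3 →ₗ[R] D2} {g' : D2 →ₗ[R] D1} {p3 : C3 →ₗ[R] D3} {p2 : C2 →ₗ[R] D2} {p1 : C1 →ₗ[R] D1}
    (m3 : Surjective p3) (m2 : Md x p2) (r1 : Rg x C1)
    (cf : ∀ v, p2 (f v) = f' (p3 v)) (cg : ∀ v, p1 (g v) = g' (p2 v))
    (hgf : ∀ v, g (f v) = 0)
    (h' : Exact f' g') : Exact f g := by
  have key : LinearMap.ker g ≤ LinearMap.range f ⊔ IsLocalRing.maximalIdeal R • LinearMap.ker g := by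
    intro c hc
    obtain ⟨w, hw⟩ := (h' (p2 c)).1 (by rw [← cg, LinearMap.mem_ker.1 hc, map_zero])
    obtain ⟨w, rfl⟩ := m3 w
    obtain ⟨c'', hc''⟩ := m2.ker (c - f w) (by rw [map_sub, cf, hw, sub_self])
    have hg : g (x • c'') = 0 := by rw [← hc'', map_sub, hgf, LinearMap.mem_ker.1 hc, sub_zero]
    have : c = f w + x • c'' := by rw [← hc'']; abel
    rw [this]
    refine Submodule.add_mem_sup ⟨w, rfl⟩ ?_
    rcases r1 with r1 | r1
    · exact Submodule.smul_mem_smul hx (r1 _ (by rw [← map_smul, hg]))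
    · rw [r1, zero_smul]; exact Submodule.zero_mem _
  have hle := Submodule.le_of_le_smul_of_le_jacobson_bot (IsNoetherian.noetherian (LinearMap.ker g))
    (IsLocalRing.maximalIdeal_le_jacobson _) key
  intro c
  constructor
  · intro hc; exact hle hc
  · rintro ⟨w, rfl⟩; exact hgf w

end T3

section Q
variable {R : Type u} [CommRing R] {x : R}
variable {b : ℕ → ℕ} {A : ∀ i, Matrix (Fin (b (i + 1))) (Fin (b i)) R}
variable {B B' X X' Y Y' : Type u} [AddCommGroup B] [Module R B] [AddCommGroup B'] [Module R B']
  [AddCommGroup X] [Module R X] [AddCommGroup X'] [Module R X']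
  [AddCommGroup Y] [Module R Y] [AddCommGroup Y'] [Module R Y']

structure RQ (A : ∀ i, Matrix (Fin (b (i + 1))) (Fin (b i)) R) (c : (Fin (b 0) → B) →ₗ[R] X) : Prop where
  r0 : Surjective c
  r1 : Exact (act (A 0).transpose B) c
  r2 : ∀ i, Exact (act (A (i + 1)).transpose B) (act (A i).transpose B)

lemma exact_zero_of_surj {f : X →ₗ[R] Y} (h : Surjective f) : Exact f (0 : Y →ₗ[R] PUnit.{u+1}) :=
  fun v => ⟨fun _ => h v, fun _ => rfl⟩

lemma RQ.step {c : (Fin (b 0) → B) →ₗ[R] X} (H : RQ A c) {c' : (Fin (b 0) → B') →ₗ[R] X'}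
    {pB : B →ₗ[R] B'} {pX : X →ₗ[R] X'} (mB : Md x pB) (mX : Md x pX)
    (hc : ∀ v, pX (c v) = c' (pw pB _ v)) : RQ A c' where
  r0 y := by
    obtain ⟨y, rfl⟩ := mX.surj y
    obtain ⟨v, rfl⟩ := H.r0 y
    exact ⟨_, (hc v).symm⟩
  r1 := T3d (mB.pi _).surj (mB.pi _) mX rg_punit (act_pw _ _) hc H.r1 (exact_zero_of_surj H.r0)
  r2 i := by
    cases i with
    | zero => exact T3d (mB.pi _).surj (mB.pi _) (mB.pi _) mX.rg (act_pw _ _) (act_pw _ _) (H.r2 0) H.r1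
    | succ i => exact T3d (mB.pi _).surj (mB.pi _) (mB.pi _) (mB.rg.pi _) (act_pw _ _) (act_pw _ _) (H.r2 (i + 1)) (H.r2 i)

/-- coexactness -/
def CQ (A : ∀ i, Matrix (Fin (b (i + 1))) (Fin (b i)) R) (Y : Type u) [AddCommGroup Y] [Module R Y] : Prop :=
  ∀ i, Exact (act (A i) Y) (act (A (i + 1)) Y)

lemma CQ.step (H : CQ A Y) {p : Y →ₗ[R] Y'} (m : Md x p) : CQ A Y' := fun i =>
  T3d (m.pi _).surj (m.pi _) (m.pi _) (m.rg.pi _) (act_pw _ _) (act_pw _ _) (H i) (H (i + 1))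

/-- endomorphisms of the dualizing module -/
structure DQ (A0 : Matrix (Fin (b 1)) (Fin (b 0)) R) (δ : B →ₗ[R] (Fin (b 0) → Y)) : Prop where
  inj : Injective δ
  ex : Exact δ (act A0 Y)

lemma DQ.step {δ : B →ₗ[R] (Fin (b 0) → Y)} (H : DQ (A 0) δ) (hA : CQ A Y) {δ' : B' →ₗ[R] (Fin (b 0) → Y')}
    {pB : B →ₗ[R] B'} {p : Y →ₗ[R] Y'} (mB : Md x pB) (m : Md x p)
    (hc : ∀ v, pw p _ (δ v) = δ' (pB v)) : DQ (A 0) δ' where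
  inj := by
    have := T3d (f := (0 : PUnit.{u+1} →ₗ[R] B)) (f' := (0 : PUnit.{u+1} →ₗ[R] B')) (md_punit (x := x)).surj mB (m.pi _) (m.rg.pi _)
      (fun v => by simp) hc (fun v => by
        constructor
        · intro hv; exact ⟨0, by rw [map_zero]; exact (H.inj (by rw [hv, map_zero])).symm⟩
        · rintro ⟨w, rfl⟩; simp) H.ex
    rw [← LinearMap.ker_eq_bot, LinearMap.ker_eq_bot']
    intro v hv
    obtain ⟨w, rfl⟩ := (this v).1 hv
    rfl
  ex := T3d mB.surj (m.pi _) (m.pi _) (m.rg.pi _) hc (act_pw _ _) H.ex (hA 0)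

/-- the kernel model of `Hom(ω, Y)` -/
abbrev NK (A0 : Matrix (Fin (b 1)) (Fin (b 0)) R) (Y : Type u) [AddCommGroup Y] [Module R Y] :
  Submodule R (Fin (b 0) → Y) := LinearMap.ker (act A0 Y)

/-- evaluation on the kernel model -/
def evN (A0 : Matrix (Fin (b 1)) (Fin (b 0)) R) (Y : Type u) [AddCommGroup Y] [Module R Y] :
    (Fin (b 0) → NK A0 Y) →ₗ[R] Y where
  toFun k := ∑ j, (k j).1 j
  map_add' v w := by simp [Finset.sum_add_distrib]
  map_smul' r v := by simp [Finset.smul_sum]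

lemma evN_apply {A0 : Matrix (Fin (b 1)) (Fin (b 0)) R} (k : Fin (b 0) → NK A0 Y) :
    evN A0 Y k = ∑ j, (k j).1 j := rfl

/-- Bass class conditions -/
structure KQ (A : ∀ i, Matrix (Fin (b (i + 1))) (Fin (b i)) R) (Y : Type u) [AddCommGroup Y] [Module R Y] : Prop where
  k0 : Surjective (evN (A 0) Y)
  k1 : Exact (act (A 0).transpose (NK (A 0) Y)) (evN (A 0) Y)
  k2 : ∀ i, Exact (act (A (i + 1)).transpose (NK (A 0) Y)) (act (A i).transpose (NK (A 0) Y))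

/-- induced map on kernels -/
def NKmap (A0 : Matrix (Fin (b 1)) (Fin (b 0)) R) (p : Y →ₗ[R] Y') : NK A0 Y →ₗ[R] NK A0 Y' :=
  ((pw p (b 0)).comp (NK A0 Y).subtype).codRestrict _ (fun n => by
    rw [LinearMap.mem_ker, LinearMap.comp_apply, ← act_pw]
    have : act A0 Y ((NK A0 Y).subtype n) = 0 := n.2
    rw [this, map_zero])

lemma NKmap_md {p : Y →ₗ[R] Y'} (m : Md x p) (hA : CQ A Y) : Md x (NKmap (A 0) p) where
  surj n := by
    have ex := T3d (f := (NK (A 0) Y).subtype) (f' := (pw p (b 0)).comp (NK (A 0) Y).subtype) (p3 := LinearMap.id) (x := x)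
      surjective_id (m.pi _) (m.pi _) (m.rg.pi _) (fun v => rfl) (act_pw (A 0) p) (fun v => by simp) (hA 0)
    obtain ⟨w, hw⟩ := (ex n.1).1 n.2
    exact ⟨w, Subtype.ext hw⟩
  px n := Subtype.ext ((m.pi _).px n.1)
  ker n hn := by
    obtain ⟨c, hc⟩ := (m.pi _).ker n.1 (congrArg Subtype.val hn)
    have hc2 := n.2
    rw [LinearMap.mem_ker, hc, map_smul] at hc2
    rcases m.rg.pi _ with r | r
    · exact ⟨⟨c, r _ hc2⟩, Subtype.ext hc⟩
    · exact ⟨0, Subtype.ext (by rw [hc, r]; simp)⟩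
  rg := (m.rg.pi _).sub _

lemma evN_nat (A0 : Matrix (Fin (b 1)) (Fin (b 0)) R) (p : Y →ₗ[R] Y') (k : Fin (b 0) → NK A0 Y) :
    p (evN A0 Y k) = evN A0 Y' (pw (NKmap A0 p) _ k) := by
  simp [evN_apply, NKmap]

lemma KQ.step (H : KQ A Y) (hA : CQ A Y) {p : Y →ₗ[R] Y'} (m : Md x p) : KQ A Y' := by
  have mN := NKmap_md m hA
  have : RQ A (evN (A 0) Y') := RQ.step (⟨H.k0, H.k1, H.k2⟩ : RQ A (evN (A 0) Y)) mN m (evN_nat _ p)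
  exact ⟨this.r0, this.r1, this.r2⟩

lemma evN_act (A0 : Matrix (Fin (b 1)) (Fin (b 0)) R) (v : Fin (b 1) → NK A0 Y) :
    evN A0 Y (act A0.transpose _ v) = 0 := by
  have : ∀ j, ∑ l, A0 j l • (v j).1 l = 0 := fun j => by
    have := congrFun (v j).2 j
    rwa [act_apply] at this
  simp only [evN_apply, act_apply, Matrix.transpose_apply, Submodule.coe_sum, Finset.sum_apply, Submodule.coe_smul, Pi.smul_apply]
  rw [Finset.sum_comm]
  exact Finset.sum_eq_zero fun j _ => this j

lemma CQ.unstep [IsLocalRing R] [IsNoetherianRing R] [Module.Finite R Y]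
    (hx : x ∈ IsLocalRing.maximalIdeal R) {p : Y →ₗ[R] Y'} (m : Md x p)
    (hA : ∀ i (v : Fin (b i) → Y), act (A (i + 1)) Y (act (A i) Y v) = 0) (H : CQ A Y') : CQ A Y := fun i =>
  T3u hx (m.pi _).surj (m.pi _) (m.rg.pi _) (act_pw _ _) (act_pw _ p) (hA i) (H i)

lemma KQ.unstep [IsLocalRing R] [IsNoetherianRing R] [Module.Finite R Y]
    (hx : x ∈ IsLocalRing.maximalIdeal R) {p : Y →ₗ[R] Y'} (m : Md x p)
    (hA : ∀ i (v : Fin (b (i + 1 + 1)) → NK (A 0) Y), act (A i).transpose (NK (A 0) Y) (act (A (i + 1)).transpose (NK (A 0) Y) v) = 0)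
    (hC : CQ A Y) (H : KQ A Y') : KQ A Y := by
  have mN := NKmap_md m hC
  refine ⟨?_, ?_, fun i => ?_⟩
  · have := T3u (g := (0 : Y →ₗ[R] PUnit.{u+1})) (p1 := 0) hx (mN.pi _).surj m rg_punit (evN_nat (A 0) p) (fun _ => rfl) (fun _ => rfl)
      (exact_zero_of_surj H.k0)
    exact fun y => (this y).1 rfl
  · exact T3u hx (mN.pi _).surj (mN.pi _) m.rg (act_pw _ _) (evN_nat (A 0) p) (evN_act _) H.k1
  · exact T3u hx (mN.pi _).surj (mN.pi _) (mN.rg.pi _) (act_pw _ _) (act_pw _ _) (hA i) (H.k2 i)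

end Q
end HH

namespace HH
open Function

section RelInj
variable {R : Type u} [CommRing R]

/-- annihilated by `J` -/
def Kl (J : Ideal R) (K : Type u) [AddCommGroup K] [Module R K] : Prop := ∀ r ∈ J, ∀ k : K, r • k = 0

/-- injective relative to modules annihilated by `J` -/
structure RI (J : Ideal R) (K : Type u) [AddCommGroup K] [Module R K] : Prop where
  kl : Kl J K
  ext : ∀ (X Y : Type u) [AddCommGroup X] [Module R X] [AddCommGroup Y] [Module R Y]
    (_ : Kl J X) (_ : Kl J Y) (f : X →ₗ[R] Y) (_ : Injective f) (φ : X →ₗ[R] K),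
    ∃ ψ : Y →ₗ[R] K, ∀ v, ψ (f v) = φ v

variable {J : Ideal R} {x : R}
variable {L G C K D : Type u} [AddCommGroup L] [Module R L] [AddCommGroup G] [Module R G]
    [AddCommGroup C] [Module R C] [AddCommGroup K] [Module R K] [AddCommGroup D] [Module R D]

lemma Kl.of_inj (h : Kl J G) {f : L →ₗ[R] G} (hf : Injective f) : Kl J L := fun r hr k =>
  hf (by rw [map_smul, h r hr, map_zero])

lemma Kl.of_surj (h : Kl J G) {f : G →ₗ[R] C} (hf : Surjective f) : Kl J C := fun r hr k => by
  obtain ⟨y, rfl⟩ := hf k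
  rw [← map_smul, h r hr, map_zero]

lemma RI.congr (N N' : Type u) [AddCommGroup N] [Module R N] [AddCommGroup N'] [Module R N']
    (e : N ≃ₗ[R] N') (h : RI J N) : RI J N' := by
  refine ⟨h.kl.of_surj e.surjective, fun X Y _ _ _ _ hX hY f hf φ => ?_⟩
  obtain ⟨ψ, hψ⟩ := h.ext X Y hX hY f hf (e.symm.toLinearMap.comp φ)
  exact ⟨e.toLinearMap.comp ψ, fun v => by simp [hψ]⟩

lemma RI.retract (h : RI J G) (s : K →ₗ[R] G) (r : G →ₗ[R] K) (hrs : ∀ k, r (s k) = k) : RI J K := by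
  refine ⟨h.kl.of_surj (fun k => ⟨s k, hrs k⟩), fun X Y _ _ _ _ hX hY f hf φ => ?_⟩
  obtain ⟨ψ, hψ⟩ := h.ext X Y hX hY f hf (s.comp φ)
  exact ⟨r.comp ψ, fun v => by simp [hψ, hrs]⟩

lemma RI.punit : RI J PUnit.{u+1} := ⟨fun _ _ _ => rfl, fun _ _ _ _ _ _ _ _ _ _ _ => ⟨0, fun _ => rfl⟩⟩

lemma FC.kl (h : FC R (RI J) L) : Kl J L := by
  cases h with
  | of _ h => exact h.kl
  | step _ G C f g hs hG hC => exact hG.kl.of_inj hs.inj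

lemma RI.of_inj [Module.Injective R G] (hk : Kl J G) : RI J G :=
  ⟨hk, fun _ _ _ _ _ _ _ _ f hf φ => Module.Injective.out f hf φ⟩

/-- splitting a sub which is relatively injective -/
lemma RI.split {ι : K →ₗ[R] G} {π : G →ₗ[R] C} (h : Ses ι π) (hK : RI J K) (hG : Kl J G) :
    ∃ s : C →ₗ[R] G, (∀ c, π (s c) = c) ∧ ∀ y, ∃ k, y = s (π y) + ι k := by
  obtain ⟨r, hr⟩ := hK.ext K G hK.kl hG ι h.inj LinearMap.id
  have hk : ∀ y, π y = 0 → (LinearMap.id - ι.comp r : G →ₗ[R] G) y = 0 := by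
    intro y hy
    obtain ⟨k, rfl⟩ := (h.exact y).1 hy
    simp [hr]
  let e := (LinearMap.quotKerEquivOfSurjective π h.surj).symm
  let s : C →ₗ[R] G := ((LinearMap.ker π).liftQ (LinearMap.id - ι.comp r) hk).comp e.toLinearMap
  have hs : ∀ y, s (π y) = y - ι (r y) := by
    intro y
    have : e (π y) = Submodule.Quotient.mk y := by
      rw [LinearEquiv.symm_apply_eq]; rfl
    show ((LinearMap.ker π).liftQ (LinearMap.id - ι.comp r) hk) (e (π y)) = _
    rw [this]; rfl
  refine ⟨s, fun c => ?_, fun y => ⟨r y, by rw [hs]; abel⟩⟩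
  obtain ⟨y, rfl⟩ := h.surj c
  rw [hs, map_sub, h.comp_zero, sub_zero]

lemma FC.quot {ι : K →ₗ[R] D} {π : D →ₗ[R] C} (h : Ses ι π) (hK : RI J K) (hD : FC R (RI J) D) :
    FC R (RI J) C := by
  obtain ⟨s, hs, hs'⟩ := RI.split h hK hD.kl
  cases hD with
  | of _ hD => exact FC.of _ (hD.retract s π hs)
  | step _ G C' f g h' hG hC' =>
    have hfi : Injective (f.comp ι) := h'.inj.comp h.inj
    have sq := ses_quot_range hfi
    obtain ⟨t, ht, ht'⟩ := RI.split sq hK hG.kl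
    have hle : LinearMap.range (f.comp ι) ≤ LinearMap.ker g := by
      rintro _ ⟨k, rfl⟩; exact h'.comp_zero _
    refine FC.step C (G ⧸ LinearMap.range (f.comp ι)) C' ((LinearMap.range (f.comp ι)).mkQ.comp (f.comp s))
      ((LinearMap.range (f.comp ι)).liftQ g hle) ⟨?_, ?_, ?_⟩ (hG.retract t _ ht) hC'
    · rw [← LinearMap.ker_eq_bot, LinearMap.ker_eq_bot']
      intro c hc
      obtain ⟨k, hk⟩ := (sq.exact _).1 hc
      have : s c = ι k := h'.inj hk.symm
      rw [← hs c, this, h.comp_zero]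
    · intro y
      obtain ⟨y, rfl⟩ := sq.surj y
      rw [Submodule.mkQ_apply, Submodule.liftQ_apply]
      constructor
      · intro hy
        obtain ⟨d, rfl⟩ := (h'.exact y).1 hy
        obtain ⟨k, hk⟩ := hs' d
        refine ⟨π d, ?_⟩
        rw [LinearMap.comp_apply, Submodule.mkQ_apply, Submodule.Quotient.eq]
        refine ⟨-k, ?_⟩
        have h3 : f d = f (s (π d)) + f (ι k) := by rw [← map_add, ← hk]
        rw [h3, map_neg, LinearMap.comp_apply, LinearMap.comp_apply]
        abel
      · rintro ⟨c, hc⟩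
        rw [LinearMap.comp_apply, Submodule.mkQ_apply, Submodule.Quotient.eq] at hc
        have := hle hc
        rw [LinearMap.mem_ker, map_sub, LinearMap.comp_apply, h'.comp_zero, zero_sub, neg_eq_zero] at this
        exact this
    · intro c
      obtain ⟨y, rfl⟩ := h'.surj c
      exact ⟨Submodule.Quotient.mk y, by simp⟩

/-- divisibility -/
def Dv (x : R) (K : Type u) [AddCommGroup K] [Module R K] : Prop := ∀ k : K, ∃ k', x • k' = k

lemma Dv.of_surj (h : Dv x G) {f : G →ₗ[R] C} (hf : Surjective f) : Dv x C := fun c => by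
  obtain ⟨y, rfl⟩ := hf c
  obtain ⟨z, rfl⟩ := h y
  exact ⟨f z, by simp⟩

lemma RI.dv (h : RI J K) (hx : ∀ c : R ⧸ J, x • c = 0 → c = 0) : Dv x K := by
  intro k
  have hk : J ≤ LinearMap.ker (LinearMap.toSpanSingleton R K k) := fun r hr => h.kl r hr k
  have hq : Kl J (R ⧸ J) := fun r hr c => by
    obtain ⟨c, rfl⟩ := Submodule.mkQ_surjective J c
    rw [← map_smul, Submodule.mkQ_apply, Submodule.Quotient.mk_eq_zero]
    exact J.mul_mem_right _ hr
  obtain ⟨ψ, hψ⟩ := h.ext (R ⧸ J) (R ⧸ J) hq hq (LinearMap.lsmul R (R ⧸ J) x) (by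
    rw [← LinearMap.ker_eq_bot, LinearMap.ker_eq_bot']; exact hx)
    (Submodule.liftQ J (LinearMap.toSpanSingleton R K k) hk)
  refine ⟨ψ (Submodule.Quotient.mk 1), ?_⟩
  rw [← map_smul]
  refine (hψ (Submodule.Quotient.mk 1)).trans ?_
  rw [Submodule.liftQ_apply, LinearMap.toSpanSingleton_apply, one_smul]

/-- `x`-torsion -/
abbrev Tx (x : R) (K : Type u) [AddCommGroup K] [Module R K] : Submodule R K := LinearMap.ker (LinearMap.lsmul R K x)

lemma mem_Tx {k : K} : k ∈ Tx x K ↔ x • k = 0 := Iff.rfl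

lemma kl_sup (h : Kl J K) (hx : ∀ k : K, x • k = 0) : Kl (J ⊔ Ideal.span {x}) K := by
  intro r hr k
  obtain ⟨a, ha, b, hb, rfl⟩ := Submodule.mem_sup.1 hr
  obtain ⟨c, rfl⟩ := Ideal.mem_span_singleton'.1 hb
  rw [add_smul, h a ha, mul_smul, hx, smul_zero, add_zero]

lemma RI.tx (h : RI J K) : RI (J ⊔ Ideal.span {x}) (Tx x K) := by
  refine ⟨kl_sup (h.kl.of_inj (f := (Tx x K).subtype) Subtype.val_injective) (fun k => Subtype.ext k.2), ?_⟩
  intro X Y _ _ _ _ hX hY f hf φ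
  have hxJ : x ∈ J ⊔ Ideal.span {x} := Ideal.mem_sup_right (Ideal.mem_span_singleton_self x)
  obtain ⟨ψ, hψ⟩ := h.ext X Y (fun r hr => hX r (Ideal.mem_sup_left hr)) (fun r hr => hY r (Ideal.mem_sup_left hr))
    f hf ((Tx x K).subtype.comp φ)
  exact ⟨ψ.codRestrict _ (fun y => by rw [mem_Tx, ← map_smul, hY x hxJ, map_zero]), fun v => Subtype.ext (hψ v)⟩

/-- induced map on torsion -/
def txmap (x : R) (f : L →ₗ[R] G) : Tx x L →ₗ[R] Tx x G :=
  (f.comp (Tx x L).subtype).codRestrict _ (fun y => by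
    show x • f y.1 = 0
    have h0 : x • y.1 = 0 := mem_Tx.1 y.2
    rw [← map_smul, h0, map_zero])

lemma Ses.tx {f : L →ₗ[R] G} {g : G →ₗ[R] C} (h : Ses f g) (hL : Dv x L) : Ses (txmap x f) (txmap x g) where
  inj u v huv := Subtype.ext (h.inj (congrArg Subtype.val huv))
  exact v := by
    constructor
    · intro hv
      obtain ⟨u, hu⟩ := (h.exact v.1).1 (congrArg Subtype.val hv)
      exact ⟨⟨u, h.inj (by rw [LinearMap.lsmul_apply, map_smul, hu, map_zero]; exact v.2)⟩, Subtype.ext hu⟩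
    · rintro ⟨u, rfl⟩; exact Subtype.ext (h.comp_zero _)
  surj c := by
    obtain ⟨y, hy⟩ := h.surj c.1
    obtain ⟨l, hl⟩ := (h.exact (x • y)).1 (by rw [map_smul, hy]; exact c.2)
    obtain ⟨l', rfl⟩ := hL l
    refine ⟨⟨y - f l', ?_⟩, Subtype.ext ?_⟩
    · rw [mem_Tx, smul_sub, ← hl, map_smul, sub_self]
    · show g (y - f l') = c.1
      rw [map_sub, h.comp_zero, sub_zero, hy]

lemma FC.tx (hx : ∀ c : R ⧸ J, x • c = 0 → c = 0) (hC : FC R (RI J) C) :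
    Dv x C → FC R (RI (J ⊔ Ideal.span {x})) (Tx x C) := by
  induction hC with
  | of C h => exact fun _ => FC.of _ h.tx
  | step L G C f g h hG hC ih =>
    intro hL
    exact FC.step _ _ _ _ _ (h.tx hL) hG.tx (ih ((hG.dv hx).of_surj h.surj))

/-- finite relative injective dimension modulo a regular element -/
lemma FC.mod (hx : ∀ c : R ⧸ J, x • c = 0 → c = 0) (hL : FC R (RI J) L) (hxL : ∀ c : L, x • c = 0 → c = 0)
    {p : L →ₗ[R] K} (m : Md x p) (hx0 : ∀ l, p l = 0 → ∃ l', l = x • l') : FC R (RI (J ⊔ Ideal.span {x})) K := by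
  cases hL with
  | of _ h =>
    refine FC.of _ (RI.congr PUnit.{u+1} K ⟨0, 0, fun x => Subsingleton.elim _ _, fun k => ?_⟩ RI.punit)
    obtain ⟨l, rfl⟩ := m.surj k
    obtain ⟨l', rfl⟩ := h.dv hx l
    rw [m.px]; rfl
  | step _ G C f g h hG hC =>
    have hGd := hG.dv hx
    have hCd := hGd.of_surj h.surj
    -- the connecting map `C[x] → L/x`
    have hcon : ∀ c : Tx x C, ∃ y l, g y = c.1 ∧ x • y = f l := fun c => by
      obtain ⟨y, hy⟩ := h.surj c.1
      obtain ⟨l, hl⟩ := (h.exact (x • y)).1 (by rw [map_smul, hy]; exact c.2)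
      exact ⟨y, l, hy, hl.symm⟩
    have huniq : ∀ y l y' l', g y = g y' → x • y = f l → x • y' = f l' → p l = p l' := by
      intro y l y' l' hy h1 h2
      obtain ⟨t, ht⟩ := (h.exact (y - y')).1 (by rw [map_sub, hy, sub_self])
      have : l - l' = x • t := h.inj (by rw [map_sub, ← h1, ← h2, map_smul, ht, smul_sub])
      rw [← sub_eq_zero, ← map_sub, this, m.px]
    choose y l hy hl using hcon
    let δ : Tx x C →ₗ[R] K :=
      { toFun c := p (l c)
        map_add' a b := by
          rw [← map_add]
          exact huniq (y (a + b)) _ (y a + y b) _ (by simp [hy]) (hl _) (by rw [smul_add, hl, hl, map_add])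
        map_smul' r a := by
          rw [← map_smul]
          exact huniq (y (r • a)) _ (r • y a) _ (by simp [hy]) (hl _) (by rw [smul_comm, hl, map_smul]; rfl) }
    have hδ : ∀ (c : Tx x C) y' l', g y' = c.1 → x • y' = f l' → δ c = p l' := fun c y' l' h1 h2 =>
      huniq _ _ _ _ (by rw [hy, h1]) (hl c) h2
    have sδ : Ses (txmap x g) δ := by
      refine ⟨?_, fun c => ?_, fun k => ?_⟩
      · rw [← LinearMap.ker_eq_bot, LinearMap.ker_eq_bot']
        intro a ha
        obtain ⟨t, ht⟩ := (h.exact a.1).1 (congrArg Subtype.val ha)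
        have : t = 0 := hxL t (h.inj (by rw [map_smul, ht, map_zero]; exact a.2))
        refine Subtype.ext ?_
        rw [← ht, this, map_zero]; rfl
      · constructor
        · intro hc
          obtain ⟨t, ht⟩ := hx0 (l c) hc
          refine ⟨⟨y c - f t, ?_⟩, Subtype.ext ?_⟩
          · rw [mem_Tx, smul_sub, hl, ht, map_smul, sub_self]
          · show g (y c - f t) = c.1
            rw [map_sub, h.comp_zero, sub_zero, hy]
        · rintro ⟨a, rfl⟩
          rw [hδ _ a.1 0 rfl (by rw [map_zero]; exact a.2), map_zero]
      · obtain ⟨l', rfl⟩ := m.surj k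
        obtain ⟨y', hy'⟩ := hGd (f l')
        exact ⟨⟨g y', by rw [mem_Tx, ← map_smul, hy', h.comp_zero]⟩, hδ _ y' l' rfl hy'⟩
    exact FC.quot sδ hG.tx (FC.tx hx hC hCd)

lemma FC.mono {P P' : ∀ (N : Type u) [AddCommGroup N] [Module R N], Prop}
    (hP : ∀ (N : Type u) [AddCommGroup N] [Module R N], P N → P' N) (h : FC R P L) : FC R P' L := by
  induction h with
  | of L h => exact FC.of _ (hP _ h)
  | step L G C f g h hG hC ih => exact FC.step _ _ _ f g h (hP _ hG) ih

lemma FC.ri_bot (h : FC R (Inj R) L) : FC R (RI (⊥ : Ideal R)) L :=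
  h.mono fun N _ _ hN => by
    have : Module.Injective R N := hN
    exact RI.of_inj (fun r hr k => by rw [Ideal.mem_bot.1 hr, zero_smul])

end RelInj

section Conv
variable {R S : Type u} [CommRing R] [CommRing S] [Algebra R S]

/-- the module structure over a quotient -/
lemma exists_mod (hs : Surjective (algebraMap R S)) (G : Type u) [AddCommGroup G] [Module R G]
    (hG : Kl (RingHom.ker (algebraMap R S)) G) : ∃ _ : Module S G, IsScalarTower R S G := by
  let σ := surjInv hs
  have hσ : ∀ s, algebraMap R S (σ s) = s := surjInv_eq hs
  have key : ∀ r r', algebraMap R S r = algebraMap R S r' → ∀ g : G, r • g = r' • g := by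
    intro r r' h g
    rw [← sub_eq_zero, ← sub_smul]
    exact hG _ (by rw [RingHom.mem_ker, map_sub, h, sub_self]) g
  let inst : Module S G :=
    { smul s g := σ s • g
      one_smul g := (key _ 1 (by rw [hσ, map_one]) g).trans (one_smul R g)
      mul_smul s t g := (key _ (σ s * σ t) (by simp [hσ]) g).trans (mul_smul _ _ _)
      smul_zero s := smul_zero (σ s)
      smul_add s g h := smul_add (σ s) g h
      add_smul s t g := (key _ (σ s + σ t) (by simp [hσ]) g).trans (add_smul _ _ _)
      zero_smul g := (key _ 0 (by simp [hσ]) g).trans (zero_smul _ _) }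
  refine ⟨inst, ⟨fun r s g => ?_⟩⟩
  show σ (r • s) • g = r • (σ s • g)
  rw [← mul_smul]
  exact key _ _ (by simp [hσ, Algebra.smul_def]) g

lemma RI.toInj (hs : Surjective (algebraMap R S)) (G : Type u) [AddCommGroup G] [Module R G]
    [Module S G] [IsScalarTower R S G] (h : RI (RingHom.ker (algebraMap R S)) G) : Module.Injective S G where
  out X Y _ _ _ _ f hf φ := by
    let _ : Module R X := Module.compHom X (algebraMap R S)
    let _ : Module R Y := Module.compHom Y (algebraMap R S)
    have : IsScalarTower R S X := ⟨fun r s x => by rw [Algebra.smul_def, mul_smul]; rfl⟩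
    have : IsScalarTower R S Y := ⟨fun r s x => by rw [Algebra.smul_def, mul_smul]; rfl⟩
    have hX : Kl (RingHom.ker (algebraMap R S)) X := fun r hr x => by
      show algebraMap R S r • x = 0
      rw [RingHom.mem_ker.1 hr, zero_smul]
    have hY : Kl (RingHom.ker (algebraMap R S)) Y := fun r hr x => by
      show algebraMap R S r • x = 0
      rw [RingHom.mem_ker.1 hr, zero_smul]
    obtain ⟨ψ, hψ⟩ := h.ext X Y hX hY (f.restrictScalars R) hf (φ.restrictScalars R)
    exact ⟨ψ.extendScalarsOfSurjective hs, hψ⟩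

lemma FC.conv (hs : Surjective (algebraMap R S)) {L : Type u} [AddCommGroup L] [Module R L]
    (h : FC R (RI (RingHom.ker (algebraMap R S))) L) : ∀ [Module S L] [IsScalarTower R S L], FC S (Inj S) L := by
  induction h with
  | of L h => exact fun {_ _} => FC.of _ (RI.toInj hs L h)
  | step L G C f g h hG hC ih =>
    intro _ _
    obtain ⟨i1, i2⟩ := exists_mod hs G hG.kl
    obtain ⟨i3, i4⟩ := exists_mod hs C hC.kl
    exact FC.step L G C (f.extendScalarsOfSurjective hs) (g.extendScalarsOfSurjective hs)
      ⟨h.inj, h.exact, h.surj⟩ (RI.toInj hs G hG) ih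

end Conv
end HH

namespace HH
open Function

section Fac
variable {R : Type u} [CommRing R] {x : R} {J : Ideal R}
variable {X : Type u} [AddCommGroup X] [Module R X]

lemma md_factor {p q : Submodule R X} (h : p ≤ q) (h1 : ∀ y, x • y ∈ q) (h2 : ∀ y ∈ q, ∃ z, y - x • z ∈ p)
    (hx : Rg x (X ⧸ p)) : Md x (Submodule.factor h) where
  surj y := by
    obtain ⟨y, rfl⟩ := q.mkQ_surjective y
    exact ⟨p.mkQ y, Submodule.factor_mk h y⟩
  px y := by
    obtain ⟨y, rfl⟩ := p.mkQ_surjective y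
    rw [← map_smul, Submodule.factor_mk, Submodule.mkQ_apply, Submodule.Quotient.mk_eq_zero]
    exact h1 y
  ker y hy := by
    obtain ⟨y, rfl⟩ := p.mkQ_surjective y
    rw [Submodule.factor_mk, Submodule.mkQ_apply, Submodule.Quotient.mk_eq_zero] at hy
    obtain ⟨z, hz⟩ := h2 y hy
    refine ⟨p.mkQ z, ?_⟩
    rw [← map_smul, ← sub_eq_zero, ← map_sub, Submodule.mkQ_apply, Submodule.Quotient.mk_eq_zero]
    exact hz
  rg := hx

lemma mem_sup_smul {y : X} (hy : y ∈ (J ⊔ Ideal.span {x}) • (⊤ : Submodule R X)) :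
    ∃ z, y - x • z ∈ J • (⊤ : Submodule R X) := by
  rw [Submodule.sup_smul, Submodule.mem_sup] at hy
  obtain ⟨a, ha, c, hc, rfl⟩ := hy
  rw [Submodule.ideal_span_singleton_smul] at hc
  obtain ⟨z, -, rfl⟩ := hc
  exact ⟨z, by simpa using ha⟩

lemma smul_mem_sup (y : X) : x • y ∈ (J ⊔ Ideal.span {x}) • (⊤ : Submodule R X) :=
  Submodule.smul_mem_smul (Ideal.mem_sup_right (Ideal.mem_span_singleton_self x)) Submodule.mem_top

lemma le_sup_smul : J • (⊤ : Submodule R X) ≤ (J ⊔ Ideal.span {x}) • (⊤ : Submodule R X) :=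
  Submodule.smul_mono_left le_sup_left

lemma md_mod (hx : ∀ c : X ⧸ (J • (⊤ : Submodule R X)), x • c = 0 → c = 0) :
    Md x (Submodule.factor (le_sup_smul (J := J) (x := x) (X := X))) :=
  md_factor _ smul_mem_sup (fun _ => mem_sup_smul) (Or.inl hx)

lemma md_ring (hx : ∀ c : R ⧸ J, x • c = 0 → c = 0) :
    Md x (Submodule.factor (le_sup_left : J ≤ J ⊔ Ideal.span {x})) := by
  refine md_factor _ (fun y => ?_) (fun y hy => ?_) (Or.inl hx)
  · exact Ideal.mul_mem_right _ _ (Ideal.mem_sup_right (Ideal.mem_span_singleton_self x))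
  · obtain ⟨a, ha, c, hc, rfl⟩ := Submodule.mem_sup.1 hy
    obtain ⟨z, rfl⟩ := Ideal.mem_span_singleton'.1 hc
    exact ⟨z, by simpa [mul_comm] using ha⟩

lemma md_bot (p : Submodule R X) (hp : p = ⊥) : Md (0 : R) p.mkQ where
  surj := p.mkQ_surjective
  px y := by simp
  ker y hy := by
    subst hp
    rw [Submodule.mkQ_apply, Submodule.Quotient.mk_eq_zero, Submodule.mem_bot] at hy
    exact ⟨0, by simp [hy]⟩
  rg := Or.inr rfl

/-- combination at level `J` -/
def cmb (J : Ideal R) {n : ℕ} (e : Fin n → X) : (Fin n → R ⧸ J) →ₗ[R] X ⧸ (J • (⊤ : Submodule R X)) where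
  toFun v := ∑ j, v j • (J • (⊤ : Submodule R X)).mkQ (e j)
  map_add' v w := by simp [add_smul, Finset.sum_add_distrib]
  map_smul' r v := by simp [Finset.smul_sum, smul_assoc]

/-- diagonal at level `J` -/
def dg (J : Ideal R) {n : ℕ} (e : Fin n → X) : (R ⧸ J) →ₗ[R] (Fin n → X ⧸ (J • (⊤ : Submodule R X))) where
  toFun c j := c • (J • (⊤ : Submodule R X)).mkQ (e j)
  map_add' v w := by funext j; simp [add_smul]
  map_smul' r v := by funext j; simp [smul_assoc]

lemma factor_smul (c : R ⧸ J) (y : X) :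
    Submodule.factor (le_sup_smul (J := J) (x := x) (X := X)) (c • (J • (⊤ : Submodule R X)).mkQ y) =
    (Submodule.factor (le_sup_left : J ≤ J ⊔ Ideal.span {x}) c) • ((J ⊔ Ideal.span {x}) • (⊤ : Submodule R X)).mkQ y := by
  obtain ⟨c, rfl⟩ := J.mkQ_surjective c
  rw [Submodule.factor_mk]
  show Submodule.factor _ ((J • (⊤ : Submodule R X)).mkQ (c • y)) = ((J ⊔ Ideal.span {x}) • (⊤ : Submodule R X)).mkQ (c • y)
  rw [Submodule.factor_mk]

lemma omega_reg [IsNoetherianRing R] [Module.Finite R X]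
    (h : ∀ φ : X →ₗ[R] X, (∀ y, x • φ y = 0) → φ = 0) : ∀ c : X, x • c = 0 → c = 0 := by
  have hs : Subsingleton (QuotSMulTop x X →ₗ[R] X) := by
    refine subsingleton_of_forall_eq 0 fun φ => ?_
    have h0 := h (φ.comp (Submodule.mkQ _)) (fun y => by
      rw [← map_smul, LinearMap.comp_apply, Submodule.mkQ_apply,
        (Submodule.Quotient.mk_eq_zero _).2 (Submodule.smul_mem_pointwise_smul y x ⊤ trivial), map_zero])
    refine LinearMap.ext fun y => ?_
    obtain ⟨y, rfl⟩ := Submodule.mkQ_surjective _ y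
    exact LinearMap.congr_fun h0 y
  obtain ⟨r, hr, hreg⟩ := IsSMulRegular.subsingleton_linearMap_iff.1 hs
  by_contra hx
  have hx' : ¬ IsSMulRegular X x := fun hh => hx (isSMulRegular_iff_right_eq_zero_of_smul.1 hh)
  have hmem : x ∈ ({r | IsSMulRegular X r}ᶜ : Set R) := hx'
  rw [← biUnion_associatedPrimes_eq_compl_regular R X] at hmem
  simp only [Set.mem_iUnion] at hmem
  obtain ⟨p, hp, hxp⟩ := hmem
  have hpp : p.IsPrime := hp.1
  have hsp : (⟨p, hpp⟩ : PrimeSpectrum R) ∈ Module.support R X :=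
    Module.mem_support_iff_of_finite.2 (Submodule.annihilator_top (R := R) (M := X) ▸ hp.annihilator_le)
  have : (⟨p, hpp⟩ : PrimeSpectrum R) ∈ Module.support R (QuotSMulTop x X) := by
    rw [Module.support_quotSMulTop]
    exact ⟨hsp, by simpa using hxp⟩
  have hrp : r ∈ p := Module.mem_support_iff_of_finite.1 this hr
  have : r ∈ ⋃ p ∈ associatedPrimes R X, (p : Set R) := Set.mem_biUnion hp hrp
  rw [biUnion_associatedPrimes_eq_compl_regular] at this
  exact this hreg

end Fac

section Lev
variable {R : Type u} [CommRing R]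
variable {b : ℕ → ℕ} {A : ∀ i, Matrix (Fin (b (i + 1))) (Fin (b i)) R}
variable {c : ℕ → ℕ} {Γ : ∀ i, Matrix (Fin (c (i + 1))) (Fin (c i)) R}
variable {ω M : Type u} [AddCommGroup ω] [Module R ω] [AddCommGroup M] [Module R M]
variable {e : Fin (b 0) → ω} {g : Fin (c 0) → M}

/-- everything known at level `J` -/
structure Lev (A : ∀ i, Matrix (Fin (b (i + 1))) (Fin (b i)) R) (Γ : ∀ i, Matrix (Fin (c (i + 1))) (Fin (c i)) R)
    (e : Fin (b 0) → ω) (g : Fin (c 0) → M) (J : Ideal R) : Prop where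
  rq : RQ A (cmb J e)
  cq : CQ A (ω ⧸ (J • (⊤ : Submodule R ω)))
  dq : DQ (A 0) (dg J e)
  fc : FC R (RI J) (ω ⧸ (J • (⊤ : Submodule R ω)))
  rqM : RQ Γ (cmb J g)
  cqM : CQ Γ (ω ⧸ (J • (⊤ : Submodule R ω)))
  iff : (CQ A M ∧ KQ A M) ↔ CQ A (M ⧸ (J • (⊤ : Submodule R M))) ∧ KQ A (M ⧸ (J • (⊤ : Submodule R M)))

lemma CQ.both [IsLocalRing R] [IsNoetherianRing R] {Y Y' : Type u} [AddCommGroup Y] [Module R Y] [AddCommGroup Y'] [Module R Y']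
    [Module.Finite R Y] {x : R} (H : IsRes b A e)
    (hx : x ∈ IsLocalRing.maximalIdeal R) {p : Y →ₗ[R] Y'} (m : Md x p) :
    (CQ A Y ∧ KQ A Y) ↔ CQ A Y' ∧ KQ A Y' := by
  constructor
  · rintro ⟨h1, h2⟩
    exact ⟨h1.step m, h2.step h1 m⟩
  · rintro ⟨h1, h2⟩
    have h3 := CQ.unstep hx m (fun i v => act_act_zero' (H.ex i) Y v) h1
    exact ⟨h3, KQ.unstep hx m (fun i v => H.act_act' i v) h3 h2⟩

lemma Lev.base [IsLocalRing R] [IsNoetherianRing R] [Module.Finite R M] (D : Dz A e) (G : IsRes c Γ g)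
    (hG : CQ Γ ω) : Lev A Γ e g ⊥ := by
  have mω := md_bot ((⊥ : Ideal R) • (⊤ : Submodule R ω)) (by simp)
  have mM := md_bot ((⊥ : Ideal R) • (⊤ : Submodule R M)) (by simp)
  have mR := md_bot (⊥ : Ideal R) rfl
  have r1 : RQ A (comb (R := R) e) := ⟨D.res.surj, D.res.ex0, D.res.ex⟩
  have r2 : RQ Γ (comb (R := R) g) := ⟨G.surj, G.ex0, G.ex⟩
  let δ : R →ₗ[R] (Fin (b 0) → ω) := LinearMap.toSpanSingleton R _ e
  have d1 : DQ (A 0) δ := by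
    constructor
    · rw [← LinearMap.ker_eq_bot, LinearMap.ker_eq_bot']
      intro r hr
      exact D.faith r (fun j => congrFun hr j)
    · intro v
      constructor
      · intro hv
        obtain ⟨r, hr⟩ := D.endo v hv
        exact ⟨r, funext fun j => (hr j).symm⟩
      · rintro ⟨r, rfl⟩
        show act (A 0) ω (r • e) = 0
        rw [map_smul, D.res.act_e, smul_zero]
  refine ⟨r1.step mR mω ?_, CQ.step (fun i => D.ex i) mω, d1.step (fun i => D.ex i) mR mω ?_, ?_,
    r2.step mR mM ?_, hG.step mω, CQ.both D.res (Submodule.zero_mem _) mM⟩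
  · intro v
    rw [comb_apply, map_sum]; rfl
  · intro v; rfl
  · exact FC.congr RI.congr ((Submodule.quotEquivOfEqBot _ (by simp)).symm) D.fc.ri_bot
  · intro v
    rw [comb_apply, map_sum]; rfl

lemma Lev.omega_reg [IsNoetherianRing R] [Module.Finite R ω] {J : Ideal R} (H : Lev A Γ e g J) {x : R}
    (hxR : ∀ c : R ⧸ J, x • c = 0 → c = 0) : ∀ c : ω ⧸ (J • (⊤ : Submodule R ω)), x • c = 0 → c = 0 := by
  refine HH.omega_reg fun φ hφ => ?_
  have h1 : dg J e 1 = fun j => (J • (⊤ : Submodule R ω)).mkQ (e j) := funext fun j => one_smul _ _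
  have h2 : act (A 0) _ (dg J e 1) = 0 := (H.dq.ex _).2 ⟨1, rfl⟩
  obtain ⟨t, ht⟩ := (H.dq.ex (fun j => φ (dg J e 1 j))).1 (by rw [act_nat, h2]; funext; simp)
  have hx : t = 0 := hxR t (H.dq.inj (by
    rw [map_smul, ht, map_zero]; funext j; exact hφ _))
  rw [hx, map_zero] at ht
  refine LinearMap.ext fun y => ?_
  obtain ⟨v, rfl⟩ := H.rq.r0 y
  show φ (∑ j, v j • (J • (⊤ : Submodule R ω)).mkQ (e j)) = 0
  rw [map_sum]
  refine Finset.sum_eq_zero fun j _ => ?_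
  obtain ⟨r, hr⟩ := J.mkQ_surjective (v j)
  rw [← hr]
  have h3 : φ ((J • (⊤ : Submodule R ω)).mkQ (e j)) = 0 := by
    have := congrFun ht j
    rw [h1] at this
    exact this.symm
  show φ (r • (J • (⊤ : Submodule R ω)).mkQ (e j)) = 0
  rw [map_smul, h3, smul_zero]

lemma Lev.step [IsLocalRing R] [IsNoetherianRing R] [Module.Finite R M] [Module.Finite R ω] {J : Ideal R}
    (H : Lev A Γ e g J) (hA : IsRes b A e) {x : R} (hx : x ∈ IsLocalRing.maximalIdeal R)
    (hxR : ∀ c : R ⧸ J, x • c = 0 → c = 0)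
    (hxM : ∀ c : M ⧸ (J • (⊤ : Submodule R M)), x • c = 0 → c = 0) : Lev A Γ e g (J ⊔ Ideal.span {x}) := by
  have hxω := H.omega_reg hxR
  have mω := md_mod hxω
  have mM := md_mod hxM
  have mR := md_ring hxR
  refine ⟨H.rq.step mR mω ?_, H.cq.step mω, H.dq.step H.cq mR mω ?_, ?_,
    H.rqM.step mR mM ?_, H.cqM.step mω, H.iff.trans (CQ.both hA hx mM)⟩
  · intro v
    show Submodule.factor _ (∑ j, v j • (J • (⊤ : Submodule R ω)).mkQ (e j)) = _
    rw [map_sum]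
    exact Finset.sum_congr rfl fun j _ => factor_smul _ _
  · intro v
    funext j
    exact factor_smul _ _
  · exact FC.mod hxR H.fc hxω mω mω.ker
  · intro v
    show Submodule.factor _ (∑ j, v j • (J • (⊤ : Submodule R M)).mkQ (g j)) = _
    rw [map_sum]
    exact Finset.sum_congr rfl fun j _ => factor_smul _ _


lemma Lev.chain [IsLocalRing R] [IsNoetherianRing R] [Module.Finite R M] [Module.Finite R ω]
    (D : Dz A e) (G : IsRes c Γ g) (hG : CQ Γ ω) (xs : List R) (hx : ∀ r ∈ xs, r ∈ IsLocalRing.maximalIdeal R)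
    (hxR : RingTheory.Sequence.IsWeaklyRegular R xs) (hxM : RingTheory.Sequence.IsWeaklyRegular M xs) :
    Lev A Γ e g (Ideal.ofList xs) := by
  rw [RingTheory.Sequence.isWeaklyRegular_iff] at hxR hxM
  have key : ∀ k, k ≤ xs.length → Lev A Γ e g (Ideal.ofList (xs.take k)) := by
    intro k
    induction k with
    | zero => intro _; simpa using Lev.base D G hG
    | succ k ih =>
      intro hk
      have h1 := (ih (by omega)).step (x := xs[k]) D.res (hx _ (List.getElem_mem _)) (by
          have := isSMulRegular_iff_right_eq_zero_of_smul.1 (hxR k (by omega))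
          have hJ : Ideal.ofList (xs.take k) • (⊤ : Submodule R R) = Ideal.ofList (xs.take k) := by
            rw [smul_eq_mul, Ideal.mul_top]
          rw [hJ] at this
          exact this) (isSMulRegular_iff_right_eq_zero_of_smul.1 (hxM k (by omega)))
      rw [← List.take_concat_get' xs k (by omega), Ideal.ofList_append, Ideal.ofList_singleton]
      exact h1
  simpa using key xs.length le_rfl

end Lev

section Conv
variable {R S : Type u} [CommRing R] [CommRing S] [Algebra R S]
variable {b : ℕ → ℕ} {A : ∀ i, Matrix (Fin (b (i + 1))) (Fin (b i)) R}
variable {ω Y : Type u} [AddCommGroup ω] [Module S ω] [AddCommGroup Y] [Module R Y] [Module S Y] [IsScalarTower R S Y]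
variable {e : Fin (b 0) → ω}

lemma exact_iso {C1 C2 C3 D1 D2 D3 : Type u} [Zero C3] [Zero D3] {f : C1 → C2} {g : C2 → C3} {f' : D1 → D2} {g' : D2 → D3}
    (p1 : C1 → D1) (p2 : C2 → D2) (p3 : C3 → D3) (h1 : Surjective p1) (h2 : Bijective p2) (h3 : Injective p3)
    (h0 : p3 0 = 0) (hf : ∀ v, p2 (f v) = f' (p1 v)) (hg : ∀ v, p3 (g v) = g' (p2 v)) :
    Exact f g ↔ Exact f' g' := by
  have hg0 : ∀ v, g v = 0 ↔ g' (p2 v) = 0 := fun v => by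
    rw [← hg, ← h0]; exact (h3.eq_iff).symm
  have hf0 : ∀ v, v ∈ Set.range f ↔ p2 v ∈ Set.range f' := fun v => by
    constructor
    · rintro ⟨w, rfl⟩; exact ⟨p1 w, (hf w).symm⟩
    · rintro ⟨w, hw⟩
      obtain ⟨w, rfl⟩ := h1 w
      exact ⟨w, h2.1 (by rw [hf, hw])⟩
  constructor
  · intro h v
    obtain ⟨v, rfl⟩ := h2.2 v
    rw [← hg0, h v, hf0]
  · intro h v
    rw [hg0, h, hf0]

lemma act_map {m n : ℕ} (B : Matrix (Fin m) (Fin n) R) (v : Fin n → Y) :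
    act (B.map (algebraMap R S)) Y v = act B Y v := by
  funext i
  simp [act_apply]

lemma act_map_t {m n : ℕ} (B : Matrix (Fin m) (Fin n) R) (v : Fin m → Y) :
    act (B.map (algebraMap R S)).transpose Y v = act B.transpose Y v := by
  funext i
  simp [act_apply]

lemma cq_map : CQ (fun i => (A i).map (algebraMap R S)) Y ↔ CQ A Y := by
  refine forall_congr' fun i => ?_
  exact exact_iso id id id surjective_id bijective_id injective_id rfl (fun v => act_map _ _) (fun v => act_map _ _)

lemma kex_iff (H : IsRes b (fun i => (A i).map (algebraMap R S)) e) :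
    KEx (fun i => (A i).map (algebraMap R S)) e Y ↔ KQ A Y := by
  let θ : (ω →ₗ[S] Y) → NK (A 0) Y := fun h => ⟨fun j => h (e j), by
    have := H.hom_mem h
    rw [act_map] at this
    exact this⟩
  have hθ : Bijective θ := by
    constructor
    · intro f f' hff
      exact H.hom_ext fun j => congrFun (congrArg Subtype.val hff) j
    · intro n
      obtain ⟨f, hf⟩ := H.exists_hom n.1 (by rw [act_map]; exact n.2)
      exact ⟨f, Subtype.ext (funext hf)⟩
  have hp : ∀ n : ℕ, Bijective (fun (v : Fin n → (ω →ₗ[S] Y)) j => θ (v j)) := fun n =>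
    Bijective.piMap fun _ => hθ
  have hev : ∀ k : Fin (b 0) → (ω →ₗ[S] Y), ev e Y k = evN (A 0) Y (fun j => θ (k j)) := fun k => rfl
  have hact : ∀ {m n : ℕ} (B : Matrix (Fin m) (Fin n) R) (k : Fin m → (ω →ₗ[S] Y)),
      (fun j => θ (act (B.map (algebraMap R S)).transpose _ k j)) = act B.transpose (NK (A 0) Y) (fun j => θ (k j)) := by
    intro m n B k
    funext j
    refine Subtype.ext (funext fun l => ?_)
    simp [act_apply, θ]
  have h0 : ∀ n : ℕ, (fun (v : Fin n → (ω →ₗ[S] Y)) j => θ (v j)) 0 = 0 := fun n => by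
    funext j; exact Subtype.ext (funext fun l => rfl)
  have e1 : Surjective (ev (R := S) e Y) ↔ Surjective (evN (A 0) Y) := by
    constructor
    · intro h y
      obtain ⟨k, rfl⟩ := h y
      exact ⟨_, (hev k).symm⟩
    · intro h y
      obtain ⟨k, rfl⟩ := h y
      obtain ⟨k, rfl⟩ := (hp _).2 k
      exact ⟨k, hev k⟩
  have e2 := exact_iso (f := act ((A 0).map (algebraMap R S)).transpose (ω →ₗ[S] Y)) (g := ev e Y)
    (f' := act (A 0).transpose (NK (A 0) Y)) (g' := evN (A 0) Y) _ _ id (hp _).2 (hp _) injective_id rfl (hact _) hev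
  have e3 := fun i => exact_iso (f := act ((A (i + 1)).map (algebraMap R S)).transpose (ω →ₗ[S] Y))
    (g := act ((A i).map (algebraMap R S)).transpose (ω →ₗ[S] Y))
    (f' := act (A (i + 1)).transpose (NK (A 0) Y)) (g' := act (A i).transpose (NK (A 0) Y)) _ _ _
    (hp _).2 (hp _) (hp _).1 (h0 _) (hact _) (hact _)
  constructor
  · intro h
    exact ⟨e1.1 h.k0, e2.1 h.k1, fun i => (e3 i).1 (h.k2 i)⟩
  · intro h
    exact ⟨e1.2 h.k0, e2.2 h.k1, fun i => (e3 i).2 (h.k2 i)⟩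

end Conv

section LevS
variable {R : Type u} [CommRing R]
variable {b : ℕ → ℕ} {A : ∀ i, Matrix (Fin (b (i + 1))) (Fin (b i)) R}
variable {c : ℕ → ℕ} {Γ : ∀ i, Matrix (Fin (c (i + 1))) (Fin (c i)) R}
variable {ω M : Type u} [AddCommGroup ω] [Module R ω] [AddCommGroup M] [Module R M]
variable {e : Fin (b 0) → ω} {g : Fin (c 0) → M} {J : Ideal R}

lemma RQ.isRes {X : Type u} [AddCommGroup X] [Module R X] {g : Fin (c 0) → X} (H : RQ Γ (cmb J g)) :
    IsRes c (fun i => (Γ i).map (algebraMap R (R ⧸ J))) (fun j => (J • (⊤ : Submodule R X)).mkQ (g j)) where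
  surj := H.r0
  ex0 := (exact_iso (f' := act (Γ 0).transpose (R ⧸ J)) (g' := cmb J g) id id id surjective_id bijective_id injective_id rfl
    (fun v => act_map_t _ _) (fun v => rfl)).2 H.r1
  ex i := (exact_iso id id id surjective_id bijective_id injective_id rfl (fun v => act_map_t _ _)
    (fun v => act_map_t _ _)).2 (H.r2 i)

lemma Lev.dz (H : Lev A Γ e g J) :
    Dz (fun i => (A i).map (algebraMap R (R ⧸ J))) (fun j => (J • (⊤ : Submodule R ω)).mkQ (e j)) where
  res := H.rq.isRes
  fc := FC.conv (R := R) (S := R ⧸ J) Ideal.Quotient.mk_surjective (by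
    have : RingHom.ker (algebraMap R (R ⧸ J)) = J := Ideal.mk_ker
    rw [this]; exact H.fc)
  ex := cq_map.2 H.cq
  endo v hv := by
    rw [act_map] at hv
    obtain ⟨r, hr⟩ := (H.dq.ex v).1 hv
    exact ⟨r, fun j => (congrFun hr j).symm⟩
  faith r hr := H.dq.inj (by rw [map_zero]; exact funext hr)

end LevS
end HH

namespace HH
open Function

section Fin
variable {R : Type u} [CommRing R] [IsLocalRing R] [IsNoetherianRing R]
variable {b : ℕ → ℕ} {A : ∀ i, Matrix (Fin (b (i + 1))) (Fin (b i)) R}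
variable {ω : Type u} [AddCommGroup ω] [Module R ω] {e : Fin (b 0) → ω}

lemma bass_iff (D : Dz A e) (M : Type u) [AddCommGroup M] [Module R M]
    [Module.Finite R M] (hMω : ∀ i, EZ R M ω (i + 1)) :
    (∃ n, GG.gidLE R M n) ↔ CQ A M ∧ KEx A e M := by
  have h1 : CQ A M ↔ ∀ i, EZ R ω M (i + 1) := forall_congr' fun i => (IsRes.ez_iff M i ω D.res).symm
  rw [h1]
  constructor
  · rintro ⟨n, hn⟩
    exact Adir D (FC.of_coresolution _ gi_congr n M hn)
  · rintro ⟨h2, h3⟩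
    exact Bdir D M hMω h2 h3

theorem fin_aux (D : Dz A e) (M : Type u) [AddCommGroup M] [Module R M]
    [Module.Finite R M] (hMω : ∀ i, EZ R M ω (i + 1)) (xs : List R)
    (hx : ∀ r ∈ xs, r ∈ IsLocalRing.maximalIdeal R)
    (hxR : RingTheory.Sequence.IsWeaklyRegular R xs) (hxM : RingTheory.Sequence.IsWeaklyRegular M xs) :
    (∃ n, GG.gidLE R M n) ↔
      ∃ n, GG.gidLE (R ⧸ Ideal.ofList xs) (M ⧸ (Ideal.ofList xs • (⊤ : Submodule R M))) n := by
  have : Module.Finite R ω := Module.Finite.of_surjective _ D.res.surj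
  obtain ⟨c, Γ, g, G⟩ := exists_res R M
  have hG : CQ Γ ω := fun i => (IsRes.ez_iff ω i M G).1 (hMω i)
  have H := Lev.chain D G hG xs hx hxR hxM
  have hJ : Ideal.ofList xs ≤ IsLocalRing.maximalIdeal R := Ideal.span_le.2 hx
  generalize Ideal.ofList xs = J at H hJ ⊢
  have : Nontrivial (R ⧸ J) := Ideal.Quotient.nontrivial_iff.2 fun h =>
    (IsLocalRing.maximalIdeal.isMaximal R).ne_top (top_le_iff.1 (h ▸ hJ))
  have : IsLocalRing (R ⧸ J) := IsLocalRing.of_surjective' _ Ideal.Quotient.mk_surjective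
  have : Module.Finite (R ⧸ J) (M ⧸ (J • (⊤ : Submodule R M))) := Module.Finite.of_restrictScalars_finite R _ _
  have D' := H.dz
  have hM' : ∀ i, EZ (R ⧸ J) (M ⧸ (J • (⊤ : Submodule R M))) (ω ⧸ (J • (⊤ : Submodule R ω))) (i + 1) := fun i =>
    (IsRes.ez_iff _ i _ H.rqM.isRes).2 (cq_map.2 H.cqM i)
  rw [bass_iff D M hMω, bass_iff D' _ hM', cq_map, kex_iff D'.res]
  have hA : (fun i => (A i).map (algebraMap R R)) = A := by funext i; ext; rfl
  have h2 : KEx A e M ↔ KQ A M := by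
    have := kex_iff (R := R) (S := R) (A := A) (Y := M) (e := e) (by rw [hA]; exact D.res)
    rwa [hA] at this
  rw [h2]
  exact H.iff
end Fin
end HH

namespace HH
open Function CategoryTheory CategoryTheory.Abelian RingTheory.Sequence
open scoped Pointwise

section NK
variable {R : Type u} [CommRing R]
variable {X Y W : Type u} [AddCommGroup X] [Module R X] [AddCommGroup Y] [Module R Y] [AddCommGroup W] [Module R W]

lemma ses_x {x : R} (hx : IsSMulRegular X x) :
    Ses (LinearMap.lsmul R X x) (Submodule.mkQ (x • (⊤ : Submodule R X)) : X →ₗ[R] QuotSMulTop x X) where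
  inj := hx
  exact y := by
    rw [Submodule.mkQ_apply, Submodule.Quotient.mk_eq_zero]
    constructor
    · rintro ⟨z, -, rfl⟩; exact ⟨z, rfl⟩
    · rintro ⟨z, rfl⟩; exact ⟨z, trivial, rfl⟩
  surj := Submodule.mkQ_surjective _

lemma ez_nak [IsLocalRing R] [IsNoetherianRing R] [Module.Finite R X] [Module.Finite R W] {x : R}
    (hm : x ∈ IsLocalRing.maximalIdeal R) (hx : IsSMulRegular X x) {i : ℕ}
    (h : EZ R (QuotSMulTop x X) W (i + 1)) : EZ R X W i := by
  have key : ∀ y : Ext.{u} (ModuleCat.of R X) (ModuleCat.of R W) i, ∃ z, y = x • z := by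
    intro y
    obtain ⟨z, hz⟩ := Ext.contravariant_sequence_exact₁ (ses_x hx).se (ModuleCat.of R W) y (add_comm 1 i) (h _)
    refine ⟨z, ?_⟩
    rw [← hz]
    have : (ses_x hx).sc.f = x • 𝟙 (ModuleCat.of R X) := by ext v; rfl
    rw [this, Ext.mk₀_smul, Ext.smul_comp, Ext.mk₀_id_comp]
  have : (⊤ : Submodule R (Ext.{u} (ModuleCat.of R X) (ModuleCat.of R W) i)) = ⊥ := by
    refine Submodule.eq_bot_of_le_smul_of_le_jacobson_bot (IsLocalRing.maximalIdeal R) _ (Module.finite_def.1 inferInstance)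
      (fun y _ => ?_) (IsLocalRing.maximalIdeal_le_jacobson _)
    obtain ⟨z, rfl⟩ := key y
    exact Submodule.smul_mem_smul hm trivial
  intro y
  exact (Submodule.mem_bot R).1 (this ▸ Submodule.mem_top)

lemma ez_list_up (zs : List R) : ∀ (X : Type u) [AddCommGroup X] [Module R X] (s : ℕ)
    (_ : ∀ i, s < i → EZ R X W i) (_ : IsWeaklyRegular X zs) (i : ℕ) (_ : s + zs.length < i),
    EZ R (X ⧸ (Ideal.ofList zs • (⊤ : Submodule R X))) W i := by
  induction zs with
  | nil =>
    intro X _ _ s h _ i hi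
    exact EZ.congrX (Submodule.quotEquivOfEqBot _ (by simp)).symm (h i (by simpa using hi))
  | cons x zs ih =>
    intro X _ _ s h hr i hi
    obtain ⟨hx, hr⟩ := (isWeaklyRegular_cons_iff X x zs).1 hr
    refine EZ.congrX (Submodule.quotOfListConsSMulTopEquivQuotSMulTopInner X x zs).symm
      (ih (QuotSMulTop x X) (s + 1) (fun j hj => ?_) hr i (by rw [List.length_cons] at hi; omega))
    obtain ⟨j, rfl⟩ : ∃ k, j = k + 1 := ⟨j - 1, by omega⟩
    exact (ses_x hx).ezX_quot (h j (by omega)) (h (j + 1) (by omega))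

lemma ez_list_down [IsLocalRing R] [IsNoetherianRing R] [Module.Finite R W] (zs : List R) :
    ∀ (X : Type u) [AddCommGroup X] [Module R X] [Module.Finite R X] (_ : ∀ r ∈ zs, r ∈ IsLocalRing.maximalIdeal R)
    (_ : IsWeaklyRegular X zs) (i : ℕ) (_ : EZ R (X ⧸ (Ideal.ofList zs • (⊤ : Submodule R X))) W (i + zs.length)),
    EZ R X W i := by
  induction zs with
  | nil =>
    intro X _ _ _ _ _ i h
    exact EZ.congrX (Submodule.quotEquivOfEqBot _ (by simp)) h
  | cons x zs ih =>
    intro X _ _ _ hm hr i h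
    obtain ⟨hx, hr⟩ := (isWeaklyRegular_cons_iff X x zs).1 hr
    refine ez_nak (hm x (by simp)) hx (ih (QuotSMulTop x X) (fun r hr => hm r (by simp [hr])) hr (i + 1) ?_)
    have := EZ.congrX (Submodule.quotOfListConsSMulTopEquivQuotSMulTopInner X x zs) h
    rwa [List.length_cons, ← add_assoc, add_right_comm] at this

lemma prime_reg {p : Ideal R} [p.IsPrime] {x : R} (hx : x ∉ p) : IsSMulRegular (R ⧸ p) x := by
  rw [isSMulRegular_iff_right_eq_zero_of_smul]
  intro c hc
  obtain ⟨c, rfl⟩ := Ideal.Quotient.mk_surjective c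
  have : Ideal.Quotient.mk p (x * c) = 0 := hc
  rw [Ideal.Quotient.eq_zero_iff_mem] at this ⊢
  exact (Ideal.IsPrime.mem_or_mem ‹_› this).resolve_left hx

lemma exists_dim (R : Type u) [CommRing R] [IsLocalRing R] [IsNoetherianRing R] :
    ∃ N : ℕ, ringKrullDim R = N := by
  have h1 : ringKrullDim R ≠ ⊤ := ringKrullDim_ne_top
  have h2 : ringKrullDim R ≠ ⊥ := ringKrullDim_ne_bot
  obtain ⟨c, hc⟩ := WithBot.ne_bot_iff_exists.1 h2
  rw [← hc] at h1 ⊢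
  have h3 : c ≠ ⊤ := fun h => h1 (by rw [h]; rfl)
  obtain ⟨n, rfl⟩ := ENat.ne_top_iff_exists.1 h3
  exact ⟨n, rfl⟩

/-- the socle of a quotient by a maximal regular sequence -/
lemma exists_socle (R : Type u) [CommRing R] [IsLocalRing R] [IsNoetherianRing R] :
    ∃ zs : List R, (∀ r ∈ zs, r ∈ IsLocalRing.maximalIdeal R) ∧ IsRegular R zs ∧
      ∃ f : (R ⧸ IsLocalRing.maximalIdeal R) →ₗ[R] (R ⧸ (Ideal.ofList zs • (⊤ : Submodule R R))), Injective f := by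
  have hb : ∃ N : ℕ, ∀ zs : List R, IsRegular R zs → zs.length ≤ N := by
    obtain ⟨N, hN⟩ := exists_dim R
    refine ⟨N, fun zs hz => ?_⟩
    have h := ringKrullDim_add_length_eq_ringKrullDim_of_isRegular zs hz
    have hn : Nontrivial (R ⧸ Ideal.ofList zs) := by
      refine Ideal.Quotient.nontrivial_iff.2 fun h => hz.top_ne_smul ?_
      rw [h, Submodule.top_smul]
    have h0 : 0 ≤ ringKrullDim (R ⧸ Ideal.ofList zs) := ringKrullDim_nonneg_of_nontrivial
    rw [hN] at h
    have : ((zs.length : ℕ) : WithBot ℕ∞) ≤ (N : ℕ) := by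
      rw [← h]
      exact le_add_of_nonneg_left h0
    exact_mod_cast this
  obtain ⟨N, hN⟩ := hb
  suffices H : ∀ n (zs : List R), (∀ r ∈ zs, r ∈ IsLocalRing.maximalIdeal R) → IsRegular R zs → N ≤ zs.length + n →
    ∃ zs : List R, (∀ r ∈ zs, r ∈ IsLocalRing.maximalIdeal R) ∧ IsRegular R zs ∧
      ∃ f : (R ⧸ IsLocalRing.maximalIdeal R) →ₗ[R] (R ⧸ (Ideal.ofList zs • (⊤ : Submodule R R))), Injective f from
    H N [] (by simp) (IsRegular.nil R R) (by simp)
  have key : ∀ (zs : List R), (∀ r ∈ zs, r ∈ IsLocalRing.maximalIdeal R) → IsRegular R zs →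
      (¬ ∃ f : (R ⧸ IsLocalRing.maximalIdeal R) →ₗ[R] (R ⧸ (Ideal.ofList zs • (⊤ : Submodule R R))), Injective f) →
      ∃ r, (∀ s ∈ zs ++ [r], s ∈ IsLocalRing.maximalIdeal R) ∧ IsRegular R (zs ++ [r]) := by
    intro zs h1 h2 hcon
    have hs : Subsingleton ((R ⧸ IsLocalRing.maximalIdeal R) →ₗ[R] (R ⧸ (Ideal.ofList zs • (⊤ : Submodule R R)))) := by
      refine subsingleton_of_forall_eq 0 fun φ => ?_
      by_contra h0
      have : IsSimpleModule R (R ⧸ IsLocalRing.maximalIdeal R) :=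
        isSimpleModule_iff_isCoatom.2 (IsLocalRing.maximalIdeal.isMaximal R).out
      exact hcon ⟨φ, LinearMap.injective_of_ne_zero h0⟩
    obtain ⟨r, hr, hreg⟩ := IsSMulRegular.subsingleton_linearMap_iff.1 hs
    rw [Ideal.annihilator_quotient] at hr
    have h4 : IsWeaklyRegular R (zs ++ [r]) :=
      (isWeaklyRegular_append_iff R zs [r]).2 ⟨h2.toIsWeaklyRegular, (isWeaklyRegular_singleton_iff _ r).2 hreg⟩
    have h5 : ∀ s ∈ zs ++ [r], s ∈ IsLocalRing.maximalIdeal R := by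
      intro s hs
      rcases List.mem_append.1 hs with h | h
      · exact h1 s h
      · rw [List.mem_singleton.1 h]; exact hr
    exact ⟨r, h5, IsRegular.of_isWeaklyRegular_of_mem_maximalIdeal _ h5 h4⟩
  intro n
  induction n with
  | zero =>
    intro zs h1 h2 h3
    by_contra hcon
    have hcon' : ¬ ∃ f : (R ⧸ IsLocalRing.maximalIdeal R) →ₗ[R] (R ⧸ (Ideal.ofList zs • (⊤ : Submodule R R))), Injective f :=
      fun h => hcon ⟨zs, h1, h2, h⟩
    obtain ⟨r, -, h5⟩ := key zs h1 h2 hcon'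
    have := hN _ h5
    rw [List.length_append, List.length_singleton] at this
    omega
  | succ n ih =>
    intro zs h1 h2 h3
    by_cases hc : ∃ f : (R ⧸ IsLocalRing.maximalIdeal R) →ₗ[R] (R ⧸ (Ideal.ofList zs • (⊤ : Submodule R R))), Injective f
    · exact ⟨zs, h1, h2, hc⟩
    · obtain ⟨r, h4, h5⟩ := key zs h1 h2 hc
      exact ih _ h4 h5 (by rw [List.length_append, List.length_singleton]; omega)

end NK
end HH

namespace HH
open Function CategoryTheory CategoryTheory.Abelian RingTheory.Sequence
open scoped Pointwise

section KK
variable {R : Type u} [CommRing R] [IsLocalRing R] [IsNoetherianRing R]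

lemma ez_subs {X W : Type u} [AddCommGroup X] [Module R X] [AddCommGroup W] [Module R W] [Subsingleton X] (i : ℕ) :
    EZ R X W i :=
  EZ.congrX (LinearEquiv.ofSubsingleton PUnit.{u+1} X) (ez_punitX i)

lemma ez_filt {W : Type u} [AddCommGroup W] [Module R W] (i : ℕ) (h : ∀ p : PrimeSpectrum R, EZ R (R ⧸ p.1) W i)
    (X : Type u) [AddCommGroup X] [Module R X] [hX : Module.Finite R X] : EZ R X W i := by
  refine IsNoetherianRing.induction_on_isQuotientEquivQuotientPrime R hX
    (motive := fun N _ _ _ => EZ R N W i) ?_ ?_ ?_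
  · intro N _ _ _ _
    exact ez_subs i
  · intro N _ _ _ p e
    exact EZ.congrX e.symm (h p)
  · intro N₁ _ _ _ N₂ _ _ _ N₃ _ _ _ f g hf hg he h1 h3
    exact Ses.ezX_mid ⟨hf, he, hg⟩ h1 h3

lemma exists_mem_not {p : Ideal R} [hp : p.IsPrime] (h : p ≠ IsLocalRing.maximalIdeal R) :
    ∃ x ∈ IsLocalRing.maximalIdeal R, x ∉ p := by
  by_contra hc
  push Not at hc
  exact h (le_antisymm (IsLocalRing.le_maximalIdeal hp.ne_top) hc)

/-- vanishing of Ext into modules of finite injective dimension beyond the depth of the ring -/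
lemma ez_depth {W : Type u} [AddCommGroup W] [Module R W] [Module.Finite R W] (hW : FC R (Inj R) W) {zs : List R}
    (hz : IsWeaklyRegular R zs)
    {f : (R ⧸ IsLocalRing.maximalIdeal R) →ₗ[R] (R ⧸ (Ideal.ofList zs • (⊤ : Submodule R R)))} (hf : Injective f) :
    ∀ i, zs.length < i → ∀ (X : Type u) [AddCommGroup X] [Module R X] [Module.Finite R X], EZ R X W i := by
  obtain ⟨n, hn⟩ := FC.ez hW
  suffices H : ∀ k, ∀ i, zs.length < i → n < i + k →
      ∀ (X : Type u) [AddCommGroup X] [Module R X] [Module.Finite R X], EZ R X W i from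
    fun i hi => H (n + 1) i hi (by omega)
  intro k
  induction k with
  | zero => intro i _ h X _ _ _; exact hn X i (by omega)
  | succ k ih =>
    intro i hi hik
    have ih' := ih (i + 1) (by omega) (by omega)
    refine fun X _ _ _ => ez_filt i (fun p => ?_) X
    by_cases hp : p.1 = IsLocalRing.maximalIdeal R
    · rw [hp]
      refine (ses_quot_range hf).ezX_sub ?_ (ih' _)
      refine ez_list_up zs R 0 (fun j hj => ?_) hz i (by omega)
      obtain ⟨j, rfl⟩ : ∃ k, j = k + 1 := ⟨j - 1, by omega⟩
      exact ez_proj j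
    · have := p.2
      obtain ⟨x, hx, hxp⟩ := exists_mem_not hp
      exact ez_nak hx (prime_reg hxp) (ih' _)

lemma ez_low {M : Type u} [AddCommGroup M] [Module R M] [Module.Finite R M] {d : ℕ}
    (hM : ∀ i < d, EZ R (R ⧸ IsLocalRing.maximalIdeal R) M i) (n : ℕ) :
    ∀ i, i + n ≤ d → ∀ (X : Type u) [AddCommGroup X] [Module R X] [hX : Module.Finite R X],
    Module.supportDim R X < n → EZ R X M i := by
  induction n with
  | zero =>
    intro i hi X _ _ _ h
    have : Subsingleton X := by
      by_contra hc
      rw [not_subsingleton_iff_nontrivial] at hc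
      have := Module.supportDim_ne_bot_of_nontrivial R X
      obtain ⟨c, hc⟩ := WithBot.ne_bot_iff_exists.1 this
      rw [← hc] at h
      have : c < 0 := by exact_mod_cast h
      exact not_lt_zero this
    exact ez_subs i
  | succ n ih =>
    intro i hi X _ _ hX
    refine IsNoetherianRing.induction_on_isQuotientEquivQuotientPrime R hX
      (motive := fun N _ _ _ => Module.supportDim R N < (n + 1 : ℕ) → EZ R N M i) ?_ ?_ ?_
    · intro N _ _ _ _ _
      exact ez_subs i
    · intro N _ _ _ p e hN
      refine EZ.congrX e.symm ?_
      rw [Module.supportDim_eq_of_equiv e] at hN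
      by_cases hp : p.1 = IsLocalRing.maximalIdeal R
      · rw [hp]
        exact hM i (by omega)
      · have := p.2
        obtain ⟨x, hx, hxp⟩ := exists_mem_not hp
        refine ez_nak hx (prime_reg hxp) (ih (i + 1) (by omega) _ ?_)
        have h1 := Module.supportDim_quotSMulTop_succ_eq_supportDim (prime_reg hxp) hx
        rw [← h1] at hN
        push_cast at hN
        exact lt_of_add_lt_add_right hN
    · intro N₁ _ _ _ N₂ _ _ _ N₃ _ _ _ f g hf hg he h1 h3 hN
      exact Ses.ezX_mid ⟨hf, he, hg⟩ (h1 (lt_of_le_of_lt (Module.supportDim_le_of_injective f hf) hN))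
        (h3 (lt_of_le_of_lt (Module.supportDim_le_of_surjective g hg) hN))

end KK
end HH

namespace HH
open Function CategoryTheory CategoryTheory.Abelian RingTheory.Sequence
open scoped Pointwise

section DD
variable {R : Type u} [CommRing R] [IsLocalRing R] [IsNoetherianRing R]

/-- the residue field has no low Ext into a module with a long regular sequence -/
lemma ez_rees {M : Type u} [AddCommGroup M] [Module R M] [Module.Finite R M] {rs : List R}
    (hm : ∀ r ∈ rs, r ∈ IsLocalRing.maximalIdeal R) (hr : IsRegular M rs) :
    ∀ i < rs.length, EZ R (R ⧸ IsLocalRing.maximalIdeal R) M i := by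
  intro i hi
  have hn : Nontrivial M := hr.nontrivial
  refine ez_iff.2 (ModuleCat.subsingleton_ext_of_exists_isRegular (IsLocalRing.maximalIdeal R)
    (ModuleCat.of R (R ⧸ IsLocalRing.maximalIdeal R)) ?_ (ModuleCat.of R M) ?_ rs hm hr i hi)
  · intro q hq
    have hq' : q ∈ Module.support R (R ⧸ IsLocalRing.maximalIdeal R) := hq
    have := Module.mem_support_iff_of_finite.1 hq'
    rw [Ideal.annihilator_quotient] at this
    exact this
  · refine lt_top_iff_ne_top.2 fun h => ?_
    have := Submodule.eq_bot_of_le_smul_of_le_jacobson_bot (IsLocalRing.maximalIdeal R) (⊤ : Submodule R M)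
      (Module.finite_def.1 inferInstance) h.ge (IsLocalRing.maximalIdeal_le_jacobson _)
    exact top_ne_bot this

lemma ass_dim {M : Type u} [AddCommGroup M] [Module R M] [Module.Finite R M] {d : ℕ}
    (hM : ∀ i < d, EZ R (R ⧸ IsLocalRing.maximalIdeal R) M i) {p : Ideal R} (hp : p ∈ associatedPrimes R M) :
    (d : WithBot ℕ∞) ≤ Module.supportDim R (R ⧸ p) := by
  by_contra hc
  have h := ez_low hM d 0 (by omega) (R ⧸ p) (not_le.1 hc)
  obtain ⟨h1, y, hy⟩ := (isAssociatedPrime_iff_exists_injective_linearMap _ _).1 hp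
  have := ez_zero.1 h y
  have h0 : (1 : R ⧸ p) = 0 := hy (by rw [this]; rfl)
  have : Nontrivial (R ⧸ p) := Ideal.Quotient.nontrivial_iff.2 h1.ne_top
  exact one_ne_zero h0

lemma supportDim_mono {X Y : Type u} [AddCommGroup X] [Module R X] [AddCommGroup Y] [Module R Y]
    (h : Module.support R X ⊆ Module.support R Y) : Module.supportDim R X ≤ Module.supportDim R Y :=
  Order.krullDim_le_of_strictMono (fun a => ⟨a.1, h a.2⟩) (fun {_ _} lt => lt)

/-- regular sequences on a module pass to modules of maximal depth -/
lemma reg_of_low (xs : List R) : ∀ (A M : Type u) [AddCommGroup A] [Module R A] [AddCommGroup M] [Module R M]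
    [Module.Finite R A] [Module.Finite R M] (d : ℕ) (_ : Module.supportDim R A ≤ d)
    (_ : Module.support R M ⊆ Module.support R A) (_ : ∀ i < d, EZ R (R ⧸ IsLocalRing.maximalIdeal R) M i)
    (_ : ∀ r ∈ xs, r ∈ IsLocalRing.maximalIdeal R) (_ : IsRegular A xs), IsWeaklyRegular M xs := by
  induction xs with
  | nil => intros; exact IsWeaklyRegular.nil R _
  | cons x xs ih =>
    intro A M _ _ _ _ _ _ d hA hs hM hm hr
    obtain ⟨hx, hr⟩ := (isRegular_cons_iff A x xs).1 hr
    have hxm := hm x (by simp)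
    have h1 := Module.supportDim_quotSMulTop_succ_eq_supportDim hx hxm
    have hn : Nontrivial (QuotSMulTop x A) := hr.nontrivial
    obtain ⟨c, hc⟩ := WithBot.ne_bot_iff_exists.1 (Module.supportDim_ne_bot_of_nontrivial R (QuotSMulTop x A))
    rw [← h1, ← hc] at hA
    have hA' : c + 1 ≤ d := by exact_mod_cast hA
    have hct : c ≠ ⊤ := by rintro rfl; simp at hA'
    obtain ⟨c, rfl⟩ := ENat.ne_top_iff_exists.1 hct
    have hcd : c + 1 ≤ d := by exact_mod_cast hA'
    have hxM : IsSMulRegular M x := by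
      by_contra hx'
      have hmem : x ∈ ({r | IsSMulRegular M r}ᶜ : Set R) := hx'
      rw [← biUnion_associatedPrimes_eq_compl_regular R M] at hmem
      simp only [Set.mem_iUnion] at hmem
      obtain ⟨p, hp, hxp⟩ := hmem
      have hpp : p.IsPrime := hp.1
      have hsp : (⟨p, hpp⟩ : PrimeSpectrum R) ∈ Module.support R M :=
        Module.mem_support_iff_of_finite.2 (Submodule.annihilator_top (R := R) (M := M) ▸ hp.annihilator_le)
      have h2 := ass_dim hM hp
      have h3 : Module.supportDim R (R ⧸ p) ≤ Module.supportDim R (QuotSMulTop x A) := by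
        refine supportDim_mono fun q hq => ?_
        replace hq := Module.mem_support_iff_of_finite.1 hq
        rw [Ideal.annihilator_quotient] at hq
        rw [Module.support_quotSMulTop]
        refine ⟨Module.mem_support_mono (p := ⟨p, hpp⟩) hq (hs hsp), ?_⟩
        have : x ∈ q.asIdeal := hq hxp
        simpa using this
      have h4 := h2.trans h3
      rw [← hc] at h4
      have : d ≤ c := by exact_mod_cast h4
      omega
    refine IsWeaklyRegular.cons hxM (ih (QuotSMulTop x A) (QuotSMulTop x M) c ?_ ?_ ?_ (fun r hr => hm r (by simp [hr])) hr)
    · rw [← hc]; rfl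
    · rw [Module.support_quotSMulTop, Module.support_quotSMulTop]
      exact Set.inter_subset_inter_left _ hs
    · intro i hi
      exact (ses_x hxM).ezY_quot (hM i (by omega)) (hM (i + 1) (by omega))

/-- attainment of the depth -/
lemma exists_of_mdepth {M : Type u} [AddCommGroup M] [Module R M] {d : ℕ} (hn : Nontrivial M) (h : (GG.mdepth R M : WithBot ℕ∞) = d) :
    ∃ rs : List R, rs.length = d ∧ (∀ r ∈ rs, r ∈ IsLocalRing.maximalIdeal R) ∧ IsRegular M rs := by
  have h1 : GG.mdepth R M = d := by exact_mod_cast h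
  have h2 : GG.mdepth R M ∈ {c : ℕ∞ | ∃ rs : List R, c = rs.length ∧ (∀ r ∈ rs, r ∈ IsLocalRing.maximalIdeal R) ∧ IsRegular M rs} := by
    have : Nonempty ↑{c : ℕ∞ | ∃ rs : List R, c = rs.length ∧ (∀ r ∈ rs, r ∈ IsLocalRing.maximalIdeal R) ∧ IsRegular M rs} :=
      ⟨0, [], rfl, by simp, IsRegular.nil R M⟩
    refine ENat.sSup_mem_of_nonempty_of_lt_top ?_
    have : GG.mdepth R M < ⊤ := h1 ▸ ENat.natCast_lt_top d
    exact this
  obtain ⟨rs, h3, h4, h5⟩ := h2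
  rw [h1] at h3
  exact ⟨rs, by exact_mod_cast h3.symm, h4, h5⟩

end DD
end HH

namespace HH
open Function CategoryTheory CategoryTheory.Abelian RingTheory.Sequence
open scoped Pointwise

section Red

lemma fc_quot {Q : Type u} [CommRing Q] {r : Q} (hr : IsSMulRegular Q r) (h : FC Q (Inj Q) Q) :
    FC (Q ⧸ Ideal.span {r}) (Inj (Q ⧸ Ideal.span {r})) (Q ⧸ Ideal.span {r}) := by
  have hr0 : ∀ c : Q, r • c = 0 → c = 0 := isSMulRegular_iff_right_eq_zero_of_smul.1 hr
  have hb : ∀ c : Q ⧸ (⊥ : Ideal Q), r • c = 0 → c = 0 := by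
    intro c hc
    obtain ⟨c, rfl⟩ := Ideal.Quotient.mk_surjective c
    have : Ideal.Quotient.mk (⊥ : Ideal Q) (r * c) = 0 := hc
    rw [Ideal.Quotient.eq_zero_iff_mem, Ideal.mem_bot] at this
    rw [hr0 c this, map_zero]
  have m : Md r (Submodule.mkQ (Ideal.span {r}) : Q →ₗ[Q] Q ⧸ Ideal.span {r}) := by
    refine ⟨Submodule.mkQ_surjective _, fun c => ?_, fun c hc => ?_, Or.inl hr0⟩
    · rw [Submodule.mkQ_apply, Submodule.Quotient.mk_eq_zero]
      exact Ideal.mul_mem_right _ _ (Ideal.mem_span_singleton_self r)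
    · rw [Submodule.mkQ_apply, Submodule.Quotient.mk_eq_zero] at hc
      obtain ⟨c', rfl⟩ := Ideal.mem_span_singleton'.1 hc
      exact ⟨c', mul_comm _ _⟩
  have := FC.mod hb h.ri_bot hr0 m m.ker
  refine FC.conv (R := Q) (S := Q ⧸ Ideal.span {r}) Ideal.Quotient.mk_surjective ?_
  have hk : RingHom.ker (algebraMap Q (Q ⧸ Ideal.span {r})) = Ideal.span {r} := Ideal.mk_ker
  rw [hk]
  rwa [bot_sup_eq] at this

lemma exists_red {R : Type u} [CommRing R] [IsLocalRing R] [IsNoetherianRing R] {d : ℕ} (hd : ringKrullDim R = d)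
    {ys : List R} (hl : ys.length = d) (hm : ∀ r ∈ ys, r ∈ IsLocalRing.maximalIdeal R) (hr : IsRegular R ys) (n : ℕ) :
    ∀ (Q : Type u) [CommRing Q] [IsLocalRing Q] [IsNoetherianRing Q] [Algebra Q R] (_ : Surjective (algebraMap Q R))
      (_ : FC Q (Inj Q) Q) (_ : ringKrullDim Q < n),
    ∃ (Q : Type u) (_ : CommRing Q) (_ : Algebra Q R), IsLocalRing Q ∧ IsNoetherianRing Q ∧ Surjective (algebraMap Q R) ∧
      FC Q (Inj Q) Q ∧ ∀ i, EZ Q R Q (i + 1) := by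
  induction n with
  | zero =>
    intro Q _ _ _ _ _ _ h
    exact absurd ringKrullDim_nonneg_of_nontrivial (not_le.2 h)
  | succ n ih =>
    intro Q _ _ _ _ hs hQ hn
    obtain ⟨zs, hz1, hz2, f, hf⟩ := exists_socle Q
    have : Module.Finite Q R := Module.Finite.of_surjective (Algebra.linearMap Q R) hs
    by_cases ht : zs.length ≤ d
    · refine ⟨Q, inferInstance, inferInstance, inferInstance, inferInstance, hs, hQ, fun i => ?_⟩
      have hσ : ∀ s, algebraMap Q R (surjInv hs s) = s := surjInv_eq hs
      have hys : (ys.map (surjInv hs)).map (algebraMap Q R) = ys := by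
        rw [List.map_map]
        exact List.map_id'' hσ ys
      refine ez_list_down (ys.map (surjInv hs)) R ?_ ?_ (i + 1) (ez_depth hQ hz2.toIsWeaklyRegular hf _ ?_ _)
      · intro r hr'
        obtain ⟨y, hy, rfl⟩ := List.mem_map.1 hr'
        rw [IsLocalRing.mem_maximalIdeal, mem_nonunits_iff]
        intro hu
        have := hu.map (algebraMap Q R)
        rw [hσ] at this
        exact (IsLocalRing.mem_maximalIdeal _).1 (hm y hy) this
      · rw [← isWeaklyRegular_map_algebraMap_iff R R, hys]
        exact hr.toIsWeaklyRegular
      · rw [List.length_map]; omega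
    · have e : R ≃ₗ[Q] (Q ⧸ RingHom.ker (algebraMap Q R)) :=
        ((LinearMap.quotKerEquivOfSurjective (Algebra.linearMap Q R) hs).symm)
      have hdim : Module.supportDim Q R = d := by
        rw [Module.supportDim_eq_of_equiv e, Module.supportDim_quotient_eq_ringKrullDim, ← hd]
        exact ringKrullDim_eq_of_ringEquiv (RingHom.quotientKerEquivOfSurjective hs)
      have h0 : EZ Q R Q 0 := by
        refine ez_low (ez_rees hz1 hz2) (d + 1) 0 (by omega) R ?_
        rw [hdim]
        exact_mod_cast Nat.lt_succ_self d
      have hss : Subsingleton (R →ₗ[Q] Q) := subsingleton_of_forall_eq 0 (ez_zero.1 h0)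
      obtain ⟨r, hr', hreg⟩ := IsSMulRegular.subsingleton_linearMap_iff.1 hss
      have hr0 : algebraMap Q R r = 0 := by
        have := Module.mem_annihilator.1 hr' (1 : R)
        rwa [Algebra.smul_def, mul_one] at this
      have hrm : r ∈ IsLocalRing.maximalIdeal Q := by
        rw [IsLocalRing.mem_maximalIdeal, mem_nonunits_iff]
        intro hu
        have := hu.map (algebraMap Q R)
        rw [hr0] at this
        exact not_isUnit_zero this
      have hle : ∀ a ∈ Ideal.span {r}, algebraMap Q R a = 0 := by
        intro a ha
        obtain ⟨c, rfl⟩ := Ideal.mem_span_singleton'.1 ha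
        rw [map_mul, hr0, mul_zero]
      let _ : Algebra (Q ⧸ Ideal.span {r}) R := (Ideal.Quotient.lift (Ideal.span {r}) (algebraMap Q R) hle).toAlgebra
      have hs' : Surjective (algebraMap (Q ⧸ Ideal.span {r}) R) := by
        intro y
        obtain ⟨q, rfl⟩ := hs y
        exact ⟨Ideal.Quotient.mk _ q, Ideal.Quotient.lift_mk _ _ _⟩
      have hnt : Nontrivial (Q ⧸ Ideal.span {r}) := Ideal.Quotient.nontrivial_iff.2 (fun h => by
        have h1 : (1 : Q) ∈ Ideal.span {r} := h ▸ trivial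
        have := hle 1 h1
        rw [map_one] at this
        exact one_ne_zero this)
      have : IsLocalRing (Q ⧸ Ideal.span {r}) := IsLocalRing.of_surjective' (Ideal.Quotient.mk _) Ideal.Quotient.mk_surjective
      refine ih (Q ⧸ Ideal.span {r}) hs' (fc_quot hreg hQ) ?_
      have h1 := ringKrullDim_quotient_span_singleton_succ_eq_ringKrullDim (R := Q) hreg hrm
      rw [← h1] at hn
      push_cast at hn
      exact lt_of_add_lt_add_right hn

lemma exists_gor {R : Type u} [CommRing R] [IsLocalRing R] [IsNoetherianRing R] (hCM : GG.IsCMLocalRing R)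
    (hR : GG.HasDualizingComplex R) :
    ∃ (Q : Type u) (_ : CommRing Q) (_ : Algebra Q R), IsLocalRing Q ∧ IsNoetherianRing Q ∧ Surjective (algebraMap Q R) ∧
      FC Q (Inj Q) Q ∧ ∀ i, EZ Q R Q (i + 1) := by
  obtain ⟨d, hd⟩ := exists_dim R
  obtain ⟨ys, hl, hm, hr⟩ := exists_of_mdepth (R := R) (M := R) (d := d) inferInstance (hCM.trans hd)
  obtain ⟨Q, hQ, -, hG, f, hf⟩ := hR
  let p : PrimeSpectrum Q := PrimeSpectrum.comap f (IsLocalRing.closedPoint R)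
  obtain ⟨n, hn⟩ := hG p
  have hu : ∀ y : p.asIdeal.primeCompl, IsUnit (f y) := by
    intro y
    by_contra hc
    exact y.2 hc
  let g : Localization.AtPrime p.asIdeal →+* R := IsLocalization.lift (M := p.asIdeal.primeCompl) hu
  let _ : Algebra (Localization.AtPrime p.asIdeal) R := g.toAlgebra
  have hg : Surjective (algebraMap (Localization.AtPrime p.asIdeal) R) := by
    intro y
    obtain ⟨q, rfl⟩ := hf y
    exact ⟨algebraMap Q _ q, IsLocalization.lift_eq (M := p.asIdeal.primeCompl) hu q⟩
  have : IsNoetherianRing (Localization.AtPrime p.asIdeal) := IsLocalization.isNoetherianRing p.asIdeal.primeCompl _ hQ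
  obtain ⟨N, hN⟩ := exists_dim (Localization.AtPrime p.asIdeal)
  refine exists_red hd hl hm hr (N + 1) (Localization.AtPrime p.asIdeal) hg ?_ ?_
  · exact FC.of_coresolution (Inj _) (fun N N' _ _ _ _ e h => inj_congr N N' e h) n _ hn
  · rw [hN]
    exact_mod_cast Nat.lt_succ_self N

end Red
end HH

namespace HH
open Function CategoryTheory CategoryTheory.Abelian RingTheory.Sequence
open scoped Pointwise

section TI
variable {Q : Type u} [CommRing Q]

/-- elements killed by an ideal -/
def TI (I : Ideal Q) (L : Type u) [AddCommGroup L] [Module Q L] : Submodule Q L where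
  carrier := {l | ∀ r ∈ I, r • l = 0}
  add_mem' ha hb r hr := by rw [smul_add, ha r hr, hb r hr, add_zero]
  zero_mem' r _ := smul_zero r
  smul_mem' c l hl r hr := by rw [smul_comm, hl r hr, smul_zero]

variable {I : Ideal Q}
variable {L G C X : Type u} [AddCommGroup L] [Module Q L] [AddCommGroup G] [Module Q G] [AddCommGroup C] [Module Q C]
  [AddCommGroup X] [Module Q X]

lemma mem_TI {l : L} : l ∈ TI I L ↔ ∀ r ∈ I, r • l = 0 := Iff.rfl

lemma kl_TI : Kl I (TI I L) := fun r hr k => Subtype.ext (k.2 r hr)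

/-- maps from killed modules corestrict -/
def toTI (hX : Kl I X) (φ : X →ₗ[Q] L) : X →ₗ[Q] TI I L :=
  φ.codRestrict _ (fun x r hr => by rw [← map_smul, hX r hr, map_zero])

lemma toTI_val (hX : Kl I X) (φ : X →ₗ[Q] L) (x : X) : (toTI hX φ x).1 = φ x := rfl

/-- functoriality -/
def timap (I : Ideal Q) (f : L →ₗ[Q] G) : TI I L →ₗ[Q] TI I G := toTI kl_TI (f.comp (TI I L).subtype)

lemma timap_val (f : L →ₗ[Q] G) (x : TI I L) : (timap I f x).1 = f x.1 := rfl

lemma ri_TI [h : Module.Injective Q L] : RI I (TI I L) := by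
  refine ⟨kl_TI, fun X Y _ _ _ _ hX hY f hf φ => ?_⟩
  obtain ⟨ψ, hψ⟩ := h.out f hf ((TI I L).subtype.comp φ)
  exact ⟨toTI hY ψ, fun v => Subtype.ext (hψ v)⟩

/-- the torsion functor is exact when Ext vanishes -/
lemma Ses.ti {f : L →ₗ[Q] G} {g : G →ₗ[Q] C} (h : Ses f g) (hL : EZ Q (Q ⧸ I) L 1) :
    Ses (timap I f) (timap I g) where
  inj u v huv := Subtype.ext (h.inj (congrArg Subtype.val huv))
  exact v := by
    constructor
    · intro hv
      obtain ⟨u, hu⟩ := (h.exact v.1).1 (congrArg Subtype.val hv)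
      refine ⟨⟨u, fun r hr => h.inj ?_⟩, Subtype.ext hu⟩
      rw [map_smul, hu, map_zero]; exact v.2 r hr
    · rintro ⟨u, rfl⟩; exact Subtype.ext (h.comp_zero _)
  surj c := by
    let φ : (Q ⧸ I) →ₗ[Q] C := Submodule.liftQ I (LinearMap.toSpanSingleton Q C c.1) (fun r hr => c.2 r hr)
    obtain ⟨ψ, hψ⟩ := h.lift1 hL φ
    have hk : Kl I (Q ⧸ I) := by
      intro r hr k
      obtain ⟨k, rfl⟩ := Ideal.Quotient.mk_surjective k
      have : Ideal.Quotient.mk I (r * k) = 0 := Ideal.Quotient.eq_zero_iff_mem.2 (Ideal.mul_mem_right _ _ hr)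
      exact this
    refine ⟨toTI hk ψ (Ideal.Quotient.mk I 1), Subtype.ext ?_⟩
    have := LinearMap.congr_fun hψ (Ideal.Quotient.mk I 1)
    refine this.trans ?_
    show (1 : Q) • c.1 = c.1
    rw [one_smul]

lemma FC.ti (hL : FC Q (Inj Q) L) : (∀ i, EZ Q (Q ⧸ I) L (i + 1)) → FC Q (RI I) (TI I L) := by
  induction hL with
  | of L h =>
    intro _
    have : Module.Injective Q L := h
    exact FC.of _ ri_TI
  | step L G C f g h hG hC ih =>
    intro hE
    have : Module.Injective Q G := hG
    exact FC.step _ _ _ _ _ (h.ti (hE 0)) ri_TI (ih fun i => h.ezY_quot (ez_inj i) (hE (i + 1)))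

lemma exists_emb (L : Type u) [AddCommGroup L] [Module Q L] :
    ∃ (G : Type u) (_ : AddCommGroup G) (_ : Module Q G) (f : L →ₗ[Q] G), Module.Injective Q G ∧ Injective f := by
  obtain ⟨J⟩ := EnoughInjectives.presentation (ModuleCat.of Q L)
  refine ⟨J.J, inferInstance, inferInstance, J.f.hom, ?_, (ModuleCat.mono_iff_injective J.f).1 inferInstance⟩
  exact (Module.injective_iff_injective_object Q J.J).2 J.injective

variable {S : Type u} [CommRing S] [Algebra Q S]

/-- scalar extension of the class of linear maps along a surjection -/
lemma Ses.ext_scalars (hs : Surjective (algebraMap Q S)) [Module S L] [IsScalarTower Q S L] [Module S G]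
    [IsScalarTower Q S G] [Module S C] [IsScalarTower Q S C] {f : L →ₗ[Q] G} {g : G →ₗ[Q] C} (h : Ses f g) :
    Ses (f.extendScalarsOfSurjective hs) (g.extendScalarsOfSurjective hs) := ⟨h.inj, h.exact, h.surj⟩

/-- change of rings for Ext -/
lemma ez_ti (hs : Surjective (algebraMap Q S)) [Module S X] [IsScalarTower Q S X] (i : ℕ) :
    ∀ (L : Type u) [AddCommGroup L] [Module Q L] [Module S (TI (RingHom.ker (algebraMap Q S)) L)]
      [IsScalarTower Q S (TI (RingHom.ker (algebraMap Q S)) L)]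
      (_ : ∀ i, EZ Q (Q ⧸ RingHom.ker (algebraMap Q S)) L (i + 1)) (_ : ∀ i, EZ Q X L (i + 1)),
      EZ S X (TI (RingHom.ker (algebraMap Q S)) L) (i + 1) := by
  induction i with
  | zero =>
    intro L _ _ _ _ h1 h2
    obtain ⟨G, _, _, f, hG, hf⟩ := exists_emb (Q := Q) L
    have h := ses_quot_range hf
    have h' := h.ti (h1 0)
    obtain ⟨i1, i2⟩ := exists_mod hs (TI (RingHom.ker (algebraMap Q S)) G) kl_TI
    obtain ⟨i3, i4⟩ := exists_mod hs (TI (RingHom.ker (algebraMap Q S)) (G ⧸ LinearMap.range f)) kl_TI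
    have : Module.Injective S (TI (RingHom.ker (algebraMap Q S)) G) := RI.toInj hs _ ri_TI
    refine (h'.ext_scalars hs).ez_of_lift (ez_inj 0) (fun φ => ?_)
    obtain ⟨ψ, hψ⟩ := h.lift1 (h2 0) ((Submodule.subtype _).comp (φ.restrictScalars Q))
    have hk : Kl (RingHom.ker (algebraMap Q S)) X := fun r hr x => by
      rw [← algebraMap_smul S r x, RingHom.mem_ker.1 hr, zero_smul]
    exact ⟨(toTI hk ψ).extendScalarsOfSurjective hs, LinearMap.ext fun x => Subtype.ext (LinearMap.congr_fun hψ x)⟩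
  | succ i ih =>
    intro L _ _ _ _ h1 h2
    obtain ⟨G, _, _, f, hG, hf⟩ := exists_emb (Q := Q) L
    have h := ses_quot_range hf
    have h' := h.ti (h1 0)
    obtain ⟨i1, i2⟩ := exists_mod hs (TI (RingHom.ker (algebraMap Q S)) G) kl_TI
    obtain ⟨i3, i4⟩ := exists_mod hs (TI (RingHom.ker (algebraMap Q S)) (G ⧸ LinearMap.range f)) kl_TI
    have : Module.Injective S (TI (RingHom.ker (algebraMap Q S)) G) := RI.toInj hs _ ri_TI
    exact (h'.ext_scalars hs).ezY_sub (ih _ (fun j => h.ezY_quot (ez_inj j) (h1 (j + 1)))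
      (fun j => h.ezY_quot (ez_inj j) (h2 (j + 1)))) (ez_inj _)

end TI

section Dual
variable {Q : Type u} [CommRing Q] [IsNoetherianRing Q]

lemma dual_props (I : Ideal Q) (hQ : FC Q (Inj Q) Q) (hE : ∀ i, EZ Q (Q ⧸ I) Q (i + 1)) :
    (∀ i, EZ Q (TI I Q) Q (i + 1)) ∧ (∀ φ : TI I Q →ₗ[Q] Q, ∃ q : Q, ∀ t, φ t = q * t.1) ∧
      (∀ q : Q, (∀ t ∈ TI I Q, q * t = 0) → q ∈ I) := by
  obtain ⟨c, h, e, hres, hc, he⟩ := exists_res' (R := Q) 1 (fun _ => (Ideal.Quotient.mk I 1 : Q ⧸ I)) (by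
    intro x
    obtain ⟨x, rfl⟩ := Ideal.Quotient.mk_surjective x
    refine ⟨fun _ => x, ?_⟩
    rw [comb_apply, Fintype.sum_subsingleton _ 0]
    show Ideal.Quotient.mk I (x * 1) = _
    rw [mul_one])
  obtain ⟨g, Gm, ε, hG, hg⟩ := exists_glue h (fun i => (hres.ez_iff Q i).1 (hE i))
  have hup := hg.up hQ
  have hss : Subsingleton (Fin (c 0)) := by rw [hc]; infer_instance
  let j0 : Fin (c 0) := Fin.cast hc.symm 0
  have hI : ∀ k, h 0 k j0 ∈ I := by
    intro k
    have := congrFun hres.act_e k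
    rw [act_apply, Fintype.sum_subsingleton _ j0, he] at this
    have h2 : Ideal.Quotient.mk I (h 0 k j0 * 1) = 0 := this
    rwa [mul_one, Ideal.Quotient.eq_zero_iff_mem] at h2
  have hI' : ∀ r ∈ I, ∃ w : Fin (c 1) → Q, r = ∑ k, h 0 k j0 * w k := by
    intro r hr
    have : comb (R := Q) e (fun _ => r) = 0 := by
      rw [comb_apply, Fintype.sum_subsingleton _ j0, he]
      exact Ideal.Quotient.eq_zero_iff_mem.2 (Ideal.mul_mem_right _ _ hr)
    obtain ⟨w, hw⟩ := (hres.ex0 _).1 this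
    exact ⟨w, (congrFun hw j0).symm⟩
  have hT : ∀ t : Fin (c 0) → Q, act (h 0) Q t = 0 ↔ t j0 ∈ TI I Q := by
    intro t
    constructor
    · intro ht r hr
      obtain ⟨w, rfl⟩ := hI' r hr
      rw [smul_eq_mul, Finset.sum_mul]
      refine Finset.sum_eq_zero fun k _ => ?_
      have := congrFun ht k
      rw [act_apply, Fintype.sum_subsingleton _ j0] at this
      rw [mul_right_comm]
      have h2 : h 0 k j0 * t j0 = 0 := this
      rw [h2, zero_mul]
    · intro ht
      funext k
      rw [act_apply, Fintype.sum_subsingleton _ j0]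
      exact ht _ (hI k)
  let θ : LinearMap.ker (act (h 0) Q) ≃ₗ[Q] TI I Q :=
    { toFun := fun t => ⟨t.1 j0, (hT t.1).1 t.2⟩
      map_add' := fun _ _ => rfl
      map_smul' := fun _ _ => rfl
      invFun := fun q => ⟨fun _ => q.1, (hT _).2 q.2⟩
      left_inv := fun t => Subtype.ext (funext fun j => by rw [Subsingleton.elim j j0])
      right_inv := fun _ => rfl }
  have hE' : ∀ (w : Fin (c 0) → Q) i, act (Matrix.of (fun j i => (ε i).1 j)).transpose Q w i = w j0 * (ε i).1 j0 := by
    intro w i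
    rw [act_apply, Fintype.sum_subsingleton _ j0]
    exact mul_comm _ _
  refine ⟨fun i => EZ.congrX θ ((hG.ez_iff Q i).2 (hup.eG i)), fun φ => ?_, fun q hq => ?_⟩
  · obtain ⟨w, hw⟩ := (hup.e0 _).1 (hG.hom_mem (φ.comp θ.toLinearMap))
    refine ⟨w j0, fun t => ?_⟩
    have : φ.comp θ.toLinearMap = (w j0) • ((TI I Q).subtype.comp θ.toLinearMap) := by
      refine hG.hom_ext fun i => ?_
      have := congrFun hw i
      rw [hE'] at this
      exact this.symm
    obtain ⟨t, rfl⟩ := θ.surjective t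
    exact LinearMap.congr_fun this t
  · have : act (Matrix.of (fun j i => (ε i).1 j)).transpose Q (fun _ => q) = 0 := by
      funext i
      rw [hE']
      exact hq _ ((hT _).1 (ε i).2)
    obtain ⟨w, hw⟩ := (hup.eE _).1 this
    have h2 := congrFun hw j0
    rw [← show _ = q from h2, act_apply]
    exact Ideal.sum_mem _ fun k _ => Ideal.mul_mem_right _ _ (hI k)

end Dual
end HH

namespace HH
open Function CategoryTheory CategoryTheory.Abelian RingTheory.Sequence
open scoped Pointwise

lemma exists_dz {R : Type u} [CommRing R] [IsLocalRing R] [IsNoetherianRing R] (hCM : GG.IsCMLocalRing R)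
    (hR : GG.HasDualizingComplex R) :
    ∃ (ω : Type u) (_ : AddCommGroup ω) (_ : Module R ω) (b : ℕ → ℕ)
      (A : ∀ i, Matrix (Fin (b (i + 1))) (Fin (b i)) R) (e : Fin (b 0) → ω), Dz A e := by
  obtain ⟨Q, _, _, _, _, hs, hQ, hE⟩ := exists_gor hCM hR
  have eq : R ≃ₗ[Q] (Q ⧸ RingHom.ker (algebraMap Q R)) :=
    ((LinearMap.quotKerEquivOfSurjective (Algebra.linearMap Q R) hs).symm)
  have hE' : ∀ i, EZ Q (Q ⧸ RingHom.ker (algebraMap Q R)) Q (i + 1) := fun i => EZ.congrX eq (hE i)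
  obtain ⟨h1, h2, h3⟩ := dual_props (RingHom.ker (algebraMap Q R)) hQ hE'
  obtain ⟨i1, i2⟩ := exists_mod hs (TI (RingHom.ker (algebraMap Q R)) Q) kl_TI
  have : Module.Finite R (TI (RingHom.ker (algebraMap Q R)) Q) := Module.Finite.of_restrictScalars_finite Q _ _
  obtain ⟨b, A, e, hres⟩ := exists_res R (TI (RingHom.ker (algebraMap Q R)) Q)
  refine ⟨TI (RingHom.ker (algebraMap Q R)) Q, inferInstance, i1, b, A, e, hres, FC.conv hs (hQ.ti hE'), ?_, ?_, ?_⟩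
  · intro i
    exact (hres.ez_iff _ i).1 (ez_ti hs i Q hE' h1)
  · intro v hv
    obtain ⟨φ, hφ⟩ := hres.exists_hom v hv
    obtain ⟨q, hq⟩ := h2 ((Submodule.subtype _).comp (φ.restrictScalars Q))
    refine ⟨algebraMap Q R q, fun j => ?_⟩
    rw [← hφ j, algebraMap_smul]
    exact Subtype.ext (hq (e j))
  · intro r hr
    obtain ⟨q, rfl⟩ := hs r
    refine h3 q fun t ht => ?_
    obtain ⟨w, hw⟩ := hres.surj ⟨t, ht⟩
    have : algebraMap Q R q • (⟨t, ht⟩ : TI (RingHom.ker (algebraMap Q R)) Q) = 0 := by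
      rw [← hw, comb_apply, Finset.smul_sum]
      refine Finset.sum_eq_zero fun j _ => ?_
      rw [smul_comm, hr, smul_zero]
    rw [algebraMap_smul] at this
    exact congrArg Subtype.val this

lemma final {R : Type u} [CommRing R] [IsLocalRing R] [IsNoetherianRing R] (hCM : GG.IsCMLocalRing R)
    (hR : GG.HasDualizingComplex R) (M : Type u) [AddCommGroup M] [Module R M] [Module.Finite R M]
    (hM : GG.IsMaximalCM R M) (xs : List R) (hx : IsRegular R xs) :
    (∃ n, GG.gidLE R M n) ↔
      ∃ n, GG.gidLE (R ⧸ Ideal.ofList xs) (M ⧸ (Ideal.ofList xs • (⊤ : Submodule R M))) n := by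
  obtain ⟨ω, _, _, b, A, e, D⟩ := exists_dz hCM hR
  have hω : Module.Finite R ω := Module.Finite.of_surjective (comb (R := R) e) D.res.surj
  obtain ⟨d, hd⟩ := exists_dim R
  have hMd : Module.supportDim R M = d := hM.2.trans hd
  have hn : Nontrivial M := by
    by_contra hc
    rw [not_nontrivial_iff_subsingleton] at hc
    rw [(Module.supportDim_eq_bot_iff_subsingleton R M).2 hc] at hMd
    exact WithBot.bot_ne_coe hMd
  obtain ⟨ys, hl, hym, hyr⟩ := exists_of_mdepth (R := R) (M := M) (d := d) hn (hM.1.trans hMd)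
  have hxm : ∀ r ∈ xs, r ∈ IsLocalRing.maximalIdeal R := by
    intro r hr
    have h1 : Ideal.ofList xs ≠ ⊤ := by
      intro h
      refine hx.top_ne_smul ?_
      rw [h, Submodule.top_smul]
    exact IsLocalRing.le_maximalIdeal h1 (Ideal.subset_span hr)
  have hk := ez_rees hym hyr
  rw [hl] at hk
  refine fin_aux D M ?_ xs hxm hx.toIsWeaklyRegular ?_
  · intro i
    obtain ⟨zs, hz1, hz2, f, hf⟩ := exists_socle R
    refine ez_list_down ys M hym hyr.toIsWeaklyRegular (i + 1) (ez_depth D.fc hz2.toIsWeaklyRegular hf _ ?_ _)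
    have h := ringKrullDim_add_length_eq_ringKrullDim_of_isRegular zs hz2
    have hn : Nontrivial (R ⧸ Ideal.ofList zs) := by
      refine Ideal.Quotient.nontrivial_iff.2 fun h => hz2.top_ne_smul ?_
      rw [h, Submodule.top_smul]
    have h0 : 0 ≤ ringKrullDim (R ⧸ Ideal.ofList zs) := ringKrullDim_nonneg_of_nontrivial
    rw [hd] at h
    have : ((zs.length : ℕ) : WithBot ℕ∞) ≤ (d : ℕ) := by
      rw [← h]
      exact le_add_of_nonneg_left h0
    have : zs.length ≤ d := by exact_mod_cast this
    omega
  · refine reg_of_low xs R M d ?_ ?_ hk hxm hx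
    · rw [Module.supportDim_self_eq_ringKrullDim, hd]
    · intro q _
      refine Module.mem_support_iff_of_finite.2 fun r hr => ?_
      have := Module.mem_annihilator.1 hr 1
      rw [smul_eq_mul, mul_one] at this
      rw [this]
      exact q.asIdeal.zero_mem

end HH

open GG in
/-- For a maximal Cohen–Macaulay module `M` over a Cohen–Macaulay local ring and an
`R`-regular sequence `x`, `Gid_R M < ∞` iff `Gid_{R/xR} (M/xM) < ∞`. -/
theorem stmt11 (R : Type u) [CommRing R] [IsLocalRing R] [IsNoetherianRing R]
    (hCM : IsCMLocalRing R) (hR : HasDualizingComplex R)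
    (M : ModuleCat.{u} R) (hMf : Module.Finite R M) (hMCM : IsMaximalCM R M)
    (xs : List R) (hxR : RingTheory.Sequence.IsRegular R xs) :
    (∃ n, gidLE R M n) ↔
      ∃ n, gidLE (R ⧸ Ideal.span {r | r ∈ xs})
        (M ⧸ (Ideal.span {r | r ∈ xs} • (⊤ : Submodule R M))) n := by
  exact HH.final hCM hR M hMCM xs hxR
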